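/- arXiv:1509.06191 — 2 statements merged into one kernel-verified Lean document; each statement's English description precedes it below -/
import Mathlib

section
/- For all real numbers α ∈ (0,1] and μ ∈ (0,1] there exists δ > 0 (depending only on α and μ) with the following property: for every finite set Ω, every two-step probability distribution P on Ω² with equal marginals satisfying α(P) ≥ α, every n ≥ 1, and every function f : Ωⁿ → [0,1] with E[f(X)] = μ (where the pairs (Xᵢ,Yᵢ), i = 1,…,n, are i.i.d. with law P), one has E[f(X)·f(Y)] ≥ δ. -/
namespace SameSetHitting

/-- `P` is a probability distribution on a finite type. -/
def IsDist {α : Type} [Fintype α] (P : α → ℝ) : Prop :=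
  (∀ x, 0 ≤ P x) ∧ ∑ x, P x = 1

open Classical in
/-- The `j`-th marginal of an `ℓ`-step distribution `P`. -/
noncomputable def marginal {Ω : Type} [Fintype Ω] {ℓ : ℕ}
    (P : (Fin ℓ → Ω) → ℝ) (j : Fin ℓ) (a : Ω) : ℝ :=
  ∑ x : Fin ℓ → Ω, if x j = a then P x else 0

/-- All `ℓ` marginals of `P` are equal to `π`. -/
def HasMarginals {Ω : Type} [Fintype Ω] {ℓ : ℕ}
    (P : (Fin ℓ → Ω) → ℝ) (π : Ω → ℝ) : Prop :=
  ∀ j a, marginal P j a = π a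

/-- The expectation `E[f(X)]` where `X` has the product law `πⁿ`. -/
noncomputable def exps {Ω : Type} [Fintype Ω] {n : ℕ}
    (π : Ω → ℝ) (f : (Fin n → Ω) → ℝ) : ℝ :=
  ∑ v : Fin n → Ω, (∏ i, π (v i)) * f v

/-- `E[∏_{j} f_j(X^{(j)})]` where the tuples `(X_i^{(1)}, …, X_i^{(ℓ)})`,
`i = 1, …, n`, are i.i.d. with law `P` and `X^{(j)} = (X_1^{(j)}, …, X_n^{(j)})`. -/
noncomputable def prodExp {Ω : Type} [Fintype Ω] {ℓ n : ℕ}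
    (P : (Fin ℓ → Ω) → ℝ) (f : Fin ℓ → ((Fin n → Ω) → ℝ)) : ℝ :=
  ∑ x : Fin ℓ → Fin n → Ω, (∏ i, P (fun j => x j i)) * ∏ j, f j (x j)

/-- Expectation under the single-coordinate multi-step distribution `P`. -/
noncomputable def expP {Ω : Type} [Fintype Ω] {ℓ : ℕ}
    (P : (Fin ℓ → Ω) → ℝ) (f : (Fin ℓ → Ω) → ℝ) : ℝ :=
  ∑ x, P x * f x

/-- Covariance under `P`. -/
noncomputable def covP {Ω : Type} [Fintype Ω] {ℓ : ℕ}
    (P : (Fin ℓ → Ω) → ℝ) (f g : (Fin ℓ → Ω) → ℝ) : ℝ :=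
  expP P (fun x => f x * g x) - expP P f * expP P g

/-- Variance under `P`. -/
noncomputable def varP {Ω : Type} [Fintype Ω] {ℓ : ℕ}
    (P : (Fin ℓ → Ω) → ℝ) (f : (Fin ℓ → Ω) → ℝ) : ℝ :=
  covP P f f

/-- `f` depends only on the coordinates in `S`. -/
def DependsOn {Ω : Type} {ℓ : ℕ} (f : (Fin ℓ → Ω) → ℝ) (S : Finset (Fin ℓ)) : Prop :=
  ∀ x y : Fin ℓ → Ω, (∀ j ∈ S, x j = y j) → f x = f y

/-- The correlation `ρ(P, S, T)`. -/
noncomputable def rhoST {Ω : Type} [Fintype Ω] {ℓ : ℕ}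
    (P : (Fin ℓ → Ω) → ℝ) (S T : Finset (Fin ℓ)) : ℝ :=
  sSup {r : ℝ | ∃ f g : (Fin ℓ → Ω) → ℝ, DependsOn f S ∧ DependsOn g T ∧
    varP P f = 1 ∧ varP P g = 1 ∧ r = covP P f g}

/-- The correlation `ρ(P) = max_j ρ(P, {j}, [ℓ]∖{j})`. -/
noncomputable def rho {Ω : Type} [Fintype Ω] {ℓ : ℕ} (P : (Fin ℓ → Ω) → ℝ) : ℝ :=
  ⨆ j : Fin ℓ, rhoST P {j} ({j}ᶜ)

/-- Expectation under the single-step distribution `π`. -/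
noncomputable def expPi {Ω : Type} [Fintype Ω] (π : Ω → ℝ) (f : Ω → ℝ) : ℝ :=
  ∑ a, π a * f a

/-- Variance under the single-step distribution `π`. -/
noncomputable def varPi {Ω : Type} [Fintype Ω] (π : Ω → ℝ) (f : Ω → ℝ) : ℝ :=
  expPi π (fun a => (f a - expPi π f) ^ 2)

/-- The influence `Inf_i(f(X))` of coordinate `i`, where `X` has product law `πⁿ`. -/
noncomputable def influence {Ω : Type} [Fintype Ω] {n : ℕ}
    (π : Ω → ℝ) (i : Fin n) (f : (Fin n → Ω) → ℝ) : ℝ :=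
  ∑ v : Fin n → Ω, (∏ k, π (v k)) * varPi π (fun a => f (Function.update v i a))

/-- The function obtained from `f` by applying the restriction `R`
(`none` means unrestricted). -/
def restrict {Ω : Type} {n : ℕ} (R : Fin n → Option Ω)
    (f : (Fin n → Ω) → ℝ) : (Fin n → Ω) → ℝ :=
  fun x => f (fun i => (R i).getD (x i))

/-- The size (number of restricted coordinates) of a restriction. -/
def restSize {Ω : Type} {n : ℕ} (R : Fin n → Option Ω) : ℕ :=
  (Finset.univ.filter (fun i => (R i).isSome = true)).card

/-- `f` is `ε`-resilient up to size `k` (with respect to the product law `πⁿ`). -/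
def Resilient {Ω : Type} [Fintype Ω] {n : ℕ} (π : Ω → ℝ) (ε : ℝ) (k : ℕ)
    (f : (Fin n → Ω) → ℝ) : Prop :=
  ∀ R : Fin n → Option Ω, restSize R ≤ k →
    (1 - ε) * exps π f ≤ exps π (restrict R f) ∧
    exps π (restrict R f) ≤ (1 + ε) * exps π f

/-- The restriction operator `R[i,a]`. -/
def restrOp {Ω : Type} {n : ℕ} (i : Fin n) (a : Ω)
    (f : (Fin n → Ω) → ℝ) : (Fin n → Ω) → ℝ :=
  fun x => f (Function.update x i a)

/-- The maximum operator `M[i,y,z]`. -/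
def maxOp {Ω : Type} {n : ℕ} (i : Fin n) (y z : Ω)
    (f : (Fin n → Ω) → ℝ) : (Fin n → Ω) → ℝ :=
  fun x => max (f (Function.update x i y)) (f (Function.update x i z))

/-- Insert the value `a` at position `j` into `w : Ω^{[ℓ] ∖ {j}}`. -/
def ins {Ω : Type} {ℓ : ℕ} (j : Fin ℓ) (w : {k : Fin ℓ // k ≠ j} → Ω) (a : Ω) :
    Fin ℓ → Ω :=
  fun k => if h : k = j then a else w ⟨k, h⟩

/-- The probability that the coordinates other than `j` equal `w`. -/
noncomputable def margOff {Ω : Type} [Fintype Ω] {ℓ : ℕ}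
    (P : (Fin ℓ → Ω) → ℝ) (j : Fin ℓ) (w : {k : Fin ℓ // k ≠ j} → Ω) : ℝ :=
  ∑ a, P (ins j w a)

open Classical in
/-- The joint law of `(Y, Z)` for a double sample on step `j` from `P`. -/
noncomputable def doubleSample {Ω : Type} [Fintype Ω] {ℓ : ℕ}
    (P : (Fin ℓ → Ω) → ℝ) (j : Fin ℓ) (y z : Ω) : ℝ :=
  ∑ w : {k : Fin ℓ // k ≠ j} → Ω,
    if margOff P j w = 0 then 0
    else P (ins j w y) * P (ins j w z) / margOff P j w

end SameSetHitting

namespace SSH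
open Finset

/-- mean over the cycle -/
noncomputable def mn {N : ℕ} [NeZero N] (f : ZMod N → ℝ) : ℝ := (∑ z, f z) / N

/-- expectation over a lazy cycle step -/
noncomputable def pe {N : ℕ} [NeZero N] (p q : ℝ) (F : ZMod N → ZMod N → ℝ) : ℝ :=
  mn (fun z => q * F z z + p * F z (z + 1))

/-- variance -/
noncomputable def vr {N : ℕ} [NeZero N] (A : ZMod N → ℝ) : ℝ := mn (fun z => (A z - mn A) ^ 2)

section one
variable {N : ℕ} [NeZero N]

lemma Npos : (0 : ℝ) < N := Nat.cast_pos.mpr (NeZero.pos N)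

lemma mn_add (f g : ZMod N → ℝ) : mn (fun z => f z + g z) = mn f + mn g := by
  simp [mn, sum_add_distrib, add_div]
lemma mn_sub (f g : ZMod N → ℝ) : mn (fun z => f z - g z) = mn f - mn g := by
  simp [mn, sum_sub_distrib, sub_div]
lemma mn_mul (c : ℝ) (f : ZMod N → ℝ) : mn (fun z => c * f z) = c * mn f := by
  simp [mn, ← mul_sum, mul_div_assoc]
lemma mn_const (c : ℝ) : mn (fun _ : ZMod N => c) = c := by
  have := (Npos (N := N)).ne'
  simp [mn, ZMod.card]
  field_simp
lemma mn_le {f g : ZMod N → ℝ} (h : ∀ z, f z ≤ g z) : mn f ≤ mn g := by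
  unfold mn
  have := (Npos (N := N)).le
  gcongr with z
  exact h z
lemma mn_nonneg {f : ZMod N → ℝ} (h : ∀ z, 0 ≤ f z) : 0 ≤ mn f := by
  have := mn_le h; rwa [mn_const] at this
lemma mn_le_one {f : ZMod N → ℝ} (h : ∀ z, f z ≤ 1) : mn f ≤ 1 := by
  have := mn_le h; rwa [mn_const] at this
lemma mn_shift (f : ZMod N → ℝ) : mn (fun z => f (z + 1)) = mn f := by
  unfold mn
  rw [Equiv.sum_comp (Equiv.addRight (1 : ZMod N)) f |>.symm]
  rfl
lemma le_mn {f : ZMod N → ℝ} (h : ∀ z, 0 ≤ f z) (z : ZMod N) : f z ≤ N * mn f := by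
  unfold mn
  rw [mul_div_cancel₀ _ (Npos (N := N)).ne']
  exact single_le_sum (fun i _ => h i) (mem_univ z)
lemma mn_comm (F : ZMod N → ZMod N → ℝ) :
    mn (fun x => mn (fun y => F x y)) = mn (fun y => mn (fun x => F x y)) := by
  simp only [mn, ← sum_div]
  rw [sum_comm]
lemma exists_ge_mn (f : ZMod N → ℝ) : ∃ z, mn f ≤ f z := by
  by_contra! h
  have : mn f < mn f := by
    conv_lhs => unfold mn
    rw [div_lt_iff₀ Npos]
    calc ∑ z, f z < ∑ z : ZMod N, mn f := sum_lt_sum_of_nonempty univ_nonempty (fun z _ => h z)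
      _ = mn f * N := by simp [ZMod.card, mul_comm]
  exact lt_irrefl _ this
lemma mn_cs (u v : ZMod N → ℝ) :
    (mn fun z => u z * v z) ^ 2 ≤ (mn fun z => u z ^ 2) * (mn fun z => v z ^ 2) := by
  unfold mn
  rw [div_pow, div_mul_div_comm, ← sq]
  have := (Npos (N := N)).le
  gcongr
  exact sum_mul_sq_le_sq_mul_sq _ _ _

variable {p q : ℝ}

lemma pe_le (hp : 0 ≤ p) (hq : 0 ≤ q) {F G : ZMod N → ZMod N → ℝ} (h : ∀ x y, F x y ≤ G x y) :
    pe p q F ≤ pe p q G := by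
  apply mn_le
  intro z
  gcongr
  · exact h _ _
  · exact h _ _
lemma pe_add (F G : ZMod N → ZMod N → ℝ) :
    pe p q (fun x y => F x y + G x y) = pe p q F + pe p q G := by
  unfold pe; rw [← mn_add]; congr 1; ext z; ring
lemma pe_sub (F G : ZMod N → ZMod N → ℝ) :
    pe p q (fun x y => F x y - G x y) = pe p q F - pe p q G := by
  unfold pe; rw [← mn_sub]; congr 1; ext z; ring
lemma pe_mul (c : ℝ) (F : ZMod N → ZMod N → ℝ) :
    pe p q (fun x y => c * F x y) = c * pe p q F := by
  unfold pe; rw [← mn_mul]; congr 1; ext z; ring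
lemma pe_const (h : p + q = 1) (c : ℝ) : pe p q (fun _ _ : ZMod N => c) = c := by
  have : pe p q (fun _ _ : ZMod N => c) = mn (fun _ : ZMod N => c) := by
    unfold pe; congr 1; ext z; linear_combination c * h
  rw [this, mn_const]
lemma pe_fst (h : p + q = 1) (f : ZMod N → ℝ) : pe p q (fun x _ => f x) = mn f := by
  unfold pe
  congr 1; ext z; rw [← add_mul, add_comm, h, one_mul]
lemma pe_snd (h : p + q = 1) (f : ZMod N → ℝ) : pe p q (fun _ y => f y) = mn f := by
  unfold pe
  rw [mn_add, mn_mul, mn_mul, mn_shift, ← add_mul, add_comm, h, one_mul]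
lemma pe_nonneg (hp : 0 ≤ p) (hq : 0 ≤ q) {F : ZMod N → ZMod N → ℝ} (h : ∀ x y, 0 ≤ F x y) :
    0 ≤ pe p q F := by
  apply mn_nonneg
  intro z
  have := h z z
  have := h z (z+1)
  positivity
lemma pe_sum {ι : Type*} (s : Finset ι) (F : ι → ZMod N → ZMod N → ℝ) :
    pe p q (fun x y => ∑ i ∈ s, F i x y) = ∑ i ∈ s, pe p q (F i) := by
  unfold pe mn
  rw [← sum_div, sum_comm]
  congr 1
  apply sum_congr rfl
  intro z _
  simp only [sum_add_distrib, mul_sum]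

lemma path_bound (v : ZMod N → ℝ) (D : ℝ) (hD : ∀ z, |v (z + 1) - v z| ≤ D) (a b : ZMod N) :
    |v b - v a| ≤ N * D := by
  have key : ∀ k : ℕ, |v (a + k) - v a| ≤ k * D := by
    intro k
    induction k with
    | zero => simp
    | succ k ih =>
      have h1 := hD (a + k)
      have : v (a + ((k + 1 : ℕ) : ZMod N)) - v a
          = (v (a + k + 1) - v (a + k)) + (v (a + k) - v a) := by push_cast; ring_nf
      rw [this]
      refine (abs_add_le _ _).trans ?_
      push_cast; linarith
  have h := key (b - a).val
  rw [ZMod.natCast_zmod_val, add_sub_cancel] at h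
  have hD0 : 0 ≤ D := (abs_nonneg _).trans (hD a)
  have : (((b - a).val : ℕ) : ℝ) ≤ N := by exact_mod_cast (ZMod.val_lt (b - a)).le
  exact h.trans (by gcongr)

lemma path_bound_mn (v : ZMod N → ℝ) (D : ℝ) (hD : ∀ z, |v (z + 1) - v z| ≤ D) (a : ZMod N) :
    |v a - mn v| ≤ N * D := by
  have : v a - mn v = mn (fun z => v a - v z) := by rw [mn_sub, mn_const]
  rw [this, abs_le]
  constructor
  · rw [← mn_const (N := N) (-(N * D))]
    apply mn_le
    intro z
    exact (abs_le.1 (path_bound v D hD z a)).1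
  · rw [← mn_const (N := N) (N * D)]
    apply mn_le
    intro z
    exact (abs_le.1 (path_bound v D hD z a)).2

lemma poincare (v : ZMod N → ℝ) (hv : mn v = 0) :
    mn (fun z => v z ^ 2) ≤ (N : ℝ) ^ 3 * mn (fun z => (v (z + 1) - v z) ^ 2) := by
  set S := mn (fun z => (v (z + 1) - v z) ^ 2)
  have hS : ∀ z, |v (z + 1) - v z| ≤ Real.sqrt (N * S) := by
    intro z
    apply Real.abs_le_sqrt
    exact le_mn (f := fun z => (v (z + 1) - v z) ^ 2) (fun z => sq_nonneg _) z
  have hS0 : 0 ≤ S := mn_nonneg (fun z => sq_nonneg _)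
  rw [← mn_const (N := N) (_ * S)]
  apply mn_le
  intro a
  have := path_bound_mn v _ hS a
  rw [hv, sub_zero] at this
  have h2 : v a ^ 2 ≤ (N * Real.sqrt (N * S)) ^ 2 := by
    rw [← sq_abs]; gcongr
  rw [mul_pow, Real.sq_sqrt (by have := Npos (N := N); positivity)] at h2
  linarith

/-- variance bounded by L1 gradient -/
lemma vr_le_grad (v : ZMod N → ℝ) (h0 : ∀ z, 0 ≤ v z) (h1 : ∀ z, v z ≤ 1) :
    vr v ≤ (N : ℝ) ^ 3 * mn (fun z => |v z - v (z + 1)|) := by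
  unfold vr
  have h := poincare (fun z => v z - mn v) (by rw [mn_sub, mn_const, sub_self])
  refine h.trans ?_
  have := Npos (N := N)
  gcongr
  apply mn_le
  intro z
  have e : (v (z + 1) - mn v - (v z - mn v)) ^ 2 = |v z - v (z+1)| * |v z - v (z+1)| := by
    rw [← sq, sq_abs]; ring
  rw [e]
  have : |v z - v (z+1)| ≤ 1 := by
    rw [abs_le]; constructor <;> linarith [h0 z, h1 z, h0 (z+1), h1 (z+1)]
  nlinarith [abs_nonneg (v z - v (z+1))]

lemma vr_nonneg (A : ZMod N → ℝ) : 0 ≤ vr A := mn_nonneg fun _ => sq_nonneg _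

lemma vr_eq (A : ZMod N → ℝ) : vr A = mn (fun z => A z ^ 2) - mn A ^ 2 := by
  unfold vr
  have : (fun z => (A z - mn A) ^ 2) = fun z => A z ^ 2 - ((2 * mn A) * A z - mn A ^ 2) := by
    ext z; ring
  rw [this, mn_sub, mn_sub, mn_mul, mn_const]; ring

lemma cov_bound (hp : 0 < p) (hq : 0 < q) (h : p + q = 1) :
    ∃ ρ : ℝ, 0 ≤ ρ ∧ ρ < 1 ∧ ∀ u v : ZMod N → ℝ, mn v = 0 →
      |pe p q (fun x y => u x * v y)| ≤
        ρ * (Real.sqrt (mn fun z => u z ^ 2) * Real.sqrt (mn fun z => v z ^ 2)) := by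
  have hN := Npos (N := N)
  have hN1 : (1 : ℝ) ≤ (N : ℝ) ^ 3 := one_le_pow₀ (by exact_mod_cast NeZero.one_le)
  have hpq : p * q ≤ 1 := by nlinarith
  have hd : 0 < p * q / (N : ℝ) ^ 3 := by positivity
  have hd1 : p * q / (N : ℝ) ^ 3 ≤ 1 := by
    rw [div_le_one (by positivity)]; linarith
  refine ⟨Real.sqrt (1 - p * q / (N : ℝ) ^ 3), Real.sqrt_nonneg _, ?_, ?_⟩
  · rw [Real.sqrt_lt' one_pos]; linarith
  intro u v hv
  have e1 : pe p q (fun x y => u x * v y) = mn (fun z => u z * (q * v z + p * v (z + 1))) := by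
    unfold pe; congr 1; ext z; ring
  have e2 : mn (fun z => (q * v z + p * v (z + 1)) ^ 2)
      = mn (fun z => v z ^ 2) - p * q * mn (fun z => (v (z + 1) - v z) ^ 2) := by
    have : (fun z => (q * v z + p * v (z + 1)) ^ 2) = fun z =>
        (q * v z ^ 2 + p * v (z+1) ^ 2) - (p * q) * (v (z + 1) - v z) ^ 2 := by
      ext z
      have : q = 1 - p := by linarith
      subst this; ring
    rw [this, mn_sub, mn_mul, mn_add, mn_mul, mn_mul, mn_shift (fun z => v z ^ 2)]
    linear_combination (mn fun z => v z ^ 2) * h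
  have e3 := poincare v hv
  have e4 : p * q / (N : ℝ) ^ 3 * mn (fun z => v z ^ 2)
      ≤ p * q * mn (fun z => (v (z + 1) - v z) ^ 2) := by
    rw [div_mul_eq_mul_div, div_le_iff₀ (by positivity)]
    have := mul_le_mul_of_nonneg_left e3 (mul_pos hp hq).le
    linarith
  rw [e1, ← Real.sqrt_mul (mn_nonneg fun _ => sq_nonneg _), ← Real.sqrt_mul (by linarith)]
  apply Real.abs_le_sqrt
  refine (mn_cs _ _).trans ?_
  rw [e2]
  have h0 : 0 ≤ mn (fun z => u z ^ 2) := mn_nonneg fun _ => sq_nonneg _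
  nlinarith

lemma rpow_lower {x M ε : ℝ} (hx : 0 ≤ x) (hxM : x ≤ M) (h0 : 0 < ε) (h1 : ε ≤ 1 / 2) :
    1 + (2 - ε) * (x - 1) + (1 - ε * (M + 1)) * (x - 1) ^ 2 ≤ x ^ (2 - ε) := by
  rcases hx.eq_or_lt with rfl | hx
  · rw [Real.zero_rpow (by linarith)]
    nlinarith
  have h2 : x ^ (2 - ε) = x ^ 2 * Real.exp (- ε * Real.log x) := by
    rw [sub_eq_add_neg, Real.rpow_add hx, Real.rpow_def_of_pos hx (-ε)]
    norm_num
    left; ring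
  have h3 := Real.add_one_le_exp (- ε * Real.log x)
  have h4 := Real.log_le_sub_one_of_pos hx
  rw [h2]
  have h5 : x ^ 2 * (1 - ε * (x - 1)) ≤ x ^ 2 * Real.exp (- ε * Real.log x) := by
    gcongr
    nlinarith
  refine le_trans ?_ h5
  have h6 : ε * ((x - 1) ^ 2 * (x + 1)) ≤ ε * ((x - 1) ^ 2 * (M + 1)) := by gcongr
  nlinarith

lemma hyper_aux {ρ ε : ℝ} (hε0 : 0 < ε) (hε : ε ≤ 1 / 2) (hρ0 : 0 ≤ ρ)
    (hερ : ρ ≤ 1 - ε * (N + 1)) (F : ZMod N → ℝ) (hF : ∀ z, 0 ≤ F z) :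
    mn F ^ 2 + ρ * vr F ≤ (mn fun z => F z ^ (2 - ε)) ^ (2 / (2 - ε)) := by
  have hN := Npos (N := N)
  have he : 0 ≤ mn F := mn_nonneg hF
  have hG : 0 ≤ mn fun z => F z ^ (2 - ε) := mn_nonneg fun z => Real.rpow_nonneg (hF z) _
  rcases he.eq_or_lt with he | he
  · have : F = fun _ => 0 := by
      ext z
      have := le_mn hF z
      rw [← he, mul_zero] at this
      exact le_antisymm this (hF z)
    have hv : vr F = 0 := by rw [vr_eq, this]; simp [mn]
    rw [← he, hv]
    simp
    positivity
  set e := mn F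
  have key : mn (fun z => 1 + (2 - ε) * (F z / e - 1) + ρ * (F z / e - 1) ^ 2)
      ≤ mn (fun z => (F z / e) ^ (2 - ε)) := by
    apply mn_le
    intro z
    have := rpow_lower (x := F z / e) (M := N) (by have := hF z; positivity)
      (by rw [div_le_iff₀ he]; exact le_mn hF z) hε0 hε
    refine le_trans ?_ this
    gcongr
  have k1 : mn (fun z => 1 + (2 - ε) * (F z / e - 1) + ρ * (F z / e - 1) ^ 2)
      = 1 + ρ * vr F / e ^ 2 := by
    have : (fun z => 1 + (2 - ε) * (F z / e - 1) + ρ * (F z / e - 1) ^ 2) = fun z =>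
      1 + (((2 - ε) / e) * (F z - e) + (ρ / e ^ 2) * (F z - e) ^ 2) := by
      ext z; field_simp; ring
    rw [this, mn_add, mn_add, mn_mul, mn_mul, mn_sub, mn_const, mn_const]
    change 1 + ((2 - ε) / e * (e - e) + ρ / e ^ 2 * vr F) = _
    ring
  have k2 : mn (fun z => (F z / e) ^ (2 - ε)) = (mn fun z => F z ^ (2 - ε)) / e ^ (2 - ε) := by
    have : (fun z => (F z / e) ^ (2 - ε)) = fun z => (e ^ (2 - ε))⁻¹ * F z ^ (2 - ε) := by
      ext z; rw [Real.div_rpow (hF z) he.le]; ring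
    rw [this, mn_mul]; ring
  rw [k1, k2] at key
  set G := mn fun z => F z ^ (2 - ε)
  have hv := vr_nonneg F
  have k3 : 1 + ρ * vr F / e ^ 2 ≤ (G / e ^ (2 - ε)) ^ (2 / (2 - ε)) := by
    have h1 : 1 ≤ G / e ^ (2 - ε) := le_trans (by
      have : 0 ≤ ρ * vr F / e ^ 2 := by positivity
      linarith) key
    calc _ ≤ G / e ^ (2 - ε) := key
      _ = (G / e ^ (2 - ε)) ^ (1:ℝ) := (Real.rpow_one _).symm
      _ ≤ _ := Real.rpow_le_rpow_of_exponent_le h1 (by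
        rw [le_div_iff₀ (by linarith)]; linarith)
  rw [Real.div_rpow hG (by positivity), ← Real.rpow_mul he.le,
    mul_div_cancel₀ _ (by linarith : 2 - ε ≠ 0), Real.rpow_two, le_div_iff₀ (by positivity)] at k3
  calc _ = (1 + ρ * vr F / e ^ 2) * e ^ 2 := by field_simp
    _ ≤ _ := k3

lemma pe_cov (h : p + q = 1) (F G : ZMod N → ℝ) :
    pe p q (fun x y => F x * G y) = mn F * mn G
      + pe p q (fun x y => (F x - mn F) * (G y - mn G)) := by
  have : (fun x y => (F x - mn F) * (G y - mn G)) = fun x y =>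
    F x * G y - (mn G * F x + (mn F * G y - mn F * mn G)) := by ext x y; ring
  rw [this, pe_sub, pe_add, pe_sub, pe_mul, pe_mul, pe_fst h, pe_snd h, pe_const h]; ring

lemma hyper (hp : 0 < p) (hq : 0 < q) (h : p + q = 1) :
    ∃ t : ℝ, 1 / 2 < t ∧ t < 1 ∧ ∀ A B : ZMod N → ℝ, (∀ z, 0 ≤ A z) → (∀ z, 0 ≤ B z) →
      pe p q (fun x y => A x ^ t * B y ^ t) ≤ mn A ^ t * mn B ^ t := by
  obtain ⟨ρ, hρ0, hρ1, hρ⟩ := cov_bound (N := N) hp hq h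
  have hN := Npos (N := N)
  have hN1 : (1 : ℝ) ≤ N := by exact_mod_cast NeZero.one_le
  set ε := (1 - ρ) / (N + 1) with hεd
  have hε0 : 0 < ε := div_pos (by linarith) (by linarith)
  have hε1 : ε ≤ 1 / 2 := by
    rw [div_le_iff₀ (by linarith)]; linarith
  have hερ : ρ ≤ 1 - ε * (N + 1) := by
    rw [hεd, div_mul_cancel₀ _ (by linarith)]; linarith
  have h2 : 0 < 2 - ε := by linarith
  refine ⟨1 / (2 - ε), ?_, ?_, ?_⟩
  · rw [div_lt_div_iff₀ (by norm_num) h2]; linarith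
  · rw [div_lt_one h2]; linarith
  intro A B hA hB
  have main : ∀ A : ZMod N → ℝ, (∀ z, 0 ≤ A z) →
      mn (fun z => A z ^ (1 / (2 - ε))) ^ 2 + ρ * vr (fun z => A z ^ (1 / (2 - ε)))
        ≤ (mn A ^ (1 / (2 - ε))) ^ 2 := by
    intro A hA
    refine (hyper_aux hε0 hε1 hρ0 hερ _ (fun z => Real.rpow_nonneg (hA z) _)).trans (le_of_eq ?_)
    have : (fun z => (A z ^ (1 / (2 - ε))) ^ (2 - ε)) = A := by
      ext z
      rw [← Real.rpow_mul (hA z), one_div_mul_cancel h2.ne', Real.rpow_one]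
    rw [this, ← Real.rpow_natCast, ← Real.rpow_mul (mn_nonneg hA)]
    congr 1
    push_cast; ring
  have hA' := main A hA
  have hB' := main B hB
  rw [pe_cov h]
  set F := fun z => A z ^ (1 / (2 - ε))
  set G := fun z => B z ^ (1 / (2 - ε))
  have hc := (le_abs_self _).trans (hρ (fun z => F z - mn F) (fun z => G z - mn G)
    (by rw [mn_sub, mn_const, sub_self]))
  change _ ≤ ρ * (Real.sqrt (vr F) * Real.sqrt (vr G)) at hc
  have sF := Real.sq_sqrt (vr_nonneg F)
  have sG := Real.sq_sqrt (vr_nonneg G)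
  have a0 : 0 ≤ mn A ^ (1 / (2 - ε)) := Real.rpow_nonneg (mn_nonneg hA) _
  have b0 : 0 ≤ mn B ^ (1 / (2 - ε)) := Real.rpow_nonneg (mn_nonneg hB) _
  refine le_trans (add_le_add_right hc _) ?_
  refine le_of_sq_le_sq ?_ (by positivity)
  rw [mul_pow]
  refine le_trans ?_ (mul_le_mul hA' hB' (by have := vr_nonneg G; positivity) (by positivity))
  set x := Real.sqrt (vr F)
  set y := Real.sqrt (vr G)
  rw [← sF, ← sG]
  nlinarith [mul_nonneg hρ0 (sq_nonneg (mn F * y - mn G * x))]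

end one
end SSH

namespace SSH
open Finset

lemma alpha_lower (s : ℕ) (t : ℝ) (ht : -1 ≤ t) :
    (s + 1 : ℝ) * t ^ 2 ≤ (1 + t) ^ (s + 2) - 1 - (s + 2) * t := by
  induction s with
  | zero => norm_num; nlinarith
  | succ s ih =>
    have h0 : 0 ≤ 1 + t := by linarith
    have h1 : 0 ≤ (s + 1 : ℝ) * t ^ 2 := by positivity
    have h2 := mul_nonneg h0 (h1.trans ih)
    have e : (1 + t) ^ (s + 1 + 2) = (1 + t) * (1 + t) ^ (s + 2) := by ring
    rw [e]; push_cast; nlinarith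

lemma alpha_upper (s : ℕ) (L : ℝ) (hL : 1 ≤ L) : ∃ C : ℝ, 0 ≤ C ∧ ∀ t, |t| ≤ L →
    |(1 + t) ^ s - 1 - s * t| ≤ C * t ^ 2 := by
  induction s with
  | zero => exact ⟨0, le_rfl, fun t _ => by simp⟩
  | succ s ih =>
    obtain ⟨C, hC0, hC⟩ := ih
    refine ⟨s + (1 + L) * C, by positivity, fun t ht => ?_⟩
    have e : (1 + t) ^ (s + 1) - 1 - ((s + 1 : ℕ) : ℝ) * t
        = s * t ^ 2 + (1 + t) * ((1 + t) ^ s - 1 - s * t) := by push_cast; ring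
    rw [e]
    have h1 : |1 + t| ≤ 1 + L := (abs_add_le _ _).trans (by simpa using ht)
    calc _ ≤ |(s : ℝ) * t ^ 2| + |(1 + t) * ((1 + t) ^ s - 1 - s * t)| := abs_add_le _ _
      _ ≤ s * t ^ 2 + (1 + L) * (C * t ^ 2) := by
        rw [abs_of_nonneg (by positivity), abs_mul]
        gcongr
        exact hC t ht
      _ = _ := by ring

lemma alpha_second (s : ℕ) (L : ℝ) (hL : 1 ≤ L) : ∃ C : ℝ, 0 ≤ C ∧ ∀ t, |t| ≤ L →
    |(1 + t) ^ s - 1 - s * t - s * (s - 1) / 2 * t ^ 2| ≤ C * |t| ^ 3 := by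
  induction s with
  | zero => exact ⟨0, le_rfl, fun t _ => by simp⟩
  | succ s ih =>
    obtain ⟨C, hC0, hC⟩ := ih
    obtain ⟨C', hC0', hC'⟩ := alpha_upper s L hL
    refine ⟨C + C', by positivity, fun t ht => ?_⟩
    have e : (1 + t) ^ (s + 1) - 1 - ((s + 1 : ℕ) : ℝ) * t
          - ((s + 1 : ℕ) : ℝ) * (((s + 1 : ℕ) : ℝ) - 1) / 2 * t ^ 2
        = ((1 + t) ^ s - 1 - s * t - s * (s - 1) / 2 * t ^ 2)
          + t * ((1 + t) ^ s - 1 - s * t) := by push_cast; ring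
    rw [e]
    calc _ ≤ _ := abs_add_le _ _
      _ ≤ C * |t| ^ 3 + |t| * (C' * t ^ 2) := by
        rw [abs_mul]
        gcongr
        · exact hC t ht
        · exact hC' t ht
      _ = _ := by rw [← sq_abs t]; ring

/-- the purely real part of the Bellman estimate -/
lemma real_part (S ρ C L : ℝ) (hS : 2 ≤ S) (hρ0 : 0 ≤ ρ) (hSρ : 1 ≤ S - 1 - S * ρ)
    (hC : 0 ≤ C) (hL : 1 ≤ L) : ∃ C0 : ℝ, 0 ≤ C0 ∧
    ∀ m n a b : ℝ, 0 ≤ m → 0 ≤ n → m ≤ L → n ≤ L →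
      m ^ 2 ≤ a → n ^ 2 ≤ b → S * (S - 1) / 2 * m ^ 2 - C * m ^ 3 ≤ a →
      S * (S - 1) / 2 * n ^ 2 - C * n ^ 3 ≤ b →
      - C0 * (m ^ 2 * n ^ 2) ≤ a + b - S ^ 2 * ρ * (m * n) - C * (m * n * (m + n)) := by
  set θ := 1 / (2 * C + 2) with hθ
  have hθ0 : 0 < θ := by positivity
  have hθC : 2 * C * θ ≤ 1 := by
    rw [hθ, mul_one_div, div_le_one (by positivity)]; linarith
  set C3 := S ^ 2 * ρ + 2 * L * C with hC3
  have hC30 : 0 ≤ C3 := by positivity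
  refine ⟨C3 ^ 2 / θ ^ 2, by positivity, ?_⟩
  have big : ∀ m n a b : ℝ, 0 ≤ m → 0 ≤ n → m ≤ L → n ≤ L → m ^ 2 ≤ a → n ^ 2 ≤ b → θ < m →
      - (C3 ^ 2 / θ ^ 2) * (m ^ 2 * n ^ 2)
        ≤ a + b - S ^ 2 * ρ * (m * n) - C * (m * n * (m + n)) := by
    intro m n a b hm hn hmL hnL ha hb hmθ
    have h1 : C * (m * n * (m + n)) ≤ C * (m * n * (2 * L)) := by
      gcongr; linarith
    have h2 : m ^ 2 - C3 * (m * n) ≥ - (C3 ^ 2 * n ^ 2) := by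
      nlinarith [sq_nonneg (m - C3 * n), sq_nonneg (m + C3 * n), mul_nonneg hC30 (mul_nonneg hm hn), sq_nonneg (m - 2 * (C3 * n)), sq_nonneg (C3 * n)]
    have h3 : C3 ^ 2 * n ^ 2 ≤ (C3 ^ 2 / θ ^ 2) * (m ^ 2 * n ^ 2) := by
      rw [div_mul_eq_mul_div, le_div_iff₀ (by positivity)]
      have : θ ^ 2 ≤ m ^ 2 := by gcongr
      have h4 : 0 ≤ C3 ^ 2 * n ^ 2 := by positivity
      nlinarith
    have : 0 ≤ n ^ 2 := sq_nonneg n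
    nlinarith
  intro m n a b hm hn hmL hnL ha hb ha' hb'
  by_cases hmθ : θ < m
  · exact big m n a b hm hn hmL hnL ha hb hmθ
  by_cases hnθ : θ < n
  · have := big n m b a hn hm hnL hmL hb ha hnθ
    linarith
  push Not at hmθ hnθ
  have h1 : C * m ^ 3 ≤ 1 / 2 * m ^ 2 := by
    have : C * m ≤ 1 / 2 := by nlinarith
    nlinarith [sq_nonneg m]
  have h2 : C * n ^ 3 ≤ 1 / 2 * n ^ 2 := by
    have : C * n ≤ 1 / 2 := by nlinarith
    nlinarith [sq_nonneg n]
  have h3 : C * (m * n * (m + n)) ≤ m * n := by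
    have : C * (m + n) ≤ 1 := by nlinarith
    nlinarith [mul_nonneg hm hn]
  have h0 : 0 ≤ C3 ^ 2 / θ ^ 2 * (m ^ 2 * n ^ 2) := by positivity
  have h4 : S ^ 2 * ρ ≤ S * (S - 2) := by nlinarith
  have h5 : S ^ 2 * ρ * (m * n) ≤ S * (S - 2) * (m * n) := by
    have := mul_nonneg hm hn
    gcongr
  have h6 : 0 ≤ S * (S - 2) := by nlinarith
  have h7 := mul_nonneg h6 (sq_nonneg (m - n))
  nlinarith [sq_nonneg (m - n), sq_nonneg m, sq_nonneg n]

section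
variable {N : ℕ} [NeZero N] {p q : ℝ}

lemma abs_mn_le (f : ZMod N → ℝ) : |mn f| ≤ mn (fun z => |f z|) := by
  unfold mn
  rw [abs_div, abs_of_pos (Npos (N := N))]
  have := (Npos (N := N)).le
  gcongr
  exact abs_sum_le_sum_abs _ _

lemma abs_pe_le (hp : 0 ≤ p) (hq : 0 ≤ q) (F : ZMod N → ZMod N → ℝ) :
    |pe p q F| ≤ pe p q (fun x y => |F x y|) := by
  refine (abs_mn_le _).trans (mn_le fun z => ?_)
  refine (abs_add_le _ _).trans ?_
  rw [abs_mul, abs_mul, abs_of_nonneg hp, abs_of_nonneg hq]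

lemma bellman0 (hp : 0 < p) (hq : 0 < q) (h : p + q = 1) :
    ∃ s : ℕ, 1 ≤ s ∧ ∀ L : ℝ, 1 ≤ L → ∃ C : ℝ, 0 ≤ C ∧ ∀ u v : ZMod N → ℝ,
      (∀ z, -1 ≤ u z) → (∀ z, u z ≤ L) → (∀ z, -1 ≤ v z) → (∀ z, v z ≤ L) →
      mn u = 0 → mn v = 0 →
      1 - C * ((mn fun z => u z ^ 2) * (mn fun z => v z ^ 2))
        ≤ pe p q (fun x y => (1 + u x) ^ s * (1 + v y) ^ s) := by
  obtain ⟨ρ, hρ0, hρ1, hρ⟩ := cov_bound (N := N) hp hq h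
  obtain ⟨s0, hs0⟩ := exists_nat_ge (2 / (1 - ρ))
  refine ⟨s0 + 2, by omega, fun L hL => ?_⟩
  set s := s0 + 2 with hs
  have hsR : (s : ℝ) = s0 + 2 := by rw [hs]; push_cast; ring
  have hSρ : 1 ≤ (s : ℝ) - 1 - s * ρ := by
    rw [div_le_iff₀ (by linarith)] at hs0
    rw [hsR]; nlinarith
  obtain ⟨C1, hC1, h1⟩ := alpha_upper s L hL
  obtain ⟨C2, hC2, h2⟩ := alpha_second s L hL
  set R := Real.sqrt N with hR
  have hN := Npos (N := N)
  have hR0 : 0 ≤ R := Real.sqrt_nonneg _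
  obtain ⟨C0, hC0, hreal⟩ := real_part s ρ (C2 * R + s * C1 * R) L
    (by rw [hsR]; linarith [Nat.cast_nonneg (α := ℝ) s0]) hρ0 hSρ (by positivity) hL
  refine ⟨C0, hC0, ?_⟩
  intro u v hu1 huL hv1 hvL hu0 hv0
  -- properties for a single function
  have single : ∀ u : ZMod N → ℝ, (∀ z, -1 ≤ u z) → (∀ z, u z ≤ L) →
      (∀ z, |u z| ≤ R * Real.sqrt (mn fun z => u z ^ 2)) ∧
      Real.sqrt (mn fun z => u z ^ 2) ≤ L ∧
      (mn fun z => u z ^ 2) ≤ mn (fun z => (1 + u z) ^ s - 1 - s * u z) ∧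
      (s : ℝ) * (s - 1) / 2 * Real.sqrt (mn fun z => u z ^ 2) ^ 2
        - C2 * R * Real.sqrt (mn fun z => u z ^ 2) ^ 3
        ≤ mn (fun z => (1 + u z) ^ s - 1 - s * u z) := by
    intro u hu1 huL
    have hsq0 : 0 ≤ mn fun z => u z ^ 2 := mn_nonneg fun _ => sq_nonneg _
    have habs : ∀ z, |u z| ≤ L := fun z => abs_le.2 ⟨by linarith [hu1 z], huL z⟩
    have hsup : ∀ z, |u z| ≤ R * Real.sqrt (mn fun z => u z ^ 2) := by
      intro z
      rw [hR, ← Real.sqrt_mul hN.le]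
      exact Real.abs_le_sqrt (le_mn (f := fun z => u z ^ 2) (fun _ => sq_nonneg _) z)
    refine ⟨hsup, ?_, ?_, ?_⟩
    · apply Real.sqrt_le_iff.2 ⟨by linarith, ?_⟩
      rw [← mn_const (N := N) (L ^ 2)]
      apply mn_le
      intro z
      rw [← sq_abs]
      have := habs z
      gcongr
    · apply mn_le
      intro z
      have := alpha_lower s0 (u z) (hu1 z)
      rw [hsR]
      refine le_trans ?_ this
      nlinarith [sq_nonneg (u z), mul_nonneg (Nat.cast_nonneg (α := ℝ) s0) (sq_nonneg (u z))]
    · set m := Real.sqrt (mn fun z => u z ^ 2)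
      have hm : m ^ 2 = mn fun z => u z ^ 2 := Real.sq_sqrt hsq0
      have : (s : ℝ) * (s - 1) / 2 * m ^ 2 - C2 * R * m ^ 3
          = mn (fun z => ((s : ℝ) * (s - 1) / 2 - C2 * R * m) * u z ^ 2) := by
        rw [mn_mul, ← hm]; ring
      rw [this]
      apply mn_le
      intro z
      have a1 := (abs_le.1 (h2 (u z) (habs z))).1
      have a2 : C2 * |u z| ^ 3 ≤ C2 * (R * m) * u z ^ 2 := by
        have : |u z| ^ 3 = |u z| * u z ^ 2 := by rw [← sq_abs (u z)]; ring
        rw [this, mul_assoc]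
        gcongr
        exact hsup z
      linarith
  obtain ⟨u1, u2, u3, u4⟩ := single u hu1 huL
  obtain ⟨v1, v2, v3, v4⟩ := single v hv1 hvL
  have hmsq : Real.sqrt (mn fun z => u z ^ 2) ^ 2 = mn fun z => u z ^ 2 :=
    Real.sq_sqrt (mn_nonneg fun _ => sq_nonneg _)
  have hnsq : Real.sqrt (mn fun z => v z ^ 2) ^ 2 = mn fun z => v z ^ 2 :=
    Real.sq_sqrt (mn_nonneg fun _ => sq_nonneg _)
  have hcov := (abs_le.1 (hρ u v hv0)).1
  have hm0 : 0 ≤ Real.sqrt (mn fun z => u z ^ 2) := Real.sqrt_nonneg _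
  have hn0 : 0 ≤ Real.sqrt (mn fun z => v z ^ 2) := Real.sqrt_nonneg _
  set m := Real.sqrt (mn fun z => u z ^ 2)
  set n := Real.sqrt (mn fun z => v z ^ 2)
  set α : ZMod N → ℝ := fun z => (1 + u z) ^ s - 1 - s * u z with hα
  set β : ZMod N → ℝ := fun z => (1 + v z) ^ s - 1 - s * v z with hβ
  have hα0 : ∀ z, 0 ≤ α z := by
    intro z
    have := alpha_lower s0 (u z) (hu1 z)
    simp only [hα, hsR]
    exact le_trans (by positivity) this
  have hβ0 : ∀ z, 0 ≤ β z := by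
    intro z
    have := alpha_lower s0 (v z) (hv1 z)
    simp only [hβ, hsR]
    exact le_trans (by positivity) this
  have hαu : ∀ z, α z ≤ C1 * u z ^ 2 := fun z =>
    (le_abs_self _).trans (h1 _ (abs_le.2 ⟨by linarith [hu1 z], huL z⟩))
  have hβu : ∀ z, β z ≤ C1 * v z ^ 2 := fun z =>
    (le_abs_self _).trans (h1 _ (abs_le.2 ⟨by linarith [hv1 z], hvL z⟩))
  have expand : pe p q (fun x y => (1 + u x) ^ s * (1 + v y) ^ s)
      = 1 + (s : ℝ) ^ 2 * pe p q (fun x y => u x * v y) + mn α + mn β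
        + s * pe p q (fun x y => u x * β y) + s * pe p q (fun x y => α x * v y)
        + pe p q (fun x y => α x * β y) := by
    have : (fun x y => (1 + u x) ^ s * (1 + v y) ^ s) = fun x y =>
        1 + ((s : ℝ) ^ 2 * (u x * v y) + (α x + (β y + (s * (u x * β y) + (s * (α x * v y)
          + (α x * β y + (s * u x + s * v y))))))) := by
      ext x y; simp only [hα, hβ]; ring
    rw [this]
    simp only [pe_add, pe_mul, pe_fst h, pe_snd h]
    rw [mn_const, mn_mul, mn_mul, hu0, hv0]
    ring
  have t1 : |pe p q (fun x y => u x * β y)| ≤ C1 * R * m * n ^ 2 := by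
    refine (abs_pe_le hp.le hq.le _).trans ?_
    have : C1 * R * m * n ^ 2 = pe p q (fun _ y : ZMod N => (C1 * R * m) * v y ^ 2) := by
      rw [pe_snd h (fun y => (C1 * R * m) * v y ^ 2), mn_mul, hnsq]
    rw [this]
    refine pe_le hp.le hq.le fun x y => ?_
    rw [abs_mul, abs_of_nonneg (hβ0 y)]
    calc |u x| * β y ≤ (R * m) * (C1 * v y ^ 2) := by
          gcongr
          · exact hβ0 y
          · exact u1 x
          · exact hβu y
      _ = _ := by ring
  have t2 : |pe p q (fun x y => α x * v y)| ≤ C1 * R * n * m ^ 2 := by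
    refine (abs_pe_le hp.le hq.le _).trans ?_
    have : C1 * R * n * m ^ 2 = pe p q (fun x _ : ZMod N => (C1 * R * n) * u x ^ 2) := by
      rw [pe_fst h (fun y => (C1 * R * n) * u y ^ 2), mn_mul, hmsq]
    rw [this]
    refine pe_le hp.le hq.le fun x y => ?_
    rw [abs_mul, abs_of_nonneg (hα0 x)]
    calc α x * |v y| ≤ (C1 * u x ^ 2) * (R * n) := by
          gcongr
          · exact hαu x
          · exact v1 y
      _ = _ := by ring
  have t3 : 0 ≤ pe p q (fun x y => α x * β y) :=
    pe_nonneg hp.le hq.le fun x y => mul_nonneg (hα0 x) (hβ0 y)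
  rw [← hmsq] at u3
  rw [← hnsq] at v3
  have hextra : ∀ w : ℝ, 0 ≤ w → 0 ≤ s * C1 * R * w ^ 3 := fun w hw => by positivity
  have fin := hreal m n (mn α) (mn β) hm0 hn0 u2 v2 u3 v3
    (by have := hextra m hm0; linarith) (by have := hextra n hn0; linarith)
  rw [expand, ← hmsq, ← hnsq]
  have s0' : (0:ℝ) ≤ s := Nat.cast_nonneg _
  have t1' := mul_le_mul_of_nonneg_left (abs_le.1 t1).1 s0'
  have t2' := mul_le_mul_of_nonneg_left (abs_le.1 t2).1 s0'
  have c' := mul_le_mul_of_nonneg_left hcov (sq_nonneg (s:ℝ))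
  have x1 : 0 ≤ C2 * R * (m * n * (m + n)) := by positivity
  linarith

lemma bellman1 (hp : 0 < p) (hq : 0 < q) (h : p + q = 1) :
    ∃ s : ℕ, 1 ≤ s ∧ ∀ κ : ℝ, 0 < κ → κ ≤ 1 → ∃ C : ℝ, 0 ≤ C ∧ ∀ A B : ZMod N → ℝ,
      (∀ z, 0 ≤ A z) → (∀ z, A z ≤ 1) → (∀ z, 0 ≤ B z) → (∀ z, B z ≤ 1) →
      κ ≤ mn A → κ ≤ mn B →
      mn A ^ s * mn B ^ s - C * (vr A * vr B) ≤ pe p q (fun x y => A x ^ s * B y ^ s) := by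
  obtain ⟨s, hs, H⟩ := bellman0 (N := N) hp hq h
  refine ⟨s, hs, fun κ hκ hκ1 => ?_⟩
  obtain ⟨C, hC, hH⟩ := H (1 / κ) (by rw [le_div_iff₀ hκ]; linarith)
  refine ⟨C / κ ^ 4, by positivity, ?_⟩
  intro A B hA0 hA1 hB0 hB1 ha hb
  have ha0 : 0 < mn A := hκ.trans_le ha
  have hb0 : 0 < mn B := hκ.trans_le hb
  have ha1 : mn A ≤ 1 := mn_le_one hA1
  have hb1 : mn B ≤ 1 := mn_le_one hB1
  have prep : ∀ A : ZMod N → ℝ, (∀ z, 0 ≤ A z) → (∀ z, A z ≤ 1) → κ ≤ mn A →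
      (∀ z, -1 ≤ (A z - mn A) / mn A) ∧ (∀ z, (A z - mn A) / mn A ≤ 1 / κ) ∧
      mn (fun z => (A z - mn A) / mn A) = 0 ∧
      mn (fun z => ((A z - mn A) / mn A) ^ 2) ≤ vr A / κ ^ 2 := by
    intro A hA0 hA1 ha
    have ha0 : 0 < mn A := hκ.trans_le ha
    refine ⟨fun z => ?_, fun z => ?_, ?_, ?_⟩
    · rw [le_div_iff₀ ha0]; linarith [hA0 z]
    · rw [div_le_div_iff₀ ha0 hκ]; nlinarith [hA1 z]
    · have : (fun z => (A z - mn A) / mn A) = fun z => (mn A)⁻¹ * (A z - mn A) := by ext z; ring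
      rw [this, mn_mul, mn_sub, mn_const]; ring
    · have : (fun z => ((A z - mn A) / mn A) ^ 2) = fun z => (mn A ^ 2)⁻¹ * (A z - mn A) ^ 2 := by
        ext z; rw [div_pow]; ring
      rw [this, mn_mul, ← div_eq_inv_mul]
      change vr A / mn A ^ 2 ≤ _
      have := vr_nonneg A
      gcongr
  obtain ⟨a1, a2, a3, a4⟩ := prep A hA0 hA1 ha
  obtain ⟨b1, b2, b3, b4⟩ := prep B hB0 hB1 hb
  have := hH _ _ a1 a2 b1 b2 a3 b3
  have e : pe p q (fun x y => A x ^ s * B y ^ s) = (mn A ^ s * mn B ^ s) *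
      pe p q (fun x y => (1 + (A x - mn A) / mn A) ^ s * (1 + (B y - mn B) / mn B) ^ s) := by
    rw [← pe_mul]
    congr 1; ext x y
    have hx : mn A * (1 + (A x - mn A) / mn A) = A x := by field_simp; ring
    have hy : mn B * (1 + (B y - mn B) / mn B) = B y := by field_simp; ring
    rw [mul_mul_mul_comm, ← mul_pow (mn A), ← mul_pow (mn B), hx, hy]
  rw [e]
  have hw0 : 0 ≤ mn A ^ s * mn B ^ s := by positivity
  have hw1 : mn A ^ s * mn B ^ s ≤ 1 :=
    mul_le_one₀ (pow_le_one₀ ha0.le ha1) (by positivity) (pow_le_one₀ hb0.le hb1)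
  have k := mul_le_mul_of_nonneg_left this hw0
  refine le_trans ?_ k
  have vA := vr_nonneg A
  have vB := vr_nonneg B
  have k2 : C * ((mn fun z => ((A z - mn A) / mn A) ^ 2) * (mn fun z => ((B z - mn B) / mn B) ^ 2))
      ≤ C / κ ^ 4 * (vr A * vr B) := by
    calc _ ≤ C * ((vr A / κ ^ 2) * (vr B / κ ^ 2)) := by
          gcongr
          exact mn_nonneg fun _ => sq_nonneg _
      _ = _ := by field_simp
  have k3 : 0 ≤ C * ((mn fun z => ((A z - mn A) / mn A) ^ 2) * (mn fun z => ((B z - mn B) / mn B) ^ 2)) :=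
    mul_nonneg hC (mul_nonneg (mn_nonneg fun _ => sq_nonneg _) (mn_nonneg fun _ => sq_nonneg _))
  nlinarith
end
end SSH

namespace SSH
open Finset

/-- functions on the `n`-th power of the cycle, curried -/
def T (N : ℕ) : ℕ → Type
  | 0 => ℝ
  | n + 1 => ZMod N → T N n

section trees
variable {N : ℕ} [NeZero N]

/-- average -/
noncomputable def av : ∀ {n : ℕ}, T N n → ℝ
  | 0, f => (f : ℝ)
  | _ + 1, f => mn (fun z => av (f z))

/-- bilinear expectation -/
noncomputable def hit (p q : ℝ) : ∀ {n : ℕ}, T N n → T N n → ℝ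
  | 0, f, g => (show ℝ from f) * (show ℝ from g)
  | _ + 1, f, g => pe p q (fun x y => hit p q (f x) (g y))

/-- values in the unit interval -/
def tB : ∀ {n : ℕ}, T N n → Prop
  | 0, f => 0 ≤ (show ℝ from f) ∧ (show ℝ from f) ≤ 1
  | _ + 1, f => ∀ z, tB (f z)

/-- pointwise order -/
def tle : ∀ {n : ℕ}, T N n → T N n → Prop
  | 0, f, g => (show ℝ from f) ≤ (show ℝ from g)
  | _ + 1, f, g => ∀ z, tle (f z) (g z)

/-- pointwise maximum -/
noncomputable def tmax : ∀ {n : ℕ}, T N n → T N n → T N n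
  | 0, f, g => @max ℝ _ f g
  | _ + 1, f, g => fun z => tmax (f z) (g z)

/-- L1 distance -/
noncomputable def dd : ∀ {n : ℕ}, T N n → T N n → ℝ
  | 0, f, g => |(show ℝ from f) - (show ℝ from g)|
  | _ + 1, f, g => mn (fun z => dd (f z) (g z))

/-- freeze a coordinate -/
def upd : ∀ {n : ℕ}, ℕ → ZMod N → T N n → T N n
  | 0, _, _, f => f
  | _ + 1, 0, z, f => fun _ => f z
  | _ + 1, i + 1, z, f => fun x => upd i z (f x)

/-- variance-type influence -/
noncomputable def W : ℕ → ∀ {n : ℕ}, T N n → ℝ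
  | _, 0, _ => 0
  | 0, _ + 1, f => vr (fun z => av (f z))
  | i + 1, _ + 1, f => mn (fun z => W i (f z))

/-- loss term -/
noncomputable def Lo (p q : ℝ) : ℕ → ∀ {n : ℕ}, T N n → T N n → ℝ
  | _, 0, _, _ => 0
  | 0, _ + 1, f, g => vr (fun z => av (f z)) * vr (fun z => av (g z))
  | i + 1, _ + 1, f, g => pe p q (fun x y => Lo p q i (f x) (g y))

/-- average of the square -/
noncomputable def asq : ∀ {n : ℕ}, T N n → ℝ
  | 0, f => (show ℝ from f) ^ 2
  | _ + 1, f => mn (fun z => asq (f z))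

lemma av_nonneg : ∀ {n : ℕ} {f : T N n}, tB f → 0 ≤ av f
  | 0, _, h => h.1
  | _ + 1, _, h => mn_nonneg fun z => av_nonneg (h z)

lemma av_le_one : ∀ {n : ℕ} {f : T N n}, tB f → av f ≤ 1
  | 0, _, h => h.2
  | _ + 1, _, h => mn_le_one fun z => av_le_one (h z)

lemma asq_le_one : ∀ {n : ℕ} {f : T N n}, tB f → asq f ≤ 1
  | 0, _, h => pow_le_one₀ h.1 h.2
  | _ + 1, _, h => mn_le_one fun z => asq_le_one (h z)

lemma tB_tmax : ∀ {n : ℕ} {f g : T N n}, tB f → tB g → tB (tmax f g)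
  | 0, _, _, hf, hg => ⟨le_max_of_le_left hf.1, max_le hf.2 hg.2⟩
  | _ + 1, _, _, hf, hg => fun z => tB_tmax (hf z) (hg z)

lemma tB_upd : ∀ {n : ℕ} (i : ℕ) (z : ZMod N) {f : T N n}, tB f → tB (upd i z f)
  | 0, _, _, _, h => h
  | _ + 1, 0, z, _, h => fun _ => h z
  | _ + 1, i + 1, z, _, h => fun x => tB_upd i z (h x)

lemma tle_tmax : ∀ {n : ℕ} (f g : T N n), tle f (tmax f g)
  | 0, _, _ => le_max_left _ _
  | _ + 1, f, g => fun z => tle_tmax (f z) (g z)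

lemma tmax_self : ∀ {n : ℕ} (f : T N n), tmax f f = f
  | 0, f => max_self (show ℝ from f)
  | _ + 1, f => funext fun z => tmax_self (f z)

lemma dd_nonneg : ∀ {n : ℕ} (f g : T N n), 0 ≤ dd f g
  | 0, _, _ => abs_nonneg _
  | _ + 1, f, g => mn_nonneg fun z => dd_nonneg (f z) (g z)

lemma av_tmax : ∀ {n : ℕ} (f g : T N n), av (tmax f g) = 2⁻¹ * (av f + av g + dd f g)
  | 0, f, g => by
    change max (show ℝ from f) (show ℝ from g) = 2⁻¹ * ((show ℝ from f) + (show ℝ from g)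
      + |(show ℝ from f) - (show ℝ from g)|)
    generalize (show ℝ from f) = a
    generalize (show ℝ from g) = b
    rcases le_total a b with h | h
    · rw [max_eq_right h, abs_of_nonpos (by linarith)]; ring
    · rw [max_eq_left h, abs_of_nonneg (by linarith)]; ring
  | _ + 1, f, g => by
    simp only [av, dd, tmax]
    rw [← mn_add, ← mn_add, ← mn_mul]
    congr 1; ext z; exact av_tmax (f z) (g z)

lemma abs_av_sub_le : ∀ {n : ℕ} (f g : T N n), |av f - av g| ≤ dd f g
  | 0, _, _ => le_rfl
  | _ + 1, f, g => by
    simp only [av, dd]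
    rw [← mn_sub]
    exact (abs_mn_le _).trans (mn_le fun z => abs_av_sub_le (f z) (g z))

lemma mn_av_upd : ∀ {n : ℕ} (i : ℕ) (f : T N n), mn (fun z => av (upd i z f)) = av f
  | 0, _, f => mn_const _
  | _ + 1, 0, f => by
    change mn (fun z => mn (fun _ => av (f z))) = mn (fun z => av (f z))
    simp only [mn_const]
  | _ + 1, i + 1, f => by
    change mn (fun z => mn (fun x => av (upd i z (f x)))) = mn (fun z => av (f z))
    rw [mn_comm]
    congr 1; ext x; exact mn_av_upd i (f x)

lemma W_le_dd : ∀ {n : ℕ} (i : ℕ) {g : T N n}, tB g →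
    W i g ≤ (N : ℝ) ^ 3 * mn (fun z => dd (upd i z g) (upd i (z + 1) g))
  | 0, 0, g, _ => mul_nonneg (by positivity) (mn_nonneg fun _ => dd_nonneg _ _)
  | 0, i + 1, g, _ => mul_nonneg (by positivity) (mn_nonneg fun _ => dd_nonneg _ _)
  | _ + 1, 0, g, h => by
    change vr (fun z => av (g z)) ≤ (N : ℝ) ^ 3 * mn (fun z => mn (fun _ => dd (g z) (g (z + 1))))
    simp only [mn_const]
    refine (vr_le_grad _ (fun z => av_nonneg (h z)) (fun z => av_le_one (h z))).trans ?_
    gcongr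
    exact mn_le fun z => abs_av_sub_le _ _
  | _ + 1, i + 1, g, h => by
    change mn (fun x => W i (g x)) ≤
      (N : ℝ) ^ 3 * mn (fun z => mn (fun x => dd (upd i z (g x)) (upd i (z + 1) (g x))))
    rw [mn_comm, ← mn_mul]
    exact mn_le fun x => W_le_dd i (h x)

lemma exists_raise {n : ℕ} (i : ℕ) {g : T N n} (h : tB g) :
    ∃ z, av g + W i g / (2 * (N : ℝ) ^ 3) ≤ av (tmax (upd i z g) (upd i (z + 1) g)) := by
  obtain ⟨z, hz⟩ := exists_ge_mn (fun z => av (tmax (upd i z g) (upd i (z + 1) g)))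
  refine ⟨z, le_trans ?_ hz⟩
  simp only [av_tmax]
  rw [mn_mul, mn_add, mn_add, mn_shift (fun z => av (upd i z g)), mn_av_upd]
  have := W_le_dd i h
  have hN : (0 : ℝ) < (N : ℝ) ^ 3 := pow_pos Npos 3
  have : W i g / (2 * (N : ℝ) ^ 3) ≤ 2⁻¹ * mn (fun z => dd (upd i z g) (upd i (z + 1) g)) := by
    rw [div_le_iff₀ (by positivity)]; linarith
  linarith

lemma W_nonneg : ∀ {n : ℕ} (i : ℕ) (f : T N n), 0 ≤ W i f
  | 0, 0, _ => le_rfl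
  | 0, _ + 1, _ => le_rfl
  | _ + 1, 0, _ => vr_nonneg _
  | _ + 1, i + 1, f => mn_nonneg fun z => W_nonneg i (f z)

lemma vr_le_one {A : ZMod N → ℝ} (h0 : ∀ z, 0 ≤ A z) (h1 : ∀ z, A z ≤ 1) : vr A ≤ 1 := by
  rw [vr_eq]
  have : mn (fun z => A z ^ 2) ≤ 1 := mn_le_one fun z => pow_le_one₀ (h0 z) (h1 z)
  nlinarith [sq_nonneg (mn A)]

lemma sum_W_le : ∀ {n : ℕ} (f : T N n), ∑ i ∈ range n, W i f ≤ asq f - av f ^ 2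
  | 0, f => by simp [asq, av]
  | n + 1, f => by
    rw [sum_range_succ']
    simp only [W, asq, av]
    rw [vr_eq]
    have : ∑ i ∈ range n, mn (fun z => W i (f z)) = mn (fun z => ∑ i ∈ range n, W i (f z)) := by
      simp only [mn, ← sum_div]
      rw [sum_comm]
    rw [this]
    have h := mn_le fun z => sum_W_le (f z)
    rw [mn_sub] at h
    linarith

lemma sum_W_le_one {n : ℕ} {f : T N n} (h : tB f) : ∑ i ∈ range n, W i f ≤ 1 := by
  have := sum_W_le f
  have := asq_le_one h
  nlinarith [sq_nonneg (av f)]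

variable {p q : ℝ}

lemma hit_nonneg (hp : 0 ≤ p) (hq : 0 ≤ q) :
    ∀ {n : ℕ} {f g : T N n}, tB f → tB g → 0 ≤ hit p q f g
  | 0, _, _, hf, hg => mul_nonneg hf.1 hg.1
  | _ + 1, _, _, hf, hg => pe_nonneg hp hq fun x y => hit_nonneg hp hq (hf x) (hg y)

lemma hit_mono (hp : 0 ≤ p) (hq : 0 ≤ q) :
    ∀ {n : ℕ} {f g g' : T N n}, tB f → tle g g' → hit p q f g ≤ hit p q f g'
  | 0, _, _, _, hf, hg => mul_le_mul_of_nonneg_left hg hf.1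
  | _ + 1, _, _, _, hf, hg => pe_le hp hq fun x y => hit_mono hp hq (hf x) (hg y)

lemma hit_tmax_le (hp : 0 ≤ p) (hq : 0 ≤ q) :
    ∀ {n : ℕ} {f a b : T N n}, tB f → tB a → tB b →
      hit p q f (tmax a b) ≤ hit p q f a + hit p q f b
  | 0, f, a, b, hf, ha, hb => by
    change (show ℝ from f) * max (show ℝ from a) (show ℝ from b) ≤
      (show ℝ from f) * (show ℝ from a) + (show ℝ from f) * (show ℝ from b)
    rw [← mul_add]
    exact mul_le_mul_of_nonneg_left (max_le (le_add_of_nonneg_right hb.1)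
      (le_add_of_nonneg_left ha.1)) hf.1
  | _ + 1, f, a, b, hf, ha, hb => by
    simp only [hit]
    rw [← pe_add]
    exact pe_le hp hq fun x y => hit_tmax_le hp hq (hf x) (ha y) (hb y)

lemma hit_upd (hp : 0 < p) (hq : 0 < q) (h : p + q = 1) :
    ∀ {n : ℕ} (i : ℕ) (z : ZMod N) {f g : T N n}, tB f → tB g →
      min p q / N * hit p q (upd i z f) (tmax (upd i z g) (upd i (z + 1) g)) ≤ hit p q f g
  | 0, i, z, f, g, hf, hg => by
    have e : hit p q (upd i z f) (tmax (upd i z g) (upd i (z + 1) g)) = hit p q f g := by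
      change hit p q f (tmax g g) = hit p q f g
      rw [tmax_self]
    rw [e]
    refine mul_le_of_le_one_left (hit_nonneg hp.le hq.le hf hg) ?_
    rw [div_le_one Npos]
    have : (1 : ℝ) ≤ N := by exact_mod_cast NeZero.one_le
    have := min_le_left p q
    linarith
  | n + 1, 0, z, f, g, hf, hg => by
    change min p q / N * pe p q (fun _ _ => hit p q (f z) (tmax (g z) (g (z + 1)))) ≤
      pe p q (fun x y => hit p q (f x) (g y))
    rw [pe_const h]
    have hN := Npos (N := N)
    have h1 := hit_tmax_le hp.le hq.le (hf z) (hg z) (hg (z + 1))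
    have n1 := hit_nonneg hp.le hq.le (hf z) (hg z)
    have n2 := hit_nonneg hp.le hq.le (hf z) (hg (z + 1))
    have hm : 0 < min p q := lt_min hp hq
    have h2 := le_mn (f := fun z => q * hit p q (f z) (g z) + p * hit p q (f z) (g (z + 1)))
      (fun z => add_nonneg (mul_nonneg hq.le (hit_nonneg hp.le hq.le (hf z) (hg z)))
        (mul_nonneg hp.le (hit_nonneg hp.le hq.le (hf z) (hg (z + 1))))) z
    rw [div_mul_eq_mul_div, div_le_iff₀ hN, mul_comm (pe p q _)]
    refine le_trans ?_ h2
    have a1 := mul_le_mul_of_nonneg_right (min_le_right p q) n1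
    have a2 := mul_le_mul_of_nonneg_right (min_le_left p q) n2
    have a3 := mul_le_mul_of_nonneg_left h1 hm.le
    linarith
  | n + 1, i + 1, z, f, g, hf, hg => by
    change min p q / N * pe p q (fun x y => hit p q (upd i z (f x))
      (tmax (upd i z (g y)) (upd i (z + 1) (g y)))) ≤ pe p q (fun x y => hit p q (f x) (g y))
    rw [← pe_mul]
    exact pe_le hp.le hq.le fun x y => hit_upd hp hq h i z (hf x) (hg y)

lemma hit_upd_self (hp : 0 < p) (hq : 0 < q) (h : p + q = 1)
    {n : ℕ} (i : ℕ) (z : ZMod N) {f g : T N n} (hf : tB f) (hg : tB g) :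
      min p q / N * hit p q (upd i z f) (upd i z g) ≤ hit p q f g := by
  refine le_trans ?_ (hit_upd hp hq h i z hf hg)
  have hm : 0 < min p q := lt_min hp hq
  have := Npos (N := N)
  gcongr
  exact hit_mono hp.le hq.le (tB_upd i z hf) (tle_tmax _ _)

lemma Lo_nonneg (hp : 0 ≤ p) (hq : 0 ≤ q) : ∀ {n : ℕ} (i : ℕ) (f g : T N n), 0 ≤ Lo p q i f g
  | 0, 0, _, _ => le_rfl
  | 0, _ + 1, _, _ => le_rfl
  | _ + 1, 0, _, _ => mul_nonneg (vr_nonneg _) (vr_nonneg _)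
  | _ + 1, i + 1, f, g => pe_nonneg hp hq fun x y => Lo_nonneg hp hq i (f x) (g y)

lemma Lo_le {t : ℝ} (hp : 0 ≤ p) (hq : 0 ≤ q) (ht0 : 0 < t) (ht1 : t ≤ 1)
    (H : ∀ A B : ZMod N → ℝ, (∀ z, 0 ≤ A z) → (∀ z, 0 ≤ B z) →
      pe p q (fun x y => A x ^ t * B y ^ t) ≤ mn A ^ t * mn B ^ t) :
    ∀ {n : ℕ} (i : ℕ) {f g : T N n}, tB f → tB g → Lo p q i f g ≤ W i f ^ t * W i g ^ t
  | 0, 0, f, g, _, _ => mul_nonneg (Real.rpow_nonneg (W_nonneg _ _) _)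
      (Real.rpow_nonneg (W_nonneg _ _) _)
  | 0, _ + 1, f, g, _, _ => mul_nonneg (Real.rpow_nonneg (W_nonneg _ _) _)
      (Real.rpow_nonneg (W_nonneg _ _) _)
  | _ + 1, 0, f, g, hf, hg => by
    simp only [Lo, W]
    have a0 := vr_nonneg (fun z => av (f z))
    have b0 := vr_nonneg (fun z => av (g z))
    have a1 := vr_le_one (fun z => av_nonneg (hf z)) (fun z => av_le_one (hf z))
    have b1 := vr_le_one (fun z => av_nonneg (hg z)) (fun z => av_le_one (hg z))
    exact mul_le_mul (Real.self_le_rpow_of_le_one a0 a1 ht1)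
      (Real.self_le_rpow_of_le_one b0 b1 ht1) b0 (Real.rpow_nonneg a0 _)
  | _ + 1, i + 1, f, g, hf, hg => by
    simp only [Lo, W]
    exact (pe_le hp hq fun x y => Lo_le hp hq ht0 ht1 H i (hf x) (hg y)).trans
      (H _ _ (fun z => W_nonneg i (f z)) (fun z => W_nonneg i (g z)))

lemma bellman {s : ℕ} {κ C : ℝ} (hp : 0 < p) (hq : 0 < q) (h : p + q = 1) (hs : 1 ≤ s)
    (hκ : 0 < κ) (hC : 0 ≤ C)
    (H : ∀ A B : ZMod N → ℝ,
      (∀ z, 0 ≤ A z) → (∀ z, A z ≤ 1) → (∀ z, 0 ≤ B z) → (∀ z, B z ≤ 1) →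
      κ ≤ mn A → κ ≤ mn B →
      mn A ^ s * mn B ^ s - C * (vr A * vr B) ≤ pe p q (fun x y => A x ^ s * B y ^ s)) :
    ∀ {n : ℕ} {f g : T N n}, tB f → tB g →
      av f ^ s * av g ^ s - κ ^ s - C * ∑ i ∈ range n, Lo p q i f g ≤ hit p q f g
  | 0, f, g, hf, hg => by
    have e : hit p q f g = av f * av g := rfl
    have a0 := av_nonneg hf
    have b0 := av_nonneg hg
    have a1 := pow_le_of_le_one a0 (av_le_one hf) (n := s) (by omega)
    have b1 := pow_le_of_le_one b0 (av_le_one hg) (n := s) (by omega)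
    have := mul_le_mul a1 b1 (by positivity) a0
    have : 0 < κ ^ s := by positivity
    rw [e]; simp; linarith
  | n + 1, f, g, hf, hg => by
    have a0 := av_nonneg hf
    have b0 := av_nonneg hg
    have a1 := av_le_one hf
    have b1 := av_le_one hg
    have L0 : 0 ≤ C * ∑ i ∈ range (n + 1), Lo p q i f g :=
      mul_nonneg hC (sum_nonneg fun i _ => Lo_nonneg hp.le hq.le i f g)
    have h0 := hit_nonneg hp.le hq.le hf hg
    by_cases ha : av f < κ
    · have : av f ^ s * av g ^ s ≤ κ ^ s * 1 :=
        mul_le_mul (by gcongr) (pow_le_one₀ b0 b1) (by positivity) (by positivity)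
      linarith
    by_cases hb : av g < κ
    · have : av f ^ s * av g ^ s ≤ 1 * κ ^ s :=
        mul_le_mul (pow_le_one₀ a0 a1) (by gcongr) (by positivity) (by positivity)
      linarith
    push Not at ha hb
    have key := H _ _ (fun z => av_nonneg (hf z)) (fun z => av_le_one (hf z))
      (fun z => av_nonneg (hg z)) (fun z => av_le_one (hg z)) ha hb
    have ih := pe_le hp.le hq.le
      (fun x y => bellman hp hq h hs hκ hC H (hf x) (hg y))
    rw [pe_sub, pe_sub, pe_const h, pe_mul, pe_sum] at ih
    rw [sum_range_succ']
    simp only [Lo, av, hit] at *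
    linarith

lemma lowinf (hp : 0 < p) (hq : 0 < q) (h : p + q = 1) (m : ℝ) (hm : 0 < m) (hm1 : m ≤ 1) :
    ∃ η β : ℝ, 0 < η ∧ 0 < β ∧ ∀ {n : ℕ} {f g : T N n}, tB f → tB g → m ≤ av f → m ≤ av g →
      (∀ i, W i g ≤ η) → β ≤ hit p q f g := by
  obtain ⟨t, ht, ht1, Ht⟩ := hyper (N := N) hp hq h
  obtain ⟨s, hs, Hs⟩ := bellman1 (N := N) hp hq h
  set β := m ^ s * m ^ s with hβ
  have hβ0 : 0 < β := by positivity
  have hβ1 : β ≤ 1 := mul_le_one₀ (pow_le_one₀ hm.le hm1) (by positivity) (pow_le_one₀ hm.le hm1)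
  obtain ⟨C, hC, HC⟩ := Hs (β / 4) (by positivity) (by linarith)
  set τ := t - 1 / 2 with hτ
  have hτ0 : 0 < τ := by linarith
  set ξ := β / (4 * (C + 1)) with hξ
  have hξ0 : 0 < ξ := by positivity
  refine ⟨ξ ^ (1 / τ), β / 2, by positivity, by positivity, ?_⟩
  intro n f g hf hg haf hag hW
  have B := bellman hp hq h hs (by positivity : 0 < β / 4) hC HC hf hg
  have k1 : (β / 4) ^ s ≤ β / 4 := pow_le_of_le_one (by positivity) (by linarith) (by omega)
  have k2 : β ≤ av f ^ s * av g ^ s := by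
    have := av_nonneg hf
    rw [hβ]; gcongr
  have k3 : ∑ i ∈ range n, Lo p q i f g ≤ ξ := by
    have : ∀ i ∈ range n, Lo p q i f g ≤ ξ * (2⁻¹ * (W i f + W i g)) := by
      intro i _
      refine (Lo_le hp.le hq.le (by linarith) ht1.le Ht i hf hg).trans ?_
      have wf := W_nonneg i f
      have wg := W_nonneg i g
      have et : t = τ + 1 / 2 := by rw [hτ]; ring
      have wf1 : W i f ≤ 1 := by
        have hin := sum_W_le_one hf
        exact (single_le_sum (f := fun i => W i f) (fun i _ => W_nonneg i f) ‹i ∈ range n›).trans hin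
      have e1 : W i f ^ t ≤ Real.sqrt (W i f) := by
        rw [Real.sqrt_eq_rpow]
        exact Real.rpow_le_rpow_of_exponent_ge_of_imp wf wf1 (by linarith) (by intro _ h; linarith)
      have e2 : W i g ^ t ≤ ξ * Real.sqrt (W i g) := by
        rw [Real.sqrt_eq_rpow, et, Real.rpow_add_of_nonneg wg hτ0.le (by norm_num)]
        gcongr
        calc W i g ^ τ ≤ (ξ ^ (1 / τ)) ^ τ := Real.rpow_le_rpow wg (hW i) hτ0.le
          _ = ξ := by rw [← Real.rpow_mul hξ0.le, one_div_mul_cancel hτ0.ne', Real.rpow_one]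
      have e3 := mul_le_mul e1 e2 (by positivity) (Real.sqrt_nonneg _)
      refine e3.trans ?_
      have s1 := Real.sq_sqrt wf
      have s2 := Real.sq_sqrt wg
      have : Real.sqrt (W i f) * Real.sqrt (W i g) ≤ 2⁻¹ * (W i f + W i g) := by
        nlinarith [sq_nonneg (Real.sqrt (W i f) - Real.sqrt (W i g))]
      calc _ = ξ * (Real.sqrt (W i f) * Real.sqrt (W i g)) := by ring
        _ ≤ _ := by gcongr
    refine (sum_le_sum this).trans ?_
    rw [← mul_sum, ← mul_sum, sum_add_distrib]
    have w1 := sum_W_le_one hf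
    have w2 := sum_W_le_one hg
    nlinarith
  have k4 : C * ∑ i ∈ range n, Lo p q i f g ≤ β / 4 := by
    calc _ ≤ (C + 1) * ξ := by
          apply mul_le_mul (by linarith) k3 (sum_nonneg fun i _ => Lo_nonneg hp.le hq.le i f g)
            (by linarith)
      _ = β / 4 := by rw [hξ]; field_simp
  linarith

/-- resilience from below -/
def Res (m : ℝ) {n : ℕ} : ℕ → T N n → Prop
  | 0, _ => True
  | k + 1, f => m ≤ av f ∧ ∀ i z, Res m k (upd i z f)

/-- bounded from above under restrictions -/
def Up (M : ℝ) {n : ℕ} : ℕ → T N n → Prop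
  | 0, _ => True
  | k + 1, f => av f ≤ M ∧ ∀ i z, Up M k (upd i z f)

lemma Up_Res (m M : ℝ) {n : ℕ} : ∀ (k : ℕ) (e : ℝ) (f : T N n), 0 ≤ e → Up M (k + 1) f →
    M - e ≤ av f → m ≤ M - N ^ k * e → Res m k f
  | 0, _, _, _, _, _, _ => trivial
  | k + 1, e, f, he, hU, ha, hm => by
    have hN : (1 : ℝ) ≤ N := by exact_mod_cast NeZero.one_le
    refine ⟨?_, fun i z => Up_Res m M k (N * e) _ (by positivity) (hU.2 i z) ?_ ?_⟩
    · have : e ≤ (N : ℝ) ^ (k + 1) * e := le_mul_of_one_le_left he (one_le_pow₀ hN)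
      linarith
    · have h1 := le_mn (f := fun z => M - av (upd i z f))
        (fun z => sub_nonneg.2 (hU.2 i z).1) z
      rw [mn_sub, mn_const, mn_av_upd] at h1
      nlinarith
    · refine hm.trans_eq ?_
      ring

lemma c0_pos (hp : 0 < p) (hq : 0 < q) : 0 < min p q / (N : ℝ) :=
  div_pos (lt_min hp hq) Npos

lemma c0_le (hq : 0 < q) (h : p + q = 1) : min p q / (N : ℝ) ≤ 1 := by
  rw [div_le_one Npos]
  have : (1 : ℝ) ≤ N := by exact_mod_cast NeZero.one_le
  have := min_le_left p q
  linarith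

lemma not_Up (hp : 0 < p) (hq : 0 < q) (h : p + q = 1) (M : ℝ) {n : ℕ} :
    ∀ (k : ℕ) (f : T N n), tB f → ¬ Up M k f → ∃ f' : T N n, tB f' ∧ M < av f' ∧
      (min p q / N) ^ k * hit p q f' f' ≤ hit p q f f
  | 0, _, _, hU => absurd trivial hU
  | k + 1, f, hf, hU => by
    have c0 := c0_pos (N := N) hp hq
    have c1 := c0_le (N := N) hq h
    by_cases ha : av f ≤ M
    · have : ∃ i z, ¬ Up M k (upd i z f) := by
        by_contra! hc
        exact hU ⟨ha, hc⟩
      obtain ⟨i, z, hz⟩ := this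
      obtain ⟨f', b, a, hh⟩ := not_Up hp hq h M k _ (tB_upd i z hf) hz
      refine ⟨f', b, a, ?_⟩
      refine le_trans ?_ (hit_upd_self hp hq h i z hf hf)
      rw [pow_succ', mul_assoc]
      gcongr
    · exact ⟨f, hf, not_le.1 ha, mul_le_of_le_one_left (hit_nonneg hp.le hq.le hf hf)
        (pow_le_one₀ c0.le c1)⟩

lemma lemA (hp : 0 < p) (hq : 0 < q) (h : p + q = 1) {m η β : ℝ} (hβ : 0 < β) (hη : 0 < η)
    (H : ∀ {n : ℕ} {f g : T N n}, tB f → tB g → m ≤ av f → m ≤ av g →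
      (∀ i, W i g ≤ η) → β ≤ hit p q f g) {n : ℕ} :
    ∀ (k : ℕ) (f g : T N n), tB f → tB g → Res m k f → m ≤ av g →
      1 - k * (η / (2 * (N : ℝ) ^ 3)) < av g → (min p q / N) ^ k * β ≤ hit p q f g
  | 0, f, g, _, hg, _, _, ha => by
    have := av_le_one hg
    simp at ha; linarith
  | k + 1, f, g, hf, hg, hR, hm, ha => by
    have c0 := c0_pos (N := N) hp hq
    have c1 := c0_le (N := N) hq h
    by_cases hW : ∀ i, W i g ≤ η
    · exact (mul_le_of_le_one_left hβ.le (pow_le_one₀ c0.le c1)).trans (H hf hg hR.1 hm hW)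
    · push Not at hW
      obtain ⟨i, hi⟩ := hW
      obtain ⟨z, hz⟩ := exists_raise i hg
      have hN := Npos (N := N)
      have hlt : η / (2 * (N : ℝ) ^ 3) < W i g / (2 * (N : ℝ) ^ 3) := by gcongr
      have hpos : 0 < η / (2 * (N : ℝ) ^ 3) := by positivity
      have := lemA hp hq h hβ hη H k (upd i z f) (tmax (upd i z g) (upd i (z + 1) g))
        (tB_upd i z hf) (tB_tmax (tB_upd i z hg) (tB_upd i _ hg)) (hR.2 i z) (by linarith)
        (by push_cast at ha; linarith)
      refine le_trans ?_ (hit_upd hp hq h i z hf hg)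
      rw [pow_succ', mul_assoc]
      gcongr

theorem tree_main (hp : 0 < p) (hq : 0 < q) (h : p + q = 1) (μ : ℝ) (hμ : 0 < μ) (hμ1 : μ ≤ 1) :
    ∃ δ : ℝ, 0 < δ ∧ ∀ {n : ℕ} {f : T N n}, tB f → μ ≤ av f → δ ≤ hit p q f f := by
  have c0 := c0_pos (N := N) hp hq
  have c1 := c0_le (N := N) hq h
  have hN := Npos (N := N)
  obtain ⟨η, β, hη, hβ, H⟩ := lowinf (N := N) hp hq h (μ / 2) (by positivity) (by linarith)
  obtain ⟨k, hk⟩ := exists_nat_ge (1 / (η / (2 * (N : ℝ) ^ 3)))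
  rw [div_le_iff₀ (by positivity)] at hk
  set e := μ / (2 * (N : ℝ) ^ k) with he
  have he0 : 0 < e := by positivity
  have outer : ∀ (j : ℕ) {n : ℕ} (f : T N n), tB f → μ ≤ av f → 1 - j * e < av f →
      ((min p q / N) ^ (k + 1)) ^ j * ((min p q / N) ^ k * β) ≤ hit p q f f := by
    intro j
    induction j with
    | zero =>
      intro n f hf _ ha
      have := av_le_one hf
      simp at ha; linarith
    | succ j ih =>
      intro n f hf hμf ha
      by_cases hU : Up (av f + e) (k + 1) f
      · have hR := Up_Res (μ / 2) (av f + e) k e f he0.le hU (by linarith) (by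
          have : (N : ℝ) ^ k * e = μ / 2 := by rw [he]; field_simp
          rw [this]; linarith)
        have := lemA hp hq h hβ hη H k f f hf hf hR (by linarith) (by linarith)
        refine le_trans (mul_le_of_le_one_left (by positivity) ?_) this
        exact pow_le_one₀ (by positivity) (pow_le_one₀ c0.le c1)
      · obtain ⟨f', hf', ha', hh⟩ := not_Up hp hq h _ _ f hf hU
        refine le_trans ?_ hh
        rw [pow_succ' _ j, mul_assoc]
        gcongr
        apply ih f' hf' (by linarith)
        push_cast at ha; linarith
  obtain ⟨j, hj⟩ := exists_nat_ge (1 / e)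
  rw [div_le_iff₀ he0] at hj
  exact ⟨_, by positivity, fun {n f} hf ha => outer j f hf ha (by linarith)⟩

end trees
end SSH

namespace SSH
open Finset

lemma cyc_step {Ω : Type} {N : ℕ} [NeZero N] (σ : Equiv.Perm Ω) (hσ : σ ^ N = 1) (z : ZMod N)
    (x : Ω) : (σ ^ (z + 1).val) x = σ ((σ ^ z.val) x) := by
  have : σ ^ (z + 1).val = σ ^ (z.val + 1) := by
    rw [ZMod.val_add, ZMod.val_one_eq_one_mod, Nat.add_mod_mod]
    have := pow_mod_orderOf σ
    have hd : orderOf σ ∣ N := orderOf_dvd_of_pow_eq_one hσ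
    rw [← pow_mod_orderOf σ ((z.val + 1) % N), Nat.mod_mod_of_dvd _ hd, pow_mod_orderOf]
  rw [this, pow_succ']; rfl

/-- decomposition into lazy cycles -/
lemma decomp {Ω : Type} [Fintype Ω] [DecidableEq Ω] {N : ℕ} [NeZero N]
    (hN : ∀ σ : Equiv.Perm Ω, σ ^ N = 1) (Q : Ω → Ω → ℝ) (π : Ω → ℝ) (α : ℝ) (hα : 0 < α)
    (hQ : ∀ x y, 0 ≤ Q x y) (hr : ∀ x, ∑ y, Q x y = π x) (hc : ∀ y, ∑ x, Q x y = π y)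
    (hs : ∑ x, π x = 1) (hd : ∀ x, α ≤ Q x x) :
    ∃ (w : (Equiv.Perm Ω × Ω) ⊕ Ω → ℝ) (γ : (Equiv.Perm Ω × Ω) ⊕ Ω → ZMod N → Ω),
      (∀ k, 0 ≤ w k) ∧ ∀ F : Ω → Ω → ℝ, ∑ x, ∑ y, Q x y * F x y =
        ∑ k, w k * pe (1 / (1 + α)) (α / (1 + α)) (fun a b => F (γ k a) (γ k b)) := by
  have hπ0 : ∀ x, 0 ≤ π x := fun x => by rw [← hr]; exact sum_nonneg fun y _ => hQ x y
  have hπ1 : ∀ x, π x ≤ 1 := fun x => by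
    rw [← hs]; exact single_le_sum (fun i _ => hπ0 i) (mem_univ x)
  let M : Matrix Ω Ω ℝ := fun x y => Q x y + if x = y then 1 - π x else 0
  have hM : M ∈ doublyStochastic ℝ Ω := by
    rw [mem_doublyStochastic_iff_sum]
    refine ⟨fun x y => ?_, fun x => ?_, fun y => ?_⟩
    · have := hQ x y
      have := hπ1 x
      simp only [M]; split_ifs <;> linarith
    · simp only [M, sum_add_distrib, hr]; simp
    · simp only [M, sum_add_distrib, hc]; simp
  obtain ⟨u, hu0, hu1, hu⟩ := exists_eq_sum_perm_of_mem_doublyStochastic hM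
  have hMQ : ∀ x y, x ≠ y → Q x y = ∑ σ, u σ * (if σ x = y then 1 else 0) := by
    intro x y hxy
    have := congrFun (congrFun hu x) y
    simp only [M, if_neg hxy, add_zero] at this
    rw [← this, Matrix.sum_apply]
    refine sum_congr rfl fun σ _ => ?_
    simp [Equiv.Perm.permMatrix, PEquiv.toMatrix_apply, eq_comm]
  have key : ∀ F : Ω → Ω → ℝ, ∑ x, ∑ y, Q x y * F x y =
      ∑ x, Q x x * F x x + ∑ x, ∑ σ, (if σ x ≠ x then u σ else 0) * F x (σ x) := by
    intro F
    rw [← sum_add_distrib]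
    refine sum_congr rfl fun x _ => ?_
    rw [← add_sum_erase _ _ (mem_univ x)]
    congr 1
    have : ∀ y ∈ univ.erase x, Q x y * F x y
        = ∑ σ, (if σ x = y then (if σ x ≠ x then u σ else 0) * F x (σ x) else 0) := by
      intro y hy
      have hy' := ne_of_mem_erase hy
      rw [hMQ x y hy'.symm, sum_mul]
      refine sum_congr rfl fun σ _ => ?_
      by_cases h : σ x = y
      · subst h; simp [hy']
      · simp [h]
    rw [sum_congr rfl this, sum_comm]
    refine sum_congr rfl fun σ _ => ?_
    rw [sum_ite_eq]
    by_cases h : σ x = x <;> simp [h]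
  have h1α : (1 + α) ≠ 0 := by positivity
  refine ⟨Sum.elim (fun a => if a.1 a.2 ≠ a.2 then u a.1 * (1 + α) else 0)
    (fun x => Q x x - α * ∑ σ, if σ x ≠ x then u σ else 0),
    Sum.elim (fun a z => (a.1 ^ z.val) a.2) (fun x _ => x), ?_, ?_⟩
  · rintro (⟨σ, x⟩ | x)
    · simp only [Sum.elim_inl]
      have := hu0 σ
      split_ifs <;> positivity
    · simp only [Sum.elim_inr]
      have : ∑ σ : Equiv.Perm Ω, (if σ x ≠ x then u σ else 0) ≤ 1 := by
        rw [← hu1]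
        refine sum_le_sum fun σ _ => ?_
        have := hu0 σ
        split_ifs <;> linarith
      have h2 := hd x
      nlinarith
  · intro F
    rw [key, Fintype.sum_sum_type, Fintype.sum_prod_type]
    simp only [Sum.elim_inl, Sum.elim_inr]
    have hpq : 1 / (1 + α) + α / (1 + α) = 1 := by field_simp
    simp only [pe_const hpq]
    have cyc : ∀ σ : Equiv.Perm Ω, ∑ x, (if σ x ≠ x then u σ * (1 + α) else 0) *
        pe (1 / (1 + α)) (α / (1 + α)) (fun a b : ZMod N => F ((σ ^ a.val) x) ((σ ^ b.val) x))
        = ∑ x, (if σ x ≠ x then u σ else 0) * (α * F x x + F x (σ x)) := by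
      intro σ
      let G : Ω → ℝ := fun x => (if σ x ≠ x then u σ else 0) * (α * F x x + F x (σ x))
      have e1 : ∀ x, (if σ x ≠ x then u σ * (1 + α) else 0) *
          pe (1 / (1 + α)) (α / (1 + α)) (fun a b : ZMod N => F ((σ ^ a.val) x) ((σ ^ b.val) x))
          = mn (fun z : ZMod N => G ((σ ^ z.val) x)) := by
        intro x
        rw [pe, ← mn_mul]
        congr 1; ext z
        simp only [G]
        rw [cyc_step σ (hN σ)]
        have : σ ((σ ^ z.val) x) = (σ ^ z.val) x ↔ σ x = x := by
          rw [← Equiv.Perm.mul_apply, (Commute.self_pow σ z.val).eq, Equiv.Perm.mul_apply]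
          exact (σ ^ z.val).injective.eq_iff
        simp only [ne_eq, this]
        split_ifs
        · simp
        · field_simp
      simp only [e1]
      have : ∑ x, mn (fun z : ZMod N => G ((σ ^ z.val) x))
          = mn (fun z : ZMod N => ∑ x, G ((σ ^ z.val) x)) := by
        simp only [mn, ← sum_div]
        rw [sum_comm]
      rw [this]
      have : ∀ z : ZMod N, ∑ x, G ((σ ^ z.val) x) = ∑ x, G x := fun z =>
        Equiv.sum_comp (σ ^ z.val) G
      simp only [this, mn_const]
      rfl
    simp only [cyc]
    have : ∑ x, (Q x x - α * ∑ σ : Equiv.Perm Ω, (if σ x ≠ x then u σ else 0)) * F x x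
        = ∑ x, Q x x * F x x
          - ∑ x, ∑ σ : Equiv.Perm Ω, (if σ x ≠ x then u σ else 0) * (α * F x x) := by
      rw [← sum_sub_distrib]
      refine sum_congr rfl fun x _ => ?_
      rw [← sum_mul]; ring
    rw [this, sum_comm (f := fun (σ : Equiv.Perm Ω) x => _ * (α * F x x + F x (σ x)))]
    simp only [mul_add, sum_add_distrib]
    ring

section tensor
variable {Ω I : Type} [Fintype Ω] [Fintype I] {N : ℕ} [NeZero N]

lemma sum_cons {A : Type} [Fintype A] {n : ℕ} (F : (Fin (n + 1) → A) → ℝ) :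
    ∑ x, F x = ∑ a, ∑ v : Fin n → A, F (Fin.cons a v) := by
  rw [← Fintype.sum_prod_type' (f := fun a (v : Fin n → A) => F (Fin.cons a v)),
    ← (Fin.consEquiv (fun _ => A)).sum_comp]
  rfl

/-- transport to trees -/
def tr (γ : I → ZMod N → Ω) : ∀ {n : ℕ}, (Fin n → I) → ((Fin n → Ω) → ℝ) → T N n
  | 0, _, f => (f Fin.elim0 : ℝ)
  | _ + 1, c, f => fun z => tr γ (Fin.tail c) (fun v => f (Fin.cons (γ (c 0) z) v))

lemma tB_tr (γ : I → ZMod N → Ω) : ∀ {n : ℕ} (c : Fin n → I) (f : (Fin n → Ω) → ℝ),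
    (∀ v, f v ∈ Set.Icc (0 : ℝ) 1) → tB (tr γ c f)
  | 0, _, _, h => h _
  | _ + 1, c, _, h => fun _ => tB_tr γ (Fin.tail c) _ fun _ => h _

variable {p q : ℝ} (h : p + q = 1) (Q : Ω → Ω → ℝ) (π : Ω → ℝ) (w : I → ℝ) (γ : I → ZMod N → Ω)

lemma tensor_hit
    (H : ∀ F : Ω → Ω → ℝ, ∑ x, ∑ y, Q x y * F x y =
        ∑ k, w k * pe p q (fun a b => F (γ k a) (γ k b))) :
    ∀ {n : ℕ} (f g : (Fin n → Ω) → ℝ),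
      ∑ x : Fin n → Ω, ∑ y : Fin n → Ω, (∏ i, Q (x i) (y i)) * (f x * g y)
        = ∑ c : Fin n → I, (∏ i, w (c i)) * hit p q (tr γ c f) (tr γ c g)
  | 0, f, g => by
    simp only [univ_unique, sum_singleton, univ_eq_empty, prod_empty, one_mul]
    simp only [hit, tr]
    congr 2
  | n + 1, f, g => by
    rw [sum_cons]
    simp only [sum_cons (n := n), Fin.prod_univ_succ, Fin.cons_zero, Fin.cons_succ]
    have e1 : ∀ a b, ∑ v : Fin n → Ω, ∑ u : Fin n → Ω, Q a b * (∏ i, Q (v i) (u i)) *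
          (f (Fin.cons a v) * g (Fin.cons b u))
        = Q a b * ∑ c : Fin n → I, (∏ i, w (c i)) *
          hit p q (tr γ c fun v => f (Fin.cons a v)) (tr γ c fun v => g (Fin.cons b v)) := by
      intro a b
      rw [← tensor_hit H]
      simp only [mul_sum, mul_assoc]
    have e2 : ∀ a, ∑ v : Fin n → Ω, ∑ b, ∑ u : Fin n → Ω, Q a b * (∏ i, Q (v i) (u i)) *
          (f (Fin.cons a v) * g (Fin.cons b u))
        = ∑ b, Q a b * ∑ c : Fin n → I, (∏ i, w (c i)) *
          hit p q (tr γ c fun v => f (Fin.cons a v)) (tr γ c fun v => g (Fin.cons b v)) := by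
      intro a
      rw [sum_comm]
      exact sum_congr rfl fun b _ => e1 a b
    simp only [e2]
    rw [H]
    refine sum_congr rfl fun k _ => ?_
    rw [pe_sum, mul_sum]
    refine sum_congr rfl fun c _ => ?_
    rw [pe_mul, mul_assoc]
    rfl

lemma tensor_av
    (H : ∀ F : Ω → ℝ, ∑ x, π x * F x = ∑ k, w k * mn (fun a => F (γ k a))) :
    ∀ {n : ℕ} (f : (Fin n → Ω) → ℝ),
      ∑ x : Fin n → Ω, (∏ i, π (x i)) * f x
        = ∑ c : Fin n → I, (∏ i, w (c i)) * av (tr γ c f)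
  | 0, f => by
    simp only [univ_unique, sum_singleton, univ_eq_empty, prod_empty, one_mul]
    simp only [av, tr]
    congr 2
  | n + 1, f => by
    rw [sum_cons]
    simp only [sum_cons (n := n), Fin.prod_univ_succ, Fin.cons_zero, Fin.cons_succ]
    have e1 : ∀ a, ∑ v : Fin n → Ω, π a * (∏ i, π (v i)) * f (Fin.cons a v)
        = π a * ∑ c : Fin n → I, (∏ i, w (c i)) * av (tr γ c fun v => f (Fin.cons a v)) := by
      intro a
      rw [← tensor_av H]
      simp only [mul_sum, mul_assoc]
    simp only [e1]
    rw [H]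
    refine sum_congr rfl fun k _ => ?_
    have : (mn fun a => ∑ c : Fin n → I, (∏ i, w (c i)) *
        av (tr γ c fun v => f (Fin.cons (γ k a) v)))
        = ∑ c : Fin n → I, (∏ i, w (c i)) * mn fun a => av (tr γ c fun v => f (Fin.cons (γ k a) v)) := by
      simp only [← mn_mul]
      simp only [mn, ← sum_div]
      rw [sum_comm]
    rw [this, mul_sum]
    refine sum_congr rfl fun c _ => ?_
    rw [mul_assoc]
    rfl

end tensor

/-- the bound in terms of a kernel of two variables -/
theorem kernel_main (α μ : ℝ) (hα : 0 < α) (hμ : 0 < μ) (hμ1 : μ ≤ 1) :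
    ∃ δ : ℝ, 0 < δ ∧ ∀ (Ω : Type) [Fintype Ω] (Q : Ω → Ω → ℝ) (π : Ω → ℝ),
      (∀ x y, 0 ≤ Q x y) → (∀ x, ∑ y, Q x y = π x) → (∀ y, ∑ x, Q x y = π y) →
      ∑ x, π x = 1 → (∀ x, α ≤ Q x x) → ∀ (n : ℕ) (f : (Fin n → Ω) → ℝ),
      (∀ v, f v ∈ Set.Icc (0 : ℝ) 1) → ∑ x : Fin n → Ω, (∏ i, π (x i)) * f x = μ →
      δ ≤ ∑ x : Fin n → Ω, ∑ y : Fin n → Ω, (∏ i, Q (x i) (y i)) * (f x * f y) := by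
  classical
  set N := (⌊1 / α⌋₊).factorial with hNdef
  haveI : NeZero N := ⟨Nat.factorial_ne_zero _⟩
  have hp : 0 < 1 / (1 + α) := by positivity
  have hq : 0 < α / (1 + α) := by positivity
  have hpq : 1 / (1 + α) + α / (1 + α) = 1 := by field_simp
  obtain ⟨δ, hδ, Hδ⟩ := tree_main (N := N) hp hq hpq (μ / 2) (by positivity) (by linarith)
  refine ⟨δ * (μ / 2), by positivity, ?_⟩
  intro Ω _ Q π hQ hr hc hs hd n f hf hμf
  have hcard : Fintype.card Ω ≤ ⌊1 / α⌋₊ := by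
    apply Nat.le_floor
    rw [le_div_iff₀ hα]
    calc (Fintype.card Ω : ℝ) * α = ∑ _x : Ω, α := by simp
      _ ≤ ∑ x, π x := sum_le_sum fun x _ => (hd x).trans (by
          rw [← hr]; exact single_le_sum (fun y _ => hQ x y) (mem_univ x))
      _ = 1 := hs
  have hN : ∀ σ : Equiv.Perm Ω, σ ^ N = 1 := by
    intro σ
    obtain ⟨c, hc⟩ := Nat.factorial_dvd_factorial hcard
    rw [hNdef, hc, pow_mul, ← Fintype.card_perm, pow_card_eq_one, one_pow]
  obtain ⟨w, γ, hw, H⟩ := decomp hN Q π α hα hQ hr hc hs hd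
  have Hav : ∀ F : Ω → ℝ, ∑ x, π x * F x = ∑ k, w k * mn (fun a => F (γ k a)) := by
    intro F
    have := H (fun x _ => F x)
    simp only [← sum_mul, hr] at this
    rw [this]
    refine sum_congr rfl fun k _ => ?_
    rw [pe_fst hpq (fun a => F (γ k a))]
  have hw1 : ∑ k, w k = 1 := by
    have := Hav (fun _ => 1)
    simp only [mn_const, mul_one] at this
    rw [← this, hs]
  have hwn : ∑ c : Fin n → _, ∏ i, w (c i) = 1 := by
    have := (Finset.prod_univ_sum (fun _ : Fin n => univ) (fun _ k => w k)).symm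
    rw [Fintype.piFinset_univ] at this
    rw [this, hw1]; simp
  rw [tensor_hit Q w γ H]
  rw [tensor_av π w γ Hav] at hμf
  have : δ * (μ / 2) = ∑ c : Fin n → _, (∏ i, w (c i)) * (δ * (av (tr γ c f) - μ / 2)) := by
    have e : ∀ c : Fin n → (Equiv.Perm Ω × Ω) ⊕ Ω,
        (∏ i, w (c i)) * (δ * (av (tr γ c f) - μ / 2))
        = δ * ((∏ i, w (c i)) * av (tr γ c f)) - (δ * (μ / 2)) * ∏ i, w (c i) := by
      intro c; ring
    simp only [e]
    rw [sum_sub_distrib, ← mul_sum, ← mul_sum, hμf, hwn]; ring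
  rw [this]
  refine sum_le_sum fun c _ => ?_
  refine mul_le_mul_of_nonneg_left ?_ (prod_nonneg fun i _ => hw _)
  have hB := tB_tr γ c f hf
  by_cases ha : μ / 2 ≤ av (tr γ c f)
  · refine le_trans ?_ (Hδ hB ha)
    have := av_le_one hB
    exact mul_le_of_le_one_right hδ.le (by linarith)
  · have := hit_nonneg hp.le hq.le hB hB
    nlinarith

end SSH

namespace SameSetHitting

/-- two-step same-set hitting with a bound depending only on `α` and `μ`. -/
theorem two_step_same_set_hitting_bound :
    ∀ α μ : ℝ, α ∈ Set.Ioc (0:ℝ) 1 → μ ∈ Set.Ioc (0:ℝ) 1 →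
    ∃ δ : ℝ, 0 < δ ∧
      ∀ (Ω : Type) [Fintype Ω],
      ∀ (P : (Fin 2 → Ω) → ℝ) (π : Ω → ℝ),
        IsDist P → HasMarginals P π → (∀ a : Ω, 0 < π a) →
        (∀ x : Ω, α ≤ P (fun _ => x)) →
        ∀ n : ℕ, 1 ≤ n →
        ∀ f : (Fin n → Ω) → ℝ, (∀ v, f v ∈ Set.Icc (0:ℝ) 1) →
          exps π f = μ →
          δ ≤ prodExp P (fun _ => f) := by
  intro α μ hα hμ
  obtain ⟨δ, hδ, H⟩ := SSH.kernel_main α μ hα.1 hμ.1 hμ.2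
  refine ⟨δ, hδ, ?_⟩
  intro Ω _ P π hP hM _ hd n _ f hf hμf
  classical
  have two : ∀ {A : Type} [Fintype A] (G : (Fin 2 → A) → ℝ),
      ∑ x, G x = ∑ a, ∑ b, G ![a, b] := by
    intro A _ G
    rw [← Fintype.sum_prod_type' (f := fun a b => G ![a, b]), ← (finTwoArrowEquiv A).symm.sum_comp]
    rfl
  have hr : ∀ x, ∑ y, P ![x, y] = π x := by
    intro x
    rw [← hM 0 x, marginal, two]
    refine Eq.symm ((Finset.sum_eq_single x ?_ ?_).trans ?_)
    · intro b _ hb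
      exact Finset.sum_eq_zero fun c _ => if_neg hb
    · intro hx
      exact absurd (Finset.mem_univ x) hx
    · exact Finset.sum_congr rfl fun b _ => if_pos rfl
  have hc : ∀ y, ∑ x, P ![x, y] = π y := by
    intro y
    rw [← hM 1 y, marginal, two]
    simp
  have hs : ∑ x, π x = 1 := by
    rw [← hP.2, two]
    exact Finset.sum_congr rfl fun x _ => (hr x).symm
  have hd' : ∀ x, α ≤ P ![x, x] := by
    intro x
    have e : (![x, x] : Fin 2 → Ω) = fun _ => x := by
      ext j; fin_cases j <;> rfl
    rw [e]; exact hd x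
  have := H Ω (fun x y => P ![x, y]) π (fun x y => hP.1 _) hr hc hs hd' n f hf hμf
  refine this.trans_eq ?_
  rw [prodExp, two]
  refine Finset.sum_congr rfl fun x _ => Finset.sum_congr rfl fun y _ => ?_
  rw [Fin.prod_univ_two]
  congr 1
  refine Finset.prod_congr rfl fun i _ => ?_
  congr 1
  ext j; fin_cases j <;> rfl

end SameSetHitting
end

section
/- A two-step probability distribution P on Ω² with equal marginals is same-set hitting if and only if α(P) := min_{x∈Ω} P(x,x) > 0. -/
namespace SameSetHitting

/-- mean -/
noncomputable def mn {Ω : Type} [Fintype Ω] (w : Ω → ℝ) (a : Ω → ℝ) : ℝ := ∑ x, w x * a x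

/-- variance -/
noncomputable def vr {Ω : Type} [Fintype Ω] (w : Ω → ℝ) (a : Ω → ℝ) : ℝ :=
  ∑ x, w x * (a x - mn w a) ^ 2

/-- joint expectation -/
noncomputable def jt {Ω : Type} [Fintype Ω] (W : Ω → Ω → ℝ) (a b : Ω → ℝ) : ℝ :=
  ∑ x, ∑ y, W x y * (a x * b y)

/-- A good single coordinate two-step law. -/
structure Good {Ω : Type} [Fintype Ω] (β ρ : ℝ) (W : Ω → Ω → ℝ) (w : Ω → ℝ) : Prop where
  nn : ∀ x y, 0 ≤ W x y
  row : ∀ x, ∑ y, W x y = w x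
  col : ∀ y, ∑ x, W x y = w y
  tot : ∑ x, w x = 1
  wmin : ∀ x, w x ≠ 0 → β ≤ w x
  emin : ∀ x y, W x y ≠ 0 → β ≤ W x y
  diag : ∀ x, w x ≠ 0 → W x x ≠ 0
  gap : ∀ a b : Ω → ℝ, mn w a = 0 → mn w b = 0 →
    2 * jt W a b ≤ ρ * (mn w (fun x => a x ^ 2) + mn w (fun x => b x ^ 2))

section single
variable {Ω : Type} [Fintype Ω] {β ρ : ℝ} {W : Ω → Ω → ℝ} {w : Ω → ℝ}

theorem Good.wnn (h : Good β ρ W w) (x : Ω) : 0 ≤ w x := by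
  rw [← h.row]; exact Finset.sum_nonneg fun y _ => h.nn x y

theorem Good.wx (h : Good β ρ W w) {x y : Ω} (hW : W x y ≠ 0) : w x ≠ 0 := by
  intro h0
  rw [← h.row, Finset.sum_eq_zero_iff_of_nonneg (fun y _ => h.nn x y)] at h0
  exact hW (h0 y (Finset.mem_univ _))

theorem Good.wy (h : Good β ρ W w) {x y : Ω} (hW : W x y ≠ 0) : w y ≠ 0 := by
  intro h0
  rw [← h.col, Finset.sum_eq_zero_iff_of_nonneg (fun x _ => h.nn x y)] at h0
  exact hW (h0 x (Finset.mem_univ _))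

theorem jt_left (h : Good β ρ W w) (a : Ω → ℝ) (c : ℝ) : jt W a (fun _ => c) = c * mn w a := by
  unfold jt mn
  rw [Finset.mul_sum]
  refine Finset.sum_congr rfl fun x _ => ?_
  rw [← Finset.sum_mul, h.row]; ring

theorem jt_right (h : Good β ρ W w) (b : Ω → ℝ) (c : ℝ) : jt W (fun _ => c) b = c * mn w b := by
  unfold jt mn
  rw [Finset.mul_sum, Finset.sum_comm]
  refine Finset.sum_congr rfl fun x _ => ?_
  rw [← Finset.sum_mul, h.col]; ring

theorem Good.swap (h : Good β ρ W w) : Good β ρ (fun x y => W y x) w where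
  nn := fun x y => h.nn y x
  row := h.col
  col := h.row
  tot := h.tot
  wmin := h.wmin
  emin := fun x y => h.emin y x
  diag := h.diag
  gap := by
    intro a b ha hb
    have := h.gap b a hb ha
    have e : jt (fun x y => W y x) a b = jt W b a := by
      unfold jt
      rw [Finset.sum_comm]
      refine Finset.sum_congr rfl fun x _ => Finset.sum_congr rfl fun y _ => by ring
    rw [e]; linarith

theorem jt_swap (a b : Ω → ℝ) : jt (fun x y => W y x) a b = jt W b a := by
  unfold jt
  rw [Finset.sum_comm]
  refine Finset.sum_congr rfl fun x _ => Finset.sum_congr rfl fun y _ => by ring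

theorem mn_const (h : Good β ρ W w) (c : ℝ) : mn w (fun _ => c) = c := by
  unfold mn; rw [← Finset.sum_mul, h.tot, one_mul]

theorem mn_add (a b : Ω → ℝ) : mn w (fun x => a x + b x) = mn w a + mn w b := by
  unfold mn; rw [← Finset.sum_add_distrib]; exact Finset.sum_congr rfl fun x _ => by ring

theorem mn_sub (a b : Ω → ℝ) : mn w (fun x => a x - b x) = mn w a - mn w b := by
  unfold mn; rw [← Finset.sum_sub_distrib]; exact Finset.sum_congr rfl fun x _ => by ring

theorem mn_smul (c : ℝ) (a : Ω → ℝ) : mn w (fun x => c * a x) = c * mn w a := by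
  unfold mn; rw [Finset.mul_sum]; exact Finset.sum_congr rfl fun x _ => by ring

theorem mn_mono (h : Good β ρ W w) {a b : Ω → ℝ} (hab : ∀ x, w x ≠ 0 → a x ≤ b x) :
    mn w a ≤ mn w b := by
  refine Finset.sum_le_sum fun x _ => ?_
  by_cases hx : w x = 0
  · simp [hx]
  · exact mul_le_mul_of_nonneg_left (hab x hx) (h.wnn x)

theorem jt_mono (h : Good β ρ W w) {a b a' b' : Ω → ℝ}
    (hab : ∀ x y, w x ≠ 0 → w y ≠ 0 → a x * b y ≤ a' x * b' y) :
    jt W a b ≤ jt W a' b' := by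
  refine Finset.sum_le_sum fun x _ => Finset.sum_le_sum fun y _ => ?_
  by_cases hx : W x y = 0
  · simp [hx]
  · exact mul_le_mul_of_nonneg_left (hab x y (h.wx hx) (h.wy hx)) (h.nn x y)

theorem vr_eq (h : Good β ρ W w) (a : Ω → ℝ) : vr w a = mn w (fun x => a x ^ 2) - mn w a ^ 2 := by
  have : vr w a = mn w (fun x => a x ^ 2 - (2 * mn w a) * a x + mn w a ^ 2) := by
    unfold vr
    generalize mn w a = m
    unfold mn
    exact Finset.sum_congr rfl fun x _ => by ring
  rw [this, mn_add, mn_sub, mn_smul, mn_const h]; ring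

theorem vr_nonneg (h : Good β ρ W w) (a : Ω → ℝ) : 0 ≤ vr w a :=
  Finset.sum_nonneg fun x _ => mul_nonneg (h.wnn x) (sq_nonneg _)

theorem vr_le (h : Good β ρ W w) (a : Ω → ℝ) (c : ℝ) : vr w a ≤ mn w (fun x => (a x - c) ^ 2) := by
  have : mn w (fun x => (a x - c)^2) = mn w (fun x => a x ^ 2 - (2 * c) * a x + c ^ 2) := by
    congr 1; funext x; ring
  rw [this, vr_eq h, mn_add, mn_sub, mn_smul, mn_const h]
  nlinarith [sq_nonneg (mn w a - c)]

theorem jt_center (h : Good β ρ W w) (a b : Ω → ℝ) :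
    jt W (fun x => a x - mn w a) (fun x => b x - mn w b) = jt W a b - mn w a * mn w b := by
  have e : jt W (fun x => a x - mn w a) (fun x => b x - mn w b)
      = jt W a b - jt W a (fun _ => mn w b) - jt W (fun _ => mn w a) b
        + jt W (fun _ => mn w a) (fun _ => mn w b) := by
    unfold jt
    simp only [← Finset.sum_sub_distrib, ← Finset.sum_add_distrib]
    exact Finset.sum_congr rfl fun x _ => Finset.sum_congr rfl fun y _ => by ring
  rw [e, jt_left h, jt_right h, jt_left h, mn_const h]; ring

theorem cov_le (h : Good β ρ W w) (a b : Ω → ℝ) :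
    2 * (jt W a b - mn w a * mn w b) ≤ ρ * (vr w a + vr w b) := by
  have := h.gap (fun x => a x - mn w a) (fun x => b x - mn w b)
    (by rw [mn_sub, mn_const h, sub_self]) (by rw [mn_sub, mn_const h, sub_self])
  rw [jt_center h] at this
  exact this

theorem cov_ge (h : Good β ρ W w) (a b : Ω → ℝ) :
    -(ρ * (vr w a + vr w b)) ≤ 2 * (jt W a b - mn w a * mn w b) := by
  have := cov_le h a (fun x => - b x)
  have e1 : jt W a (fun x => - b x) = - jt W a b := by
    unfold jt; simp only [← Finset.sum_neg_distrib]
    exact Finset.sum_congr rfl fun x _ => Finset.sum_congr rfl fun y _ => by ring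
  have e2 : mn w (fun x => - b x) = - mn w b := by
    unfold mn; simp only [← Finset.sum_neg_distrib]
    exact Finset.sum_congr rfl fun x _ => by ring
  have e3 : vr w (fun x => - b x) = vr w b := by
    rw [vr_eq h, vr_eq h, e2]; simp
  rw [e1, e2, e3] at this
  linarith

theorem vr_ge_point (h : Good β ρ W w) (a : Ω → ℝ) {x : Ω} (hx : w x ≠ 0) :
    β * (a x - mn w a) ^ 2 ≤ vr w a := by
  refine le_trans (mul_le_mul_of_nonneg_right (h.wmin x hx) (sq_nonneg _)) ?_
  exact Finset.single_le_sum (f := fun x => w x * (a x - mn w a) ^ 2)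
    (fun x _ => mul_nonneg (h.wnn x) (sq_nonneg _)) (Finset.mem_univ x)

theorem mn_ge_point (h : Good β ρ W w) {a : Ω → ℝ} (ha : ∀ x, 0 ≤ a x) {x : Ω} (hx : w x ≠ 0) :
    β * a x ≤ mn w a := by
  refine le_trans (mul_le_mul_of_nonneg_right (h.wmin x hx) (ha x)) ?_
  exact Finset.single_le_sum (f := fun x => w x * a x)
    (fun x _ => mul_nonneg (h.wnn x) (ha x)) (Finset.mem_univ x)

/-- lower Bernoulli of second order -/
theorem bern2 (c u : ℝ) (hc : 0 ≤ c) (hc1 : c ≤ 1) (hu : -c ≤ u) (s : ℕ) :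
    1 + s * u + (s * (s - 1) / 2 : ℝ) * (1 - c) ^ s * u ^ 2 ≤ (1 + u) ^ s := by
  induction s with
  | zero => simp
  | succ s ih =>
    have h1 : 0 ≤ 1 + u := by linarith
    have h2 := mul_le_mul_of_nonneg_right ih h1
    rw [pow_succ (1 + u)]
    refine le_trans ?_ h2
    set q := (1 - c) ^ s with hq
    have hq0 : 0 ≤ q := pow_nonneg (by linarith) _
    have hq1 : q * (1 - c) ≤ 1 := by
      have := pow_le_one₀ (n := s + 1) (sub_nonneg.2 hc1) (by linarith : 1 - c ≤ 1)
      rwa [pow_succ] at this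
    rw [pow_succ, ← hq]
    push_cast
    have hs : (0:ℝ) ≤ s * (s - 1) / 2 := by
      rcases s with _ | s
      · simp
      · push_cast
        have : (0:ℝ) ≤ s := Nat.cast_nonneg _
        have : ((s:ℝ) + 1 - 1) = s := by ring
        rw [this]; positivity
    have hs0 : (0:ℝ) ≤ s := Nat.cast_nonneg _
    have k1 : (s * (s - 1) / 2 : ℝ) * q * (1 - c) * u ^ 2 ≤ (s * (s - 1) / 2 : ℝ) * q * (1 + u) * u ^ 2 := by
      gcongr; linarith
    have k2 : (s : ℝ) * (q * (1 - c)) * u ^ 2 ≤ s * 1 * u ^ 2 := by gcongr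
    nlinarith [k1, k2]

theorem bern1 (u : ℝ) (hu : -1 ≤ u) (s : ℕ) (hs : 2 ≤ s) :
    1 + s * u + u ^ 2 ≤ (1 + u) ^ s := by
  induction s, hs using Nat.le_induction with
  | base => norm_num; nlinarith
  | succ s hs ih =>
    have h1 : 0 ≤ 1 + u := by linarith
    have h2 := mul_le_mul_of_nonneg_right ih h1
    rw [pow_succ (1 + u)]
    refine le_trans ?_ h2
    push_cast
    have : (2:ℝ) ≤ s := by exact_mod_cast hs
    have : 0 ≤ (s - 1 + 1 + u) * u ^ 2 := by
      apply mul_nonneg _ (sq_nonneg _); linarith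
    nlinarith

theorem pow_upper (c u : ℝ) (hc : 0 ≤ c) (hu : |u| ≤ c) (s : ℕ) :
    |(1 + u) ^ s - 1| ≤ s * (1 + c) ^ s * |u| := by
  induction s with
  | zero => simp
  | succ s ih =>
    have e : (1 + u) ^ (s + 1) - 1 = (1 + u) * ((1 + u) ^ s - 1) + u := by ring
    rw [e]
    refine (abs_add_le _ _).trans ?_
    rw [abs_mul]
    have h1 : |1 + u| ≤ 1 + c := (abs_add_le _ _).trans (by simpa using hu)
    have h2 : 1 ≤ (1 + c) ^ (s + 1) := one_le_pow₀ (by linarith)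
    have h3 : |1 + u| * |(1 + u) ^ s - 1| ≤ (1 + c) * (s * (1 + c) ^ s * |u|) :=
      mul_le_mul h1 ih (abs_nonneg _) (by linarith)
    have h4 : |u| * 1 ≤ |u| * (1 + c) ^ (s + 1) := by gcongr
    push_cast
    rw [pow_succ] at *
    nlinarith

theorem s1_local_aux (h : Good β ρ W w) (hρ : 0 ≤ ρ) (s : ℕ) (c : ℝ) (hc : 0 ≤ c) (hc1 : c ≤ 1)
    (hs : ρ * s ^ 2 * (1 + c) ^ (2 * s) ≤ s * (s - 1) * (1 - c) ^ s)
    (a : Ω → ℝ) (hm : mn w a = 1) (ha : ∀ x, w x ≠ 0 → |a x - 1| ≤ c) :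
    ρ * vr w (fun x => a x ^ s) ≤ 2 * (mn w (fun x => a x ^ s) - 1) := by
  set t := mn w (fun x => (a x - 1) ^ 2) with ht
  have ht0 : 0 ≤ t := Finset.sum_nonneg fun x _ => mul_nonneg (h.wnn x) (sq_nonneg _)
  have h1 : vr w (fun x => a x ^ s) ≤ s ^ 2 * (1 + c) ^ (2 * s) * t := by
    refine (vr_le h _ 1).trans ?_
    rw [ht, ← mn_smul]
    refine mn_mono h fun x hx => ?_
    have := pow_upper c (a x - 1) hc (ha x hx) s
    rw [add_sub_cancel] at this
    have h2 := pow_le_pow_left₀ (abs_nonneg _) this 2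
    rw [sq_abs] at h2
    refine h2.trans (le_of_eq ?_)
    rw [mul_pow, mul_pow, sq_abs, ← pow_mul, mul_comm s 2]
  have h2 : 1 + (s * (s - 1) / 2 : ℝ) * (1 - c) ^ s * t ≤ mn w (fun x => a x ^ s) := by
    have : mn w (fun x => (1 - s + s * a x) + (s * (s - 1) / 2 : ℝ) * (1 - c) ^ s * (a x - 1) ^ 2)
        ≤ mn w (fun x => a x ^ s) := by
      refine mn_mono h fun x hx => ?_
      have := bern2 c (a x - 1) hc hc1 (neg_le_of_abs_le (ha x hx)) s
      rw [add_sub_cancel] at this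
      linarith
    rw [mn_add, mn_smul, mn_add, mn_const h, mn_smul, hm, ← ht] at this
    linarith
  have h3 := mul_le_mul_of_nonneg_left h1 hρ
  have h4 := mul_le_mul_of_nonneg_right hs ht0
  nlinarith

theorem s1_local (h : Good β ρ W w) (hρ : 0 ≤ ρ) (s : ℕ) (c : ℝ) (hc : 0 ≤ c) (hc1 : c ≤ 1)
    (hs : ρ * s ^ 2 * (1 + c) ^ (2 * s) ≤ s * (s - 1) * (1 - c) ^ s)
    (a b : Ω → ℝ) (hma : mn w a = 1) (hmb : mn w b = 1) (ha : ∀ x, w x ≠ 0 → |a x - 1| ≤ c)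
    (hb : ∀ x, w x ≠ 0 → |b x - 1| ≤ c) :
    1 ≤ jt W (fun x => a x ^ s) (fun x => b x ^ s) := by
  have h1 := s1_local_aux h hρ s c hc hc1 hs a hma ha
  have h2 := s1_local_aux h hρ s c hc hc1 hs b hmb hb
  have h3 := cov_ge h (fun x => a x ^ s) (fun x => b x ^ s)
  have v1 := mul_nonneg hρ (vr_nonneg h (fun x => a x ^ s))
  have v2 := mul_nonneg hρ (vr_nonneg h (fun x => b x ^ s))
  set m1 := mn w (fun x => a x ^ s)
  set m2 := mn w (fun x => b x ^ s)
  nlinarith [mul_nonneg (by linarith : 0 ≤ m1 - 1) (by linarith : 0 ≤ m2 - 1)]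

theorem s1_wild (h : Good β ρ W w) (hβ : 0 < β) (s : ℕ) (hs2 : 2 ≤ s) (c c' : ℝ) (hc1 : c ≤ 1)
    (hc'0 : 0 ≤ c')
    (hs : 1 ≤ (1 - c) ^ s * (1 + β * c' ^ 2))
    (a b : Ω → ℝ) (ha0 : ∀ x, 0 ≤ a x) (hma : mn w a = 1)
    (ha : ∃ x, w x ≠ 0 ∧ c' ≤ |a x - 1|)
    (hb : ∀ x, w x ≠ 0 → |b x - 1| ≤ c) :
    1 ≤ jt W (fun x => a x ^ s) (fun x => b x ^ s) := by
  have h1 : (1 - c) ^ s * mn w (fun x => a x ^ s) ≤ jt W (fun x => a x ^ s) (fun x => b x ^ s) := by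
    rw [← jt_left h]
    refine jt_mono h fun x y hx hy => ?_
    refine mul_le_mul_of_nonneg_left ?_ (pow_nonneg (ha0 x) _)
    refine pow_le_pow_left₀ (by linarith) ?_ _
    have := neg_le_of_abs_le (hb y hy); linarith
  have h2 : 1 + mn w (fun x => (a x - 1) ^ 2) ≤ mn w (fun x => a x ^ s) := by
    have : mn w (fun x => (1 - s + s * a x) + (a x - 1) ^ 2) ≤ mn w (fun x => a x ^ s) := by
      refine mn_mono h fun x hx => ?_
      have := bern1 (a x - 1) (by linarith [ha0 x]) s hs2
      rw [add_sub_cancel] at this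
      linarith
    rw [mn_add, mn_add, mn_const h, mn_smul, hma] at this
    linarith
  obtain ⟨x, hx, hxc⟩ := ha
  have h3 := mn_ge_point h (a := fun x => (a x - 1) ^ 2) (fun x => sq_nonneg _) hx
  have h4 : c' ^ 2 ≤ (a x - 1) ^ 2 := by
    rw [← sq_abs (a x - 1)]; exact pow_le_pow_left₀ hc'0 hxc 2
  have h5 : β * c' ^ 2 ≤ β * (a x - 1) ^ 2 := by gcongr
  have h6 : 0 ≤ (1 - c) ^ s := pow_nonneg (by linarith) _
  calc 1 ≤ (1 - c) ^ s * (1 + β * c' ^ 2) := hs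
    _ ≤ (1 - c) ^ s * mn w (fun x => a x ^ s) := by gcongr; linarith
    _ ≤ _ := h1

theorem s1 (Ω : Type) [Fintype Ω] (β ρ : ℝ) (hβ : 0 < β) (hρ : 0 ≤ ρ) (hρ1 : ρ < 1) :
    ∃ s : ℕ, 2 ≤ s ∧ ∃ C : ℝ, 0 ≤ C ∧ ∀ (W : Ω → Ω → ℝ) (w : Ω → ℝ), Good β ρ W w →
      ∀ a b : Ω → ℝ, (∀ x, a x ∈ Set.Icc (0:ℝ) 1) → (∀ x, b x ∈ Set.Icc (0:ℝ) 1) →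
      mn w a ^ s * mn w b ^ s - C * (vr w a * vr w b)
        ≤ jt W (fun x => a x ^ s) (fun x => b x ^ s) := by
  -- choose s
  obtain ⟨s0, hs0⟩ := exists_nat_gt (1 / (1 - ρ))
  set s := s0 + 2 with hs
  have hsρ : ρ * s ^ 2 < s * (s - 1) := by
    have h1 : 0 < 1 - ρ := by linarith
    rw [div_lt_iff₀ h1] at hs0
    have : (s:ℝ) = s0 + 2 := by simp [hs]
    rw [this]
    have : (0:ℝ) ≤ s0 := Nat.cast_nonneg _
    nlinarith
  -- choose c'
  obtain ⟨c', hc'0, hc'1, hc'⟩ : ∃ c' : ℝ, 0 < c' ∧ c' ≤ 1 ∧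
      ρ * s ^ 2 * (1 + c') ^ (2 * s) ≤ s * (s - 1) * (1 - c') ^ s := by
    have hcont : Continuous fun c : ℝ => s * (s - 1) * (1 - c) ^ s - ρ * s ^ 2 * (1 + c) ^ (2 * s) := by
      fun_prop
    have h0 : (0:ℝ) < s * (s - 1) * (1 - 0) ^ s - ρ * s ^ 2 * (1 + 0) ^ (2 * s) := by
      simp; linarith
    have := (hcont.tendsto 0).eventually (lt_mem_nhds h0)
    rw [Metric.eventually_nhds_iff] at this
    obtain ⟨ε, hε, H⟩ := this
    refine ⟨min (ε / 2) 1, by positivity, min_le_right _ _, ?_⟩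
    have := H (y := min (ε / 2) 1) (by
      rw [Real.dist_eq, sub_zero, abs_of_pos (by positivity)]
      exact (min_le_left _ _).trans_lt (by linarith))
    linarith
  -- choose c
  obtain ⟨c, hc0, hc1, hcc', hc⟩ : ∃ c : ℝ, 0 < c ∧ c ≤ 1 ∧ c ≤ c' ∧
      1 ≤ (1 - c) ^ s * (1 + β * c' ^ 2) := by
    have hcont : Continuous fun c : ℝ => (1 - c) ^ s * (1 + β * c' ^ 2) := by
      fun_prop
    have h0 : (1:ℝ) < (1 - 0) ^ s * (1 + β * c' ^ 2) := by
      simp; positivity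
    have := (hcont.tendsto 0).eventually (lt_mem_nhds h0)
    rw [Metric.eventually_nhds_iff] at this
    obtain ⟨ε, hε, H⟩ := this
    refine ⟨min (ε / 2) c', by positivity, (min_le_right _ _).trans hc'1, min_le_right _ _, ?_⟩
    have := H (y := min (ε / 2) c') (by
      rw [Real.dist_eq, sub_zero, abs_of_pos (by positivity)]
      exact (min_le_left _ _).trans_lt (by linarith))
    linarith
  refine ⟨s, by omega, 1 / (β * c ^ 2) ^ 2, by positivity, ?_⟩
  intro W w h a b ha hb
  have hVa := vr_nonneg h a
  have hVb := vr_nonneg h b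
  have hA0 : 0 ≤ mn w a := Finset.sum_nonneg fun x _ => mul_nonneg (h.wnn x) (ha x).1
  have hB0 : 0 ≤ mn w b := Finset.sum_nonneg fun x _ => mul_nonneg (h.wnn x) (hb x).1
  have hA1 : mn w a ≤ 1 := by
    rw [← mn_const h 1]; exact mn_mono h fun x _ => (ha x).2
  have hB1 : mn w b ≤ 1 := by
    rw [← mn_const h 1]; exact mn_mono h fun x _ => (hb x).2
  have hj0 : 0 ≤ jt W (fun x => a x ^ s) (fun x => b x ^ s) :=
    Finset.sum_nonneg fun x _ => Finset.sum_nonneg fun y _ => mul_nonneg (h.nn x y)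
      (mul_nonneg (pow_nonneg (ha x).1 _) (pow_nonneg (hb y).1 _))
  have hCV : 0 ≤ 1 / (β * c ^ 2) ^ 2 * (vr w a * vr w b) := by positivity
  rcases hA0.eq_or_lt with hA | hA
  · rw [← hA, zero_pow (by omega)]; linarith
  rcases hB0.eq_or_lt with hB | hB
  · rw [← hB, zero_pow (by omega)]; linarith
  set A := mn w a with hAdef
  set B := mn w b with hBdef
  -- normalised functions
  set a' : Ω → ℝ := fun x => A⁻¹ * a x with ha'
  set b' : Ω → ℝ := fun x => B⁻¹ * b x with hb'
  have ma' : mn w a' = 1 := by rw [ha', mn_smul, ← hAdef]; field_simp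
  have mb' : mn w b' = 1 := by rw [hb', mn_smul, ← hBdef]; field_simp
  have ha'0 : ∀ x, 0 ≤ a' x := fun x => mul_nonneg (by positivity) (ha x).1
  have hb'0 : ∀ x, 0 ≤ b' x := fun x => mul_nonneg (by positivity) (hb x).1
  have key : 1 ≤ jt W (fun x => a' x ^ s) (fun x => b' x ^ s) →
      A ^ s * B ^ s ≤ jt W (fun x => a x ^ s) (fun x => b x ^ s) := by
    intro hk
    have e : jt W (fun x => a x ^ s) (fun x => b x ^ s)
        = (A ^ s * B ^ s) * jt W (fun x => a' x ^ s) (fun x => b' x ^ s) := by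
      unfold jt
      simp only [Finset.mul_sum]
      refine Finset.sum_congr rfl fun x _ => Finset.sum_congr rfl fun y _ => ?_
      simp only [ha', hb', mul_pow, inv_pow]
      field_simp
    rw [e]
    have : 0 ≤ A ^ s * B ^ s := by positivity
    nlinarith
  have main : 1 ≤ jt W (fun x => a' x ^ s) (fun x => b' x ^ s) ∨
      ((∃ x, w x ≠ 0 ∧ c ≤ |a' x - 1|) ∧ (∃ x, w x ≠ 0 ∧ c ≤ |b' x - 1|)) := by
    by_cases h1 : ∃ x, w x ≠ 0 ∧ c' ≤ |a' x - 1|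
    · by_cases h2 : ∃ x, w x ≠ 0 ∧ c ≤ |b' x - 1|
      · obtain ⟨x, hx, hx'⟩ := h1
        exact Or.inr ⟨⟨x, hx, hcc'.trans hx'⟩, h2⟩
      · push Not at h2
        exact Or.inl (s1_wild h hβ s (by omega) c c' hc1 hc'0.le hc a' b' ha'0 ma' h1
          fun x hx => (h2 x hx).le)
    · by_cases h2 : ∃ x, w x ≠ 0 ∧ c' ≤ |b' x - 1|
      · by_cases h3 : ∃ x, w x ≠ 0 ∧ c ≤ |a' x - 1|
        · obtain ⟨x, hx, hx'⟩ := h2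
          exact Or.inr ⟨h3, ⟨x, hx, hcc'.trans hx'⟩⟩
        · push Not at h3
          have := s1_wild h.swap hβ s (by omega) c c' hc1 hc'0.le hc b' a' hb'0 mb' h2
            fun x hx => (h3 x hx).le
          rw [jt_swap] at this
          exact Or.inl this
      · push Not at h1 h2
        exact Or.inl (s1_local h hρ s c' hc'0.le hc'1 hc' a' b' ma' mb'
          (fun x hx => (h1 x hx).le) (fun x hx => (h2 x hx).le))
  rcases main with hk | ⟨⟨x, hx, hxc⟩, ⟨y, hy, hyc⟩⟩
  · have := key hk
    linarith
  · have va : β * c ^ 2 * A ^ 2 ≤ vr w a := by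
      refine le_trans ?_ (vr_ge_point h a hx)
      have : a x - mn w a = A * (a' x - 1) := by simp only [ha', ← hAdef]; field_simp
      rw [this, mul_pow, ← sq_abs (a' x - 1)]
      have : c ^ 2 ≤ |a' x - 1| ^ 2 := pow_le_pow_left₀ hc0.le hxc 2
      calc β * c ^ 2 * A ^ 2 = β * (A ^ 2 * c ^ 2) := by ring
        _ ≤ _ := by gcongr
    have vb : β * c ^ 2 * B ^ 2 ≤ vr w b := by
      refine le_trans ?_ (vr_ge_point h b hy)
      have : b y - mn w b = B * (b' y - 1) := by simp only [hb', ← hBdef]; field_simp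
      rw [this, mul_pow, ← sq_abs (b' y - 1)]
      have : c ^ 2 ≤ |b' y - 1| ^ 2 := pow_le_pow_left₀ hc0.le hyc 2
      calc β * c ^ 2 * B ^ 2 = β * (B ^ 2 * c ^ 2) := by ring
        _ ≤ _ := by gcongr
    have hAs : A ^ s ≤ A ^ 2 := pow_le_pow_of_le_one hA.le hA1 (by omega)
    have hBs : B ^ s ≤ B ^ 2 := pow_le_pow_of_le_one hB.le hB1 (by omega)
    have h1 : A ^ s * B ^ s ≤ A ^ 2 * B ^ 2 := by gcongr
    have h2 : (β * c ^ 2 * A ^ 2) * (β * c ^ 2 * B ^ 2) ≤ vr w a * vr w b := by gcongr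
    have h3 : A ^ 2 * B ^ 2 ≤ 1 / (β * c ^ 2) ^ 2 * (vr w a * vr w b) := by
      rw [one_div, inv_mul_eq_div, le_div_iff₀ (by positivity)]
      nlinarith
    linarith

/-- single-letter hypercontractivity -/
theorem s2_aux (h : Good β ρ W w) (hβ : 0 < β) (hρ : 0 ≤ ρ) (hρ1 : ρ < 1) (κ : ℝ)
    (hκ0 : 0 ≤ κ) (hκ1 : κ ≤ 1 / 2) (hκ : κ * (1 / β + 1) ^ 2 ≤ (1 - ρ) / 4)
    (a : Ω → ℝ) (ha : ∀ x, 0 ≤ a x) (hm : mn w a = 1) :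
    mn w (fun x => a x ^ ((1 + κ) / 2)) ^ 2 + ρ * vr w (fun x => a x ^ ((1 + κ) / 2)) ≤ 1 := by
  set t := mn w (fun x => (√(a x) - 1) ^ 2) with ht
  have ht0 : 0 ≤ t := Finset.sum_nonneg fun x _ => mul_nonneg (h.wnn x) (sq_nonneg _)
  have hr : mn w (fun x => √(a x)) = 1 - t / 2 := by
    have : t = mn w (fun x => (a x + 1) - 2 * √(a x)) := by
      rw [ht]; congr 1; funext x
      have := Real.sq_sqrt (ha x); nlinarith
    rw [mn_sub, mn_add, mn_const h, mn_smul, hm] at this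
    linarith
  have hM : ∀ x, w x ≠ 0 → √(a x) ≤ 1 / β := by
    intro x hx
    have h1 := mn_ge_point h ha hx
    rw [hm] at h1
    have hb1 : β ≤ 1 := by
      refine (h.wmin x hx).trans ?_
      rw [← h.tot]
      exact Finset.single_le_sum (fun x _ => h.wnn x) (Finset.mem_univ x)
    have h2 : a x ≤ 1 / β := by rw [le_div_iff₀ hβ]; linarith
    have h3 : 1 ≤ 1 / β := by rw [le_div_iff₀ hβ]; linarith
    refine Real.sqrt_le_iff.2 ⟨by positivity, h2.trans ?_⟩
    nlinarith
  set m := mn w (fun x => a x ^ ((1 + κ) / 2)) with hmdef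
  have hm0 : 0 ≤ m := Finset.sum_nonneg fun x _ => mul_nonneg (h.wnn x) (Real.rpow_nonneg (ha x) _)
  have bern : ∀ z : ℝ, 0 ≤ z → z ^ (1 + κ) ≤ z * (1 + κ * (z - 1)) := by
    intro z hz
    rw [Real.rpow_add' hz (by positivity), Real.rpow_one]
    refine mul_le_mul_of_nonneg_left ?_ hz
    have := rpow_one_add_le_one_add_mul_self (s := z - 1) (by linarith) hκ0 (by linarith : κ ≤ 1)
    rwa [add_sub_cancel] at this
  have hm1 : m ≤ 1 - t / 4 := by
    have : m ≤ mn w (fun x => (1 - κ) * √(a x) + κ * a x) := by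
      refine mn_mono h fun x _ => ?_
      have e : a x ^ ((1 + κ) / 2) = √(a x) ^ (1 + κ) := by
        rw [Real.sqrt_eq_rpow, ← Real.rpow_mul (ha x)]; congr 1; ring
      rw [e]
      refine (bern _ (Real.sqrt_nonneg _)).trans ?_
      have := Real.sq_sqrt (ha x); nlinarith
    rw [mn_add, mn_smul, mn_smul, hm, hr] at this
    nlinarith
  have hsq : mn w (fun x => (a x ^ ((1 + κ) / 2)) ^ 2) ≤ 1 + κ * ((1 / β + 1) ^ 2 * t) := by
    have h1 : mn w (fun x => (a x ^ ((1 + κ) / 2)) ^ 2) ≤ mn w (fun x => a x + κ * (a x - 1) + κ * (a x - 1) ^ 2) := by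
      refine mn_mono h fun x _ => ?_
      have e : (a x ^ ((1 + κ) / 2)) ^ 2 = a x ^ (1 + κ) := by
        rw [← Real.rpow_natCast, ← Real.rpow_mul (ha x)]; congr 1; push_cast; ring
      rw [e]
      refine (bern _ (ha x)).trans ?_
      nlinarith
    rw [mn_add, mn_add, mn_smul, mn_smul, mn_sub, mn_const h, hm] at h1
    have h2 : mn w (fun x => (a x - 1) ^ 2) ≤ (1 / β + 1) ^ 2 * t := by
      rw [ht, ← mn_smul]
      refine mn_mono h fun x hx => ?_
      have e : (a x - 1) ^ 2 = (√(a x) + 1) ^ 2 * (√(a x) - 1) ^ 2 := by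
        rw [← mul_pow]; congr 1
        have := Real.sq_sqrt (ha x); nlinarith
      rw [e]
      have := hM x hx
      gcongr
    nlinarith
  rw [vr_eq h, ← hmdef]
  have hmsq : m ^ 2 ≤ 1 - t / 4 := by nlinarith
  have k1 := mul_le_mul_of_nonneg_right hκ ht0
  have k2 := mul_le_mul_of_nonneg_left hsq hρ
  have k3 := mul_le_mul_of_nonneg_left hmsq (by linarith : 0 ≤ 1 - ρ)
  have k4 : ρ * (κ * ((1 / β + 1) ^ 2 * t)) ≤ 1 * (κ * ((1 / β + 1) ^ 2 * t)) := by
    gcongr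
  nlinarith

theorem s2 (h : Good β ρ W w) (hβ : 0 < β) (hρ : 0 ≤ ρ) (hρ1 : ρ < 1) (κ : ℝ)
    (hκ0 : 0 ≤ κ) (hκ1 : κ ≤ 1 / 2) (hκ : κ * (1 / β + 1) ^ 2 ≤ (1 - ρ) / 4)
    (a b : Ω → ℝ) (ha : ∀ x, 0 ≤ a x) (hb : ∀ x, 0 ≤ b x) :
    jt W (fun x => a x ^ ((1 + κ) / 2)) (fun x => b x ^ ((1 + κ) / 2))
      ≤ mn w a ^ ((1 + κ) / 2) * mn w b ^ ((1 + κ) / 2) := by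
  set θ := (1 + κ) / 2 with hθ
  have hθ0 : θ ≠ 0 := by positivity
  have hA0 : 0 ≤ mn w a := Finset.sum_nonneg fun x _ => mul_nonneg (h.wnn x) (ha x)
  have hB0 : 0 ≤ mn w b := Finset.sum_nonneg fun x _ => mul_nonneg (h.wnn x) (hb x)
  have zer : ∀ f : Ω → ℝ, (∀ x, 0 ≤ f x) → mn w f = 0 → ∀ x, w x ≠ 0 → f x = 0 := by
    intro f hf hz x hx
    have h1 := mn_ge_point h hf hx
    rw [hz] at h1
    have := hf x
    nlinarith
  rcases hA0.eq_or_lt with hA | hA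
  · have : jt W (fun x => a x ^ θ) (fun x => b x ^ θ) ≤ jt W (fun _ => 0) (fun _ => 0) := by
      refine jt_mono h fun x y hx hy => ?_
      simp only [zer a ha hA.symm x hx, Real.zero_rpow hθ0]; simp
    refine this.trans ?_
    rw [← hA, Real.zero_rpow hθ0]; simp [jt]
  rcases hB0.eq_or_lt with hB | hB
  · have : jt W (fun x => a x ^ θ) (fun x => b x ^ θ) ≤ jt W (fun _ => 0) (fun _ => 0) := by
      refine jt_mono h fun x y hx hy => ?_
      simp only [zer b hb hB.symm y hy, Real.zero_rpow hθ0]; simp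
    refine this.trans ?_
    rw [← hB, Real.zero_rpow hθ0]; simp [jt]
  set A := mn w a with hAdef
  set B := mn w b with hBdef
  set a' : Ω → ℝ := fun x => A⁻¹ * a x with ha'
  set b' : Ω → ℝ := fun x => B⁻¹ * b x with hb'
  have ma' : mn w a' = 1 := by rw [ha', mn_smul, ← hAdef]; field_simp
  have mb' : mn w b' = 1 := by rw [hb', mn_smul, ← hBdef]; field_simp
  have ha'0 : ∀ x, 0 ≤ a' x := fun x => mul_nonneg (by positivity) (ha x)
  have hb'0 : ∀ x, 0 ≤ b' x := fun x => mul_nonneg (by positivity) (hb x)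
  have h1 := s2_aux h hβ hρ hρ1 κ hκ0 hκ1 hκ a' ha'0 ma'
  have h2 := s2_aux h hβ hρ hρ1 κ hκ0 hκ1 hκ b' hb'0 mb'
  have h3 := cov_le h (fun x => a' x ^ θ) (fun x => b' x ^ θ)
  rw [← hθ] at h1 h2
  have h4 : jt W (fun x => a' x ^ θ) (fun x => b' x ^ θ) ≤ 1 := by
    nlinarith [sq_nonneg (mn w (fun x => a' x ^ θ) - mn w (fun x => b' x ^ θ))]
  have e : jt W (fun x => a x ^ θ) (fun x => b x ^ θ)
      = (A ^ θ * B ^ θ) * jt W (fun x => a' x ^ θ) (fun x => b' x ^ θ) := by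
    unfold jt
    simp only [Finset.mul_sum]
    refine Finset.sum_congr rfl fun x _ => Finset.sum_congr rfl fun y _ => ?_
    simp only [ha', hb']
    rw [Real.mul_rpow (by positivity) (ha x), Real.mul_rpow (by positivity) (hb y),
      Real.inv_rpow hA.le, Real.inv_rpow hB.le]
    have : 0 < A ^ θ := Real.rpow_pos_of_pos hA _
    have : 0 < B ^ θ := Real.rpow_pos_of_pos hB _
    field_simp
  rw [e]
  have : 0 ≤ A ^ θ * B ^ θ := by positivity
  nlinarith
end single

section product
variable {Ω : Type} [Fintype Ω] {β ρ : ℝ} {n : ℕ}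

/-- product expectation -/
noncomputable def E1 (w : Fin n → Ω → ℝ) (f : (Fin n → Ω) → ℝ) : ℝ :=
  ∑ v : Fin n → Ω, (∏ i, w i (v i)) * f v

/-- product joint expectation -/
noncomputable def E2 (W : Fin n → Ω → Ω → ℝ) (f g : (Fin n → Ω) → ℝ) : ℝ :=
  ∑ x : Fin n → Ω, ∑ y : Fin n → Ω, (∏ i, W i (x i) (y i)) * (f x * g y)

/-- slice in the first coordinate -/
def sl (f : (Fin (n + 1) → Ω) → ℝ) (x : Ω) : (Fin n → Ω) → ℝ :=
  fun v => f (Fin.cons x v : Fin (n + 1) → Ω)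

/-- restriction of one coordinate -/
def rs (i : Fin n) (x : Ω) (f : (Fin n → Ω) → ℝ) : (Fin n → Ω) → ℝ :=
  fun v => f (Function.update v i x)

theorem sum_cons (H : (Fin (n + 1) → Ω) → ℝ) :
    ∑ v, H v = ∑ a, ∑ v : Fin n → Ω, H (Fin.cons a v : Fin (n + 1) → Ω) := by
  rw [← (Fin.consEquiv (fun _ : Fin (n + 1) => Ω)).sum_comp, Fintype.sum_prod_type]
  rfl

theorem E1_succ (w : Fin (n + 1) → Ω → ℝ) (f : (Fin (n + 1) → Ω) → ℝ) :
    E1 w f = mn (w 0) (fun x => E1 (fun i => w i.succ) (sl f x)) := by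
  unfold E1 mn
  rw [sum_cons]
  refine Finset.sum_congr rfl fun a _ => ?_
  rw [Finset.mul_sum]
  refine Finset.sum_congr rfl fun v _ => ?_
  rw [Fin.prod_univ_succ]
  simp only [Fin.cons_zero, Fin.cons_succ, sl]
  ring

theorem E2_succ (W : Fin (n + 1) → Ω → Ω → ℝ) (f g : (Fin (n + 1) → Ω) → ℝ) :
    E2 W f g = ∑ x, ∑ y, W 0 x y * E2 (fun i => W i.succ) (sl f x) (sl g y) := by
  unfold E2
  rw [sum_cons]
  refine Finset.sum_congr rfl fun a _ => ?_
  simp only [sum_cons (n := n) (H := fun y => _)]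
  rw [Finset.sum_comm]
  refine Finset.sum_congr rfl fun b _ => ?_
  rw [Finset.mul_sum]
  refine Finset.sum_congr rfl fun v _ => ?_
  rw [Finset.mul_sum]
  refine Finset.sum_congr rfl fun v' _ => ?_
  rw [Fin.prod_univ_succ]
  simp only [Fin.cons_zero, Fin.cons_succ, sl]
  ring

theorem sl_rs_zero (f : (Fin (n + 1) → Ω) → ℝ) (x y : Ω) : sl (rs 0 x f) y = sl f x := by
  funext v; simp only [sl, rs, Fin.update_cons_zero]

theorem sl_rs_succ (f : (Fin (n + 1) → Ω) → ℝ) (i : Fin n) (x y : Ω) :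
    sl (rs i.succ x f) y = rs i x (sl f y) := by
  funext v; simp only [sl, rs, Fin.cons_update]

variable {W : Fin n → Ω → Ω → ℝ} {w : Fin n → Ω → ℝ}

theorem E1_add (f g : (Fin n → Ω) → ℝ) : E1 w (fun v => f v + g v) = E1 w f + E1 w g := by
  unfold E1; rw [← Finset.sum_add_distrib]; exact Finset.sum_congr rfl fun x _ => by ring

theorem E1_sub (f g : (Fin n → Ω) → ℝ) : E1 w (fun v => f v - g v) = E1 w f - E1 w g := by
  unfold E1; rw [← Finset.sum_sub_distrib]; exact Finset.sum_congr rfl fun x _ => by ring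

theorem E1_smul (c : ℝ) (f : (Fin n → Ω) → ℝ) : E1 w (fun v => c * f v) = c * E1 w f := by
  unfold E1; rw [Finset.mul_sum]; exact Finset.sum_congr rfl fun x _ => by ring

theorem E1_mono (h : ∀ i, Good β ρ (W i) (w i)) {f g : (Fin n → Ω) → ℝ} (hfg : ∀ v, f v ≤ g v) :
    E1 w f ≤ E1 w g :=
  Finset.sum_le_sum fun v _ => mul_le_mul_of_nonneg_left (hfg v)
    (Finset.prod_nonneg fun i _ => (h i).wnn _)

theorem E1_const (h : ∀ i, Good β ρ (W i) (w i)) (c : ℝ) : E1 w (fun _ => c) = c := by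
  unfold E1
  rw [← Finset.sum_mul]
  have : ∑ v : Fin n → Ω, ∏ i, w i (v i) = 1 := by
    have h1 := Finset.prod_univ_sum (fun _ : Fin n => (Finset.univ : Finset Ω)) (fun i x => w i x)
    rw [Fintype.piFinset_univ] at h1
    rw [← h1]
    exact Finset.prod_eq_one fun i _ => (h i).tot
  rw [this, one_mul]

theorem E1_nonneg (h : ∀ i, Good β ρ (W i) (w i)) {f : (Fin n → Ω) → ℝ} (hf : ∀ v, 0 ≤ f v) :
    0 ≤ E1 w f := by
  rw [← E1_const h 0]; exact E1_mono h hf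

theorem E1_le_one (h : ∀ i, Good β ρ (W i) (w i)) {f : (Fin n → Ω) → ℝ} (hf : ∀ v, f v ≤ 1) :
    E1 w f ≤ 1 := by
  rw [← E1_const h 1]; exact E1_mono h hf

theorem E1_abs (h : ∀ i, Good β ρ (W i) (w i)) (f : (Fin n → Ω) → ℝ) :
    |E1 w f| ≤ E1 w (fun v => |f v|) := by
  refine abs_le.2 ⟨?_, E1_mono h fun v => le_abs_self _⟩
  have := E1_mono h (f := fun v => (-1) * f v) (g := fun v => |f v|)
    (fun v => by have := neg_abs_le (f v); linarith)
  rw [E1_smul] at this; linarith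

theorem E2_nonneg (h : ∀ i, Good β ρ (W i) (w i)) {f g : (Fin n → Ω) → ℝ} (hf : ∀ v, 0 ≤ f v)
    (hg : ∀ v, 0 ≤ g v) : 0 ≤ E2 W f g :=
  Finset.sum_nonneg fun x _ => Finset.sum_nonneg fun y _ => mul_nonneg
    (Finset.prod_nonneg fun i _ => (h i).nn _ _) (mul_nonneg (hf x) (hg y))

theorem E2_mono (h : ∀ i, Good β ρ (W i) (w i)) {f g f' : (Fin n → Ω) → ℝ} (hf : ∀ v, f v ≤ f' v)
    (hg : ∀ v, 0 ≤ g v) : E2 W f g ≤ E2 W f' g :=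
  Finset.sum_le_sum fun x _ => Finset.sum_le_sum fun y _ => mul_le_mul_of_nonneg_left
    (mul_le_mul_of_nonneg_right (hf x) (hg y)) (Finset.prod_nonneg fun i _ => (h i).nn _ _)

theorem E2_add (f g f' : (Fin n → Ω) → ℝ) :
    E2 W (fun v => f v + f' v) g = E2 W f g + E2 W f' g := by
  unfold E2
  simp only [← Finset.sum_add_distrib]
  exact Finset.sum_congr rfl fun x _ => Finset.sum_congr rfl fun y _ => by ring

theorem E1_rs : ∀ {n : ℕ} {W : Fin n → Ω → Ω → ℝ} {w : Fin n → Ω → ℝ}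
    (_ : ∀ i, Good β ρ (W i) (w i)) (f : (Fin n → Ω) → ℝ) (i : Fin n),
    E1 w f = mn (w i) (fun x => E1 w (rs i x f)) := by
  intro n
  induction n with
  | zero => intro W w h f i; exact i.elim0
  | succ n ih =>
    intro W w h f i
    refine Fin.cases ?_ (fun i => ?_) i
    · rw [E1_succ]
      congr 1; funext x
      rw [E1_succ]
      simp only [sl_rs_zero]
      rw [mn_const (h 0)]
    · rw [E1_succ]
      have e : ∀ x, E1 w (rs i.succ x f) = mn (w 0) (fun y => E1 (fun i => w i.succ) (rs i x (sl f y))) := by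
        intro x; rw [E1_succ]; simp only [sl_rs_succ]
      simp only [e]
      have e2 : ∀ y, E1 (fun i => w i.succ) (sl f y) = mn (w i.succ) (fun x => E1 (fun i => w i.succ) (rs i x (sl f y))) :=
        fun y => ih (fun i => h i.succ) (sl f y) i
      simp only [e2]
      unfold mn
      simp only [Finset.mul_sum]
      rw [Finset.sum_comm]
      exact Finset.sum_congr rfl fun x _ => Finset.sum_congr rfl fun y _ => by ring

theorem Good.one (h : Good β ρ (Ω := Ω) W' w') : ∑ x, ∑ y, W' x y = 1 := by
  rw [← h.tot]; exact Finset.sum_congr rfl fun x _ => h.row x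

theorem E2_step (hβ : 0 < β) : ∀ {n : ℕ} {W : Fin n → Ω → Ω → ℝ} {w : Fin n → Ω → ℝ}
    (_ : ∀ i, Good β ρ (W i) (w i)) (f g : (Fin n → Ω) → ℝ) (_ : ∀ v, 0 ≤ f v) (_ : ∀ v, 0 ≤ g v)
    (i : Fin n) (y z : Ω) (_ : W i y z ≠ 0),
    β * E2 W (fun v => max (rs i y f v) (rs i z f v)) (rs i z g) ≤ E2 W f g := by
  classical
  intro n
  induction n with
  | zero => intro W w h f g _ _ i; exact i.elim0
  | succ n ih =>
    intro W w h f g hf hg i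
    have h' : ∀ i : Fin n, Good β ρ (W i.succ) (w i.succ) := fun i => h i.succ
    refine Fin.cases ?_ (fun i => ?_) i
    · intro y z hyz
      have e : ∀ x x', E2 (fun i => W i.succ) (sl (fun v => max (rs 0 y f v) (rs 0 z f v)) x) (sl (rs 0 z g) x')
          = E2 (fun i => W i.succ) (fun v => max (sl f y v) (sl f z v)) (sl g z) := by
        intro x x'
        rw [sl_rs_zero]
        congr 1; funext v
        have h1 := congrFun (sl_rs_zero f y x) v
        have h2 := congrFun (sl_rs_zero f z x) v
        simp only [sl] at h1 h2 ⊢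
        rw [h1, h2]
      rw [E2_succ]
      simp only [e]
      simp only [← Finset.sum_mul]
      rw [(h 0).one, one_mul, E2_succ]
      set T : Ω → Ω → ℝ := fun x x' => E2 (fun i => W i.succ) (sl f x) (sl g x') with hT
      have T0 : ∀ x x', 0 ≤ T x x' := fun x x' =>
        E2_nonneg h' (fun v => hf _) (fun v => hg _)
      have hyz' := (h 0).emin _ _ hyz
      have hzz' := (h 0).emin _ _ ((h 0).diag z ((h 0).wy hyz))
      have hcol : ∑ x, W 0 x z * T x z ≤ ∑ x, ∑ x', W 0 x x' * T x x' :=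
        Finset.sum_le_sum fun x _ => Finset.single_le_sum (f := fun x' => W 0 x x' * T x x')
          (fun x' _ => mul_nonneg ((h 0).nn _ _) (T0 _ _)) (Finset.mem_univ z)
      refine le_trans ?_ hcol
      by_cases hne : y = z
      · subst hne
        simp only [max_self]
        refine le_trans ?_ (Finset.single_le_sum (f := fun x => W 0 x y * T x y)
          (fun x' _ => mul_nonneg ((h 0).nn _ _) (T0 _ _)) (Finset.mem_univ y))
        exact mul_le_mul_of_nonneg_right hzz' (T0 _ _)
      · have h1 : ∑ x ∈ {y, z}, W 0 x z * T x z ≤ ∑ x, W 0 x z * T x z :=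
          Finset.sum_le_sum_of_subset_of_nonneg (Finset.subset_univ _)
            (fun x' _ _ => mul_nonneg ((h 0).nn _ _) (T0 _ _))
        rw [Finset.sum_pair hne] at h1
        refine le_trans ?_ h1
        have h2 : E2 (fun i => W i.succ) (fun v => max (sl f y v) (sl f z v)) (sl g z)
            ≤ T y z + T z z := by
          rw [hT]
          simp only
          rw [← E2_add]
          refine E2_mono h' (fun v => ?_) (fun v => hg _)
          have a1 : 0 ≤ sl f y v := hf _
          have a2 : 0 ≤ sl f z v := hf _
          exact max_le (by linarith) (by linarith)
        have h3 := mul_le_mul_of_nonneg_left h2 hβ.le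
        have h4 := mul_le_mul_of_nonneg_right hyz' (T0 y z)
        have h5 := mul_le_mul_of_nonneg_right hzz' (T0 z z)
        linarith
    · intro y z hyz
      rw [E2_succ, E2_succ, Finset.mul_sum]
      refine Finset.sum_le_sum fun x _ => ?_
      rw [Finset.mul_sum]
      refine Finset.sum_le_sum fun x' _ => ?_
      have := ih h' (sl f x) (sl g x') (fun v => hf _) (fun v => hg _) i y z hyz
      have e : sl (fun v => max (rs i.succ y f v) (rs i.succ z f v)) x
          = fun v => max (rs i y (sl f x) v) (rs i z (sl f x) v) := by
        rw [← sl_rs_succ, ← sl_rs_succ]; rfl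
      rw [e, sl_rs_succ]
      have := mul_le_mul_of_nonneg_left this ((h 0).nn x x')
      linarith

/-- Martingale difference variances. -/
noncomputable def V : (n : ℕ) → (Fin n → Ω → ℝ) → ((Fin n → Ω) → ℝ) → Fin n → ℝ
  | 0, _, _ => fun k => k.elim0
  | n + 1, w, f => Fin.cons (vr (w 0) (fun x => E1 (fun i => w i.succ) (sl f x)))
      (fun k => mn (w 0) (fun x => V n (fun i => w i.succ) (sl f x) k))

theorem V_zero (w : Fin (n + 1) → Ω → ℝ) (f : (Fin (n + 1) → Ω) → ℝ) :
    V (n + 1) w f 0 = vr (w 0) (fun x => E1 (fun i => w i.succ) (sl f x)) := rfl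

theorem V_succ (w : Fin (n + 1) → Ω → ℝ) (f : (Fin (n + 1) → Ω) → ℝ) (k : Fin n) :
    V (n + 1) w f k.succ = mn (w 0) (fun x => V n (fun i => w i.succ) (sl f x) k) := rfl

theorem V_nonneg : ∀ {n : ℕ} {W : Fin n → Ω → Ω → ℝ} {w : Fin n → Ω → ℝ}
    (_ : ∀ i, Good β ρ (W i) (w i)) (f : (Fin n → Ω) → ℝ) (k : Fin n), 0 ≤ V n w f k := by
  intro n
  induction n with
  | zero => intro W w h f i; exact i.elim0
  | succ n ih =>
    intro W w h f k
    refine Fin.cases ?_ (fun k => ?_) k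
    · exact vr_nonneg (h 0) _
    · exact Finset.sum_nonneg fun x _ => mul_nonneg ((h 0).wnn x) (ih (fun i => h i.succ) _ k)

theorem V_sum : ∀ {n : ℕ} {W : Fin n → Ω → Ω → ℝ} {w : Fin n → Ω → ℝ}
    (_ : ∀ i, Good β ρ (W i) (w i)) (f : (Fin n → Ω) → ℝ),
    ∑ k, V n w f k = E1 w (fun v => f v ^ 2) - E1 w f ^ 2 := by
  intro n
  induction n with
  | zero => intro W w h f; simp [E1]
  | succ n ih =>
    intro W w h f
    rw [Fin.sum_univ_succ, V_zero]
    simp only [V_succ]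
    have e : ∑ k : Fin n, mn (w 0) (fun x => V n (fun i => w i.succ) (sl f x) k)
        = mn (w 0) (fun x => E1 (fun i => w i.succ) (fun v => sl f x v ^ 2)
          - E1 (fun i => w i.succ) (sl f x) ^ 2) := by
      have := fun x => ih (fun i => h i.succ) (sl f x)
      unfold mn
      rw [Finset.sum_comm]
      simp only [← Finset.mul_sum, this]
    rw [e, mn_sub, vr_eq (h 0), E1_succ w f, E1_succ w (fun v => f v ^ 2)]
    have e3 : ∀ x, sl (fun v => f v ^ 2) x = fun v => sl f x v ^ 2 := fun x => rfl
    simp only [e3]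
    ring

theorem V_sum_le (h : ∀ i, Good β ρ (W i) (w i)) {f : (Fin n → Ω) → ℝ}
    (hf : ∀ v, f v ∈ Set.Icc (0:ℝ) 1) : ∑ k, V n w f k ≤ 1 := by
  rw [V_sum h]
  have := E1_le_one h (f := fun v => f v ^ 2) (fun v => by
    have := hf v; exact pow_le_one₀ this.1 this.2)
  nlinarith [sq_nonneg (E1 w f)]

theorem V_le_one (h : ∀ i, Good β ρ (W i) (w i)) {f : (Fin n → Ω) → ℝ}
    (hf : ∀ v, f v ∈ Set.Icc (0:ℝ) 1) (k : Fin n) : V n w f k ≤ 1 :=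
  (Finset.single_le_sum (fun k _ => V_nonneg h f k) (Finset.mem_univ k)).trans (V_sum_le h hf)

theorem vr_edge {W : Ω → Ω → ℝ} {w : Ω → ℝ} (h : Good β ρ W w) (a : Ω → ℝ) :
    2 * (1 - ρ) * vr w a ≤ ∑ y, ∑ z, W y z * (a y - a z) ^ 2 := by
  have h1 := cov_le h a a
  have e : ∑ y, ∑ z, W y z * (a y - a z) ^ 2
      = jt W (fun x => a x ^ 2) (fun _ => 1) - 2 * jt W a a + jt W (fun _ => 1) (fun x => a x ^ 2) := by
    unfold jt
    simp only [Finset.mul_sum, ← Finset.sum_sub_distrib, ← Finset.sum_add_distrib]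
    exact Finset.sum_congr rfl fun x _ => Finset.sum_congr rfl fun y _ => by ring
  rw [e, jt_left h, jt_right h]
  have := vr_eq h a
  nlinarith

theorem V_inf : ∀ {n : ℕ} {W : Fin n → Ω → Ω → ℝ} {w : Fin n → Ω → ℝ}
    (_ : ∀ i, Good β ρ (W i) (w i)) (f : (Fin n → Ω) → ℝ) (_ : ∀ v, f v ∈ Set.Icc (0:ℝ) 1)
    (k : Fin n),
    2 * (1 - ρ) * V n w f k ≤ ∑ y, ∑ z, W k y z * E1 w (fun v => |rs k y f v - rs k z f v|) := by
  intro n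
  induction n with
  | zero => intro W w h f _ i; exact i.elim0
  | succ n ih =>
    intro W w h f hf k
    have h' : ∀ i : Fin n, Good β ρ (W i.succ) (w i.succ) := fun i => h i.succ
    refine Fin.cases ?_ (fun k => ?_) k
    · rw [V_zero]
      refine (vr_edge (h 0) _).trans ?_
      refine Finset.sum_le_sum fun y _ => Finset.sum_le_sum fun z _ => ?_
      refine mul_le_mul_of_nonneg_left ?_ ((h 0).nn y z)
      rw [E1_succ]
      have e : ∀ x, sl (fun v => |rs 0 y f v - rs 0 z f v|) x = fun v => |sl f y v - sl f z v| := by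
        intro x
        rw [← sl_rs_zero f y x, ← sl_rs_zero f z x]; rfl
      simp only [e]
      rw [mn_const (h 0)]
      have h1 := E1_abs h' (fun v => sl f y v - sl f z v)
      rw [E1_sub] at h1
      refine le_trans ?_ h1
      have b1 := E1_nonneg h' (f := sl f y) (fun v => (hf _).1)
      have b2 := E1_nonneg h' (f := sl f z) (fun v => (hf _).1)
      have b3 := E1_le_one h' (f := sl f y) (fun v => (hf _).2)
      have b4 := E1_le_one h' (f := sl f z) (fun v => (hf _).2)
      rw [← sq_abs]
      have : |E1 (fun i => w i.succ) (sl f y) - E1 (fun i => w i.succ) (sl f z)| ≤ 1 :=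
        abs_le.2 ⟨by linarith, by linarith⟩
      nlinarith [abs_nonneg (E1 (fun i => w i.succ) (sl f y) - E1 (fun i => w i.succ) (sl f z))]
    · rw [V_succ, ← mn_smul]
      have h1 : mn (w 0) (fun x => 2 * (1 - ρ) * V n (fun i => w i.succ) (sl f x) k)
          ≤ mn (w 0) (fun x => ∑ y, ∑ z, W k.succ y z *
            E1 (fun i => w i.succ) (fun v => |rs k y (sl f x) v - rs k z (sl f x) v|)) :=
        mn_mono (h 0) fun x _ => ih h' (sl f x) (fun v => hf _) k
      refine h1.trans (le_of_eq ?_)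
      have e : ∀ y z, E1 w (fun v => |rs k.succ y f v - rs k.succ z f v|) = mn (w 0) (fun x =>
          E1 (fun i => w i.succ) (fun v => |rs k y (sl f x) v - rs k z (sl f x) v|)) := by
        intro y z
        rw [E1_succ]
        congr 1; funext x
        rw [← sl_rs_succ, ← sl_rs_succ]; rfl
      simp only [e]
      unfold mn
      simp only [Finset.mul_sum]
      rw [Finset.sum_comm]
      refine Finset.sum_congr rfl fun y _ => ?_
      rw [Finset.sum_comm]
      exact Finset.sum_congr rfl fun z _ => Finset.sum_congr rfl fun x _ => by ring

theorem core1 (hβ : 0 < β) (hρ : 0 ≤ ρ) (hρ1 : ρ < 1) (κ : ℝ)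
    (hκ0 : 0 ≤ κ) (hκ1 : κ ≤ 1 / 2) (hκ : κ * (1 / β + 1) ^ 2 ≤ (1 - ρ) / 4)
    (s : ℕ) (hs : 2 ≤ s) (C : ℝ) (hC : 0 ≤ C)
    (H : ∀ (W : Ω → Ω → ℝ) (w : Ω → ℝ), Good β ρ W w →
      ∀ a b : Ω → ℝ, (∀ x, a x ∈ Set.Icc (0:ℝ) 1) → (∀ x, b x ∈ Set.Icc (0:ℝ) 1) →
      mn w a ^ s * mn w b ^ s - C * (vr w a * vr w b)
        ≤ jt W (fun x => a x ^ s) (fun x => b x ^ s)) :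
    ∀ {n : ℕ} {W : Fin n → Ω → Ω → ℝ} {w : Fin n → Ω → ℝ}
    (_ : ∀ i, Good β ρ (W i) (w i)) (f g : (Fin n → Ω) → ℝ) (_ : ∀ v, f v ∈ Set.Icc (0:ℝ) 1)
    (_ : ∀ v, g v ∈ Set.Icc (0:ℝ) 1),
    E1 w f ^ s * E1 w g ^ s - C * ∑ k, V n w f k ^ ((1 + κ) / 2) * V n w g k ^ ((1 + κ) / 2)
      ≤ E2 W f g := by
  set θ := (1 + κ) / 2 with hθ
  have hθ1 : θ ≤ 1 := by linarith
  have hθ0 : 0 < θ := by positivity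
  intro n
  induction n with
  | zero =>
    intro W w h f g hf hg
    simp only [E1, E2, Finset.univ_eq_empty, Finset.prod_empty, one_mul, Finset.sum_empty, mul_zero, sub_zero]
    rw [Fintype.sum_unique, Fintype.sum_unique, Fintype.sum_unique, Fintype.sum_unique, ← mul_pow]
    have a := hf default
    have b := hg default
    refine pow_le_of_le_one (mul_nonneg a.1 b.1) ?_ (by omega)
    nlinarith [a.1, a.2, b.1, b.2]
  | succ n ih =>
    intro W w h f g hf hg
    have h' : ∀ i : Fin n, Good β ρ (W i.succ) (w i.succ) := fun i => h i.succ
    set w' : Fin n → Ω → ℝ := fun i => w i.succ with hw'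
    have IH : ∀ x y, E1 w' (sl f x) ^ s * E1 w' (sl g y) ^ s
        - C * ∑ k, V n w' (sl f x) k ^ θ * V n w' (sl g y) k ^ θ
          ≤ E2 (fun i => W i.succ) (sl f x) (sl g y) := fun x y =>
      ih h' (sl f x) (sl g y) (fun v => hf _) (fun v => hg _)
    have h1 : jt (W 0) (fun x => E1 w' (sl f x) ^ s) (fun y => E1 w' (sl g y) ^ s)
        - C * ∑ k, jt (W 0) (fun x => V n w' (sl f x) k ^ θ) (fun y => V n w' (sl g y) k ^ θ)
        ≤ E2 W f g := by
      rw [E2_succ]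
      have e : jt (W 0) (fun x => E1 w' (sl f x) ^ s) (fun y => E1 w' (sl g y) ^ s)
        - C * ∑ k, jt (W 0) (fun x => V n w' (sl f x) k ^ θ) (fun y => V n w' (sl g y) k ^ θ)
        = ∑ x, ∑ y, W 0 x y * (E1 w' (sl f x) ^ s * E1 w' (sl g y) ^ s
        - C * ∑ k, V n w' (sl f x) k ^ θ * V n w' (sl g y) k ^ θ) := by
        have e1 : ∑ k, jt (W 0) (fun x => V n w' (sl f x) k ^ θ) (fun y => V n w' (sl g y) k ^ θ)
          = ∑ x, ∑ y, W 0 x y * ∑ k, V n w' (sl f x) k ^ θ * V n w' (sl g y) k ^ θ := by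
          unfold jt
          rw [Finset.sum_comm]
          refine Finset.sum_congr rfl fun x _ => ?_
          rw [Finset.sum_comm]
          refine Finset.sum_congr rfl fun y _ => ?_
          rw [Finset.mul_sum]
        rw [e1]
        unfold jt
        simp only [mul_sub, Finset.sum_sub_distrib]
        congr 1
        rw [Finset.mul_sum]
        refine Finset.sum_congr rfl fun x _ => ?_
        rw [Finset.mul_sum]
        refine Finset.sum_congr rfl fun y _ => ?_
        ring
      rw [e]
      exact Finset.sum_le_sum fun x _ => Finset.sum_le_sum fun y _ =>
        mul_le_mul_of_nonneg_left (IH x y) ((h 0).nn x y)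
    refine le_trans ?_ h1
    have h2 := H (W 0) (w 0) (h 0) (fun x => E1 w' (sl f x)) (fun y => E1 w' (sl g y))
      (fun x => ⟨E1_nonneg h' fun v => (hf _).1, E1_le_one h' fun v => (hf _).2⟩)
      (fun x => ⟨E1_nonneg h' fun v => (hg _).1, E1_le_one h' fun v => (hg _).2⟩)
    rw [← E1_succ, ← E1_succ, ← V_zero, ← V_zero] at h2
    have h3 : ∀ k : Fin n, jt (W 0) (fun x => V n w' (sl f x) k ^ θ) (fun y => V n w' (sl g y) k ^ θ)
        ≤ V (n + 1) w f k.succ ^ θ * V (n + 1) w g k.succ ^ θ := by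
      intro k
      rw [V_succ, V_succ]
      exact s2 (h 0) hβ hρ hρ1 κ hκ0 hκ1 hκ _ _ (fun x => V_nonneg h' _ _) (fun x => V_nonneg h' _ _)
    have h4 : V (n + 1) w f 0 * V (n + 1) w g 0 ≤ V (n + 1) w f 0 ^ θ * V (n + 1) w g 0 ^ θ := by
      have lem : ∀ z : ℝ, 0 ≤ z → z ≤ 1 → z ≤ z ^ θ := fun z z0 z1 => by
        have := Real.rpow_le_rpow_of_exponent_ge' z0 z1 hθ0.le hθ1
        rwa [Real.rpow_one] at this
      exact mul_le_mul (lem _ (V_nonneg h f 0) (V_le_one h hf 0)) (lem _ (V_nonneg h g 0) (V_le_one h hg 0))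
        (V_nonneg h g 0) (Real.rpow_nonneg (V_nonneg h f 0) _)
    rw [Fin.sum_univ_succ]
    have h5 := Finset.sum_le_sum fun (k : Fin n) (_ : k ∈ Finset.univ) => h3 k
    have h6 := mul_le_mul_of_nonneg_left h5 hC
    have h7 := mul_le_mul_of_nonneg_left h4 hC
    rw [mul_add]
    linarith

theorem core2 (Ω : Type) [Fintype Ω] (β ρ : ℝ) (hβ : 0 < β) (hρ : 0 ≤ ρ) (hρ1 : ρ < 1)
    (μ ν : ℝ) (hμ : 0 < μ) (hν : 0 < ν) :
    ∃ τ : ℝ, 0 < τ ∧ ∃ δ : ℝ, 0 < δ ∧ ∀ {n : ℕ} {W : Fin n → Ω → Ω → ℝ} {w : Fin n → Ω → ℝ}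
    (_ : ∀ i, Good β ρ (W i) (w i)) (f g : (Fin n → Ω) → ℝ) (_ : ∀ v, f v ∈ Set.Icc (0:ℝ) 1)
    (_ : ∀ v, g v ∈ Set.Icc (0:ℝ) 1), μ ≤ E1 w f → ν ≤ E1 w g → (∀ k, V n w f k ≤ τ) →
    δ ≤ E2 W f g := by
  obtain ⟨s, hs, C, hC, H⟩ := s1 Ω β ρ hβ hρ hρ1
  set κ : ℝ := min (1 / 2) ((1 - ρ) / 4 / (1 / β + 1) ^ 2) with hκdef
  have hκ0 : 0 < κ := by
    have : 0 < 1 - ρ := by linarith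
    positivity
  have hκ1 : κ ≤ 1 / 2 := min_le_left _ _
  have hκ : κ * (1 / β + 1) ^ 2 ≤ (1 - ρ) / 4 := by
    rw [← le_div_iff₀ (by positivity)]; exact min_le_right _ _
  set q := (μ * ν) ^ s / 2 with hq
  have hq0 : 0 < q := by positivity
  set t := q / (C + 1) with ht
  have ht0 : 0 < t := by positivity
  refine ⟨t ^ (2 / κ), by positivity, q, hq0, ?_⟩
  intro n W w h f g hf hg hEf hEg hV
  have h1 := core1 hβ hρ hρ1 κ hκ0.le hκ1 hκ s hs C hC H h f g hf hg
  have h2 : ∀ k, V n w f k ^ ((1 + κ) / 2) * V n w g k ^ ((1 + κ) / 2)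
      ≤ t * ((V n w f k + V n w g k) / 2) := by
    intro k
    have f0 := V_nonneg h f k
    have g0 := V_nonneg h g k
    have g1 := V_le_one h hg k
    have a1 : V n w f k ^ ((1 + κ) / 2) ≤ t * √(V n w f k) := by
      have : (1 + κ) / 2 = κ / 2 + 1 / 2 := by ring
      rw [this, Real.rpow_add' f0 (by positivity), ← Real.sqrt_eq_rpow]
      refine mul_le_mul_of_nonneg_right ?_ (Real.sqrt_nonneg _)
      calc V n w f k ^ (κ / 2) ≤ (t ^ (2 / κ)) ^ (κ / 2) :=
            Real.rpow_le_rpow f0 (hV k) (by positivity)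
        _ = t := by
            rw [← Real.rpow_mul ht0.le]
            have : 2 / κ * (κ / 2) = 1 := by field_simp
            rw [this, Real.rpow_one]
    have a2 : V n w g k ^ ((1 + κ) / 2) ≤ √(V n w g k) := by
      rw [Real.sqrt_eq_rpow]
      exact Real.rpow_le_rpow_of_exponent_ge' g0 g1 (by positivity) (by linarith)
    have a3 : √(V n w f k) * √(V n w g k) ≤ (V n w f k + V n w g k) / 2 := by
      nlinarith [sq_nonneg (√(V n w f k) - √(V n w g k)), Real.sq_sqrt f0, Real.sq_sqrt g0]
    calc _ ≤ (t * √(V n w f k)) * √(V n w g k) :=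
          mul_le_mul a1 a2 (Real.rpow_nonneg g0 _) (by positivity)
      _ = t * (√(V n w f k) * √(V n w g k)) := by ring
      _ ≤ _ := by gcongr
  have h3 : ∑ k, V n w f k ^ ((1 + κ) / 2) * V n w g k ^ ((1 + κ) / 2) ≤ t := by
    refine (Finset.sum_le_sum fun k _ => h2 k).trans ?_
    rw [← Finset.mul_sum, ← Finset.sum_div, Finset.sum_add_distrib]
    have := V_sum_le h hf
    have := V_sum_le h hg
    calc _ ≤ t * 1 := by gcongr; linarith
      _ = t := mul_one t
  have h4 : C * ∑ k, V n w f k ^ ((1 + κ) / 2) * V n w g k ^ ((1 + κ) / 2) ≤ q := by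
    calc _ ≤ C * t := by gcongr
      _ ≤ (C + 1) * t := by gcongr; linarith
      _ = q := by rw [ht]; field_simp
  have h5 : 2 * q ≤ E1 w f ^ s * E1 w g ^ s := by
    rw [hq, mul_pow]
    have e0 : 0 ≤ E1 w f := by linarith
    have : μ ^ s * ν ^ s ≤ E1 w f ^ s * E1 w g ^ s :=
      mul_le_mul (pow_le_pow_left₀ hμ.le (by assumption) s) (pow_le_pow_left₀ hν.le (by assumption) s)
        (by positivity) (pow_nonneg e0 s)
    linarith
  linarith
end product

section loops
variable {Ω : Type} [Fintype Ω] {β ρ : ℝ} {n : ℕ}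

/-- all restrictions of size at most `j` have expectation at least `ν` -/
def Rz (w : Fin n → Ω → ℝ) (ν : ℝ) : ℕ → ((Fin n → Ω) → ℝ) → Prop
  | 0, g => ν ≤ E1 w g
  | j + 1, g => ν ≤ E1 w g ∧ ∀ i x, w i x ≠ 0 → Rz w ν j (rs i x g)

variable {W : Fin n → Ω → Ω → ℝ} {w : Fin n → Ω → ℝ}

theorem Rz.le {ν : ℝ} : ∀ {j : ℕ} {g : (Fin n → Ω) → ℝ}, Rz w ν j g → ν ≤ E1 w g
  | 0, _, h => h
  | _ + 1, _, h => h.1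

theorem Rz.mono {ν ν' : ℝ} (hν : ν' ≤ ν) : ∀ {j : ℕ} {g : (Fin n → Ω) → ℝ}, Rz w ν j g → Rz w ν' j g
  | 0, _, h => le_trans hν h
  | _ + 1, _, h => ⟨le_trans hν h.1, fun i x hx => Rz.mono hν (h.2 i x hx)⟩

/-- a single restriction cannot decrease much if none increases much -/
theorem rs_lower (h : ∀ i, Good β ρ (W i) (w i)) (hβ : 0 < β) (f : (Fin n → Ω) → ℝ) (i : Fin n)
    (M : ℝ) (hM : ∀ x, w i x ≠ 0 → E1 w (rs i x f) ≤ M) {x : Ω} (hx : w i x ≠ 0) :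
    β * (M - E1 w (rs i x f)) ≤ M - E1 w f := by
  have e : M - E1 w f = ∑ x, w i x * (M - E1 w (rs i x f)) := by
    have := mn_sub (w := w i) (fun _ => M) (fun x => E1 w (rs i x f))
    rw [mn_const (h i), ← E1_rs h f i] at this
    rw [← this]; rfl
  rw [e]
  have h0 : ∀ x, 0 ≤ w i x * (M - E1 w (rs i x f)) := by
    intro x
    by_cases hx : w i x = 0
    · simp [hx]
    · exact mul_nonneg ((h i).wnn x) (by linarith [hM x hx])
  refine le_trans ?_ (Finset.single_le_sum (fun x _ => h0 x) (Finset.mem_univ x))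
  exact mul_le_mul_of_nonneg_right ((h i).wmin x hx) (by linarith [hM x hx])

theorem E2_diag (h : ∀ i, Good β ρ (W i) (w i)) (hβ : 0 < β) (f g : (Fin n → Ω) → ℝ)
    (hf : ∀ v, 0 ≤ f v) (hg : ∀ v, 0 ≤ g v) (i : Fin n) {x : Ω} (hx : w i x ≠ 0) :
    β * E2 W (rs i x f) (rs i x g) ≤ E2 W f g := by
  have := E2_step hβ h f g hf hg i x x ((h i).diag x hx)
  simpa only [max_self] using this

theorem exists_edge (h : ∀ i, Good β ρ (W i) (w i)) (hρ1 : ρ < 1) (f : (Fin n → Ω) → ℝ)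
    (hf : ∀ v, f v ∈ Set.Icc (0:ℝ) 1) (k : Fin n) (τ : ℝ) (hV : τ < V n w f k) :
    ∃ y z, W k y z ≠ 0 ∧ 2 * (1 - ρ) * τ ≤ E1 w (fun v => |rs k y f v - rs k z f v|) := by
  by_contra hc
  push Not at hc
  have h1 := V_inf h f hf k
  have h2 : ∑ y, ∑ z, W k y z * E1 w (fun v => |rs k y f v - rs k z f v|)
      ≤ ∑ y, ∑ z, W k y z * (2 * (1 - ρ) * τ) := by
    refine Finset.sum_le_sum fun y _ => Finset.sum_le_sum fun z _ => ?_
    by_cases hz : W k y z = 0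
    · simp [hz]
    · exact mul_le_mul_of_nonneg_left (hc y z hz).le ((h k).nn y z)
  simp only [← Finset.sum_mul] at h2
  rw [(h k).one, one_mul] at h2
  have : 2 * (1 - ρ) * τ < 2 * (1 - ρ) * V n w f k := by
    apply mul_lt_mul_of_pos_left hV; linarith
  linarith

theorem E1_max (f g : (Fin n → Ω) → ℝ) : 2 * E1 w (fun v => max (f v) (g v))
    = E1 w f + E1 w g + E1 w (fun v => |f v - g v|) := by
  rw [← E1_add, ← E1_add, ← E1_smul]
  congr 1; funext v
  rcases le_total (f v) (g v) with h | h
  · rw [max_eq_right h, abs_of_nonpos (by linarith)]; ring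
  · rw [max_eq_left h, abs_of_nonneg (by linarith)]; ring

theorem rs_mem {f : (Fin n → Ω) → ℝ} (hf : ∀ v, f v ∈ Set.Icc (0:ℝ) 1) (i : Fin n) (x : Ω) :
    ∀ v, rs i x f v ∈ Set.Icc (0:ℝ) 1 := fun _ => hf _

theorem lemB (Ω : Type) [Fintype Ω] (β ρ : ℝ) (hβ : 0 < β) (hρ : 0 ≤ ρ) (hρ1 : ρ < 1)
    (μ ν : ℝ) (hμ : 0 < μ) (hν : 0 < ν) :
    ∃ J : ℕ, ∃ δ : ℝ, 0 < δ ∧ ∀ {n : ℕ} {W : Fin n → Ω → Ω → ℝ} {w : Fin n → Ω → ℝ}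
    (_ : ∀ i, Good β ρ (W i) (w i)) (f g : (Fin n → Ω) → ℝ) (_ : ∀ v, f v ∈ Set.Icc (0:ℝ) 1)
    (_ : ∀ v, g v ∈ Set.Icc (0:ℝ) 1), μ ≤ E1 w f → Rz w ν J g → δ ≤ E2 W f g := by
  obtain ⟨τ, hτ, δc, hδc, core⟩ := core2 Ω β ρ hβ hρ hρ1 μ ν hμ hν
  obtain ⟨θ, hθ, hθ2⟩ : ∃ θ : ℝ, 0 < θ ∧ θ * (1 + 1 / β) = (1 - ρ) * τ := by
    have : 0 < 1 + 1 / β := by positivity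
    refine ⟨(1 - ρ) * τ / (1 + 1 / β), ?_, ?_⟩
    · have : 0 < 1 - ρ := by linarith
      positivity
    · field_simp
  have claim : ∀ j : ℕ, ∃ δ : ℝ, 0 < δ ∧ ∀ {n : ℕ} {W : Fin n → Ω → Ω → ℝ} {w : Fin n → Ω → ℝ}
    (_ : ∀ i, Good β ρ (W i) (w i)) (f g : (Fin n → Ω) → ℝ) (_ : ∀ v, f v ∈ Set.Icc (0:ℝ) 1)
    (_ : ∀ v, g v ∈ Set.Icc (0:ℝ) 1), μ ≤ E1 w f → 1 + θ - j * θ ≤ E1 w f →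
      Rz w ν j g → δ ≤ E2 W f g := by
    intro j
    induction j with
    | zero =>
      refine ⟨1, one_pos, ?_⟩
      intro n W w h f g hf hg h1 h2 h3
      have := E1_le_one h (fun v => (hf v).2)
      simp at h2
      linarith
    | succ j ih =>
      obtain ⟨δ, hδ, ih⟩ := ih
      refine ⟨min δc (β * δ), by positivity, ?_⟩
      intro n W w h f g hf hg h1 h2 h3
      push_cast at h2
      by_cases hV : ∀ k, V n w f k ≤ τ
      · exact (min_le_left _ _).trans (core h f g hf hg h1 h3.1 hV)
      push Not at hV
      obtain ⟨k, hk⟩ := hV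
      refine (min_le_right _ _).trans ?_
      by_cases hx : ∃ x, w k x ≠ 0 ∧ E1 w f + θ ≤ E1 w (rs k x f)
      · obtain ⟨x, hx, hx2⟩ := hx
        refine le_trans ?_ (E2_diag h hβ f g (fun v => (hf v).1) (fun v => (hg v).1) k hx)
        refine mul_le_mul_of_nonneg_left ?_ hβ.le
        exact ih h _ _ (rs_mem hf k x) (rs_mem hg k x) (by linarith) (by linarith) (h3.2 k x hx)
      · push Not at hx
        obtain ⟨y, z, hyz, hd⟩ := exists_edge h hρ1 f hf k τ hk
        refine le_trans ?_ (E2_step hβ h f g (fun v => (hf v).1) (fun v => (hg v).1) k y z hyz)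
        refine mul_le_mul_of_nonneg_left ?_ hβ.le
        have low : ∀ x, w k x ≠ 0 → E1 w f + θ - θ / β ≤ E1 w (rs k x f) := by
          intro x hx'
          have := rs_lower h hβ f k (E1 w f + θ) (fun x hx' => (hx x hx').le) hx'
          have h5 : E1 w f + θ - E1 w (rs k x f) ≤ θ / β := by
            rw [le_div_iff₀ hβ]; linarith
          linarith
        have ly := low y ((h k).wx hyz)
        have lz := low z ((h k).wy hyz)
        have hm := E1_max (w := w) (rs k y f) (rs k z f)
        have e : θ * (1 + 1 / β) = θ + θ / β := by ring
        have hup : E1 w f + θ ≤ E1 w (fun v => max (rs k y f v) (rs k z f v)) := by linarith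
        exact ih h _ _ (fun v => ⟨le_max_of_le_left (hf _).1, max_le (hf _).2 (hf _).2⟩)
          (rs_mem hg k z) (by linarith) (by linarith) (h3.2 k z ((h k).wy hyz))
  obtain ⟨J, hJ⟩ := exists_nat_gt ((1 + θ) / θ)
  obtain ⟨δ, hδ, hc⟩ := claim J
  refine ⟨J, δ, hδ, ?_⟩
  intro n W w h f g hf hg h1 h2
  refine hc h f g hf hg h1 ?_ h2
  rw [div_lt_iff₀ hθ] at hJ
  linarith

theorem dich (h : ∀ i, Good β ρ (W i) (w i)) (hβ : 0 < β) (hβ1 : β ≤ 1) (M : ℝ) :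
    ∀ (j : ℕ) (t : ℝ) (_ : 0 ≤ t) (f : (Fin n → Ω) → ℝ) (_ : ∀ v, f v ∈ Set.Icc (0:ℝ) 1),
      M - t ≤ E1 w f → Rz w (M - t / β ^ j) j f ∨
        ∃ f' : (Fin n → Ω) → ℝ, (∀ v, f' v ∈ Set.Icc (0:ℝ) 1) ∧ M ≤ E1 w f' ∧
          β ^ j * E2 W f' f' ≤ E2 W f f := by
  intro j
  induction j with
  | zero => intro t ht f hf h1; left; simpa [Rz] using h1
  | succ j ih =>
    intro t ht f hf h1
    by_contra hc
    push Not at hc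
    obtain ⟨hc1, hc2⟩ := hc
    apply hc1
    have hp : β ^ (j + 1) ≤ β := by
      rw [pow_succ]
      exact mul_le_of_le_one_left hβ.le (pow_le_one₀ hβ.le hβ1)
    have up : ∀ i x, w i x ≠ 0 → E1 w (rs i x f) ≤ M := by
      intro i x hx
      by_contra hlt
      push Not at hlt
      have a := hc2 _ (rs_mem hf i x) hlt.le
      have b := E2_diag h hβ f f (fun v => (hf v).1) (fun v => (hf v).1) i hx
      have c : 0 ≤ E2 W (rs i x f) (rs i x f) := E2_nonneg h (fun v => (hf _).1) (fun v => (hf _).1)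
      have := mul_le_mul_of_nonneg_right hp c
      linarith
    refine ⟨?_, ?_⟩
    · have : t ≤ t / β ^ (j + 1) := by
        rw [le_div_iff₀ (by positivity)]
        exact mul_le_of_le_one_right ht (pow_le_one₀ hβ.le hβ1)
      linarith
    · intro i x hx
      have h2 := rs_lower h hβ f i M (fun x hx => up i x hx) hx
      have h3 : M - t / β ≤ E1 w (rs i x f) := by
        have : M - E1 w (rs i x f) ≤ t / β := by rw [le_div_iff₀ hβ]; linarith
        linarith
      rcases ih (t / β) (by positivity) (rs i x f) (rs_mem hf i x) h3 with h4 | ⟨f', hf', h5, h6⟩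
      · have e : t / β / β ^ j = t / β ^ (j + 1) := by rw [div_div, pow_succ']
        rwa [e] at h4
      · exfalso
        have a := hc2 f' hf' h5
        have b := E2_diag h hβ f f (fun v => (hf v).1) (fun v => (hf v).1) i hx
        have := mul_le_mul_of_nonneg_left h6 hβ.le
        rw [pow_succ'] at a
        linarith

theorem lemA (Ω : Type) [Fintype Ω] (β ρ : ℝ) (hβ : 0 < β) (hβ1 : β ≤ 1) (hρ : 0 ≤ ρ) (hρ1 : ρ < 1)
    (μ : ℝ) (hμ : 0 < μ) :
    ∃ δ : ℝ, 0 < δ ∧ ∀ {n : ℕ} {W : Fin n → Ω → Ω → ℝ} {w : Fin n → Ω → ℝ}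
    (_ : ∀ i, Good β ρ (W i) (w i)) (f : (Fin n → Ω) → ℝ) (_ : ∀ v, f v ∈ Set.Icc (0:ℝ) 1),
      μ ≤ E1 w f → δ ≤ E2 W f f := by
  obtain ⟨J, δB, hδB, hB⟩ := lemB Ω β ρ hβ hρ hρ1 μ (μ / 2) hμ (by positivity)
  obtain ⟨θ, hθ, hθ2⟩ : ∃ θ : ℝ, 0 < θ ∧ θ / β ^ J = μ / 2 :=
    ⟨μ / 2 * β ^ J, by positivity, by field_simp⟩
  have claim : ∀ j : ℕ, ∃ δ : ℝ, 0 < δ ∧ ∀ {n : ℕ} {W : Fin n → Ω → Ω → ℝ} {w : Fin n → Ω → ℝ}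
    (_ : ∀ i, Good β ρ (W i) (w i)) (f : (Fin n → Ω) → ℝ) (_ : ∀ v, f v ∈ Set.Icc (0:ℝ) 1),
      μ ≤ E1 w f → 1 + θ - j * θ ≤ E1 w f → δ ≤ E2 W f f := by
    intro j
    induction j with
    | zero =>
      refine ⟨1, one_pos, ?_⟩
      intro n W w h f hf h1 h2
      have := E1_le_one h (fun v => (hf v).2)
      simp at h2
      linarith
    | succ j ih =>
      obtain ⟨δ, hδ, ih⟩ := ih
      refine ⟨min δB (β ^ J * δ), by positivity, ?_⟩
      intro n W w h f hf h1 h2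
      push_cast at h2
      rcases dich h hβ hβ1 (E1 w f + θ) J θ hθ.le f hf (by linarith) with h3 | ⟨f', hf', h3, h4⟩
      · refine (min_le_left _ _).trans (hB h f f hf hf h1 (h3.mono ?_))
        rw [hθ2]; linarith
      · refine (min_le_right _ _).trans (le_trans ?_ h4)
        refine mul_le_mul_of_nonneg_left ?_ (by positivity)
        exact ih h f' hf' (by linarith) (by linarith)
  obtain ⟨J', hJ'⟩ := exists_nat_gt ((1 + θ) / θ)
  obtain ⟨δ, hδ, hc⟩ := claim J'
  refine ⟨δ, hδ, ?_⟩
  intro n W w h f hf h1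
  refine hc h f hf h1 ?_
  rw [div_lt_iff₀ hθ] at hJ'
  linarith
end loops

section reduction

theorem exists_min {ι : Type} [Finite ι] (u : ι → ℝ) (hu : ∀ i, 0 ≤ u i) :
    ∃ β : ℝ, 0 < β ∧ β ≤ 1 ∧ ∀ i, u i ≠ 0 → β ≤ u i := by
  classical
  have := Fintype.ofFinite ι
  have key : ∀ s : Finset ι, ∃ β : ℝ, 0 < β ∧ β ≤ 1 ∧ ∀ i ∈ s, u i ≠ 0 → β ≤ u i := by
    intro s
    induction s using Finset.induction_on with
    | empty => exact ⟨1, one_pos, le_rfl, by simp⟩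
    | insert a s _ ih =>
      obtain ⟨β, h0, h1, h2⟩ := ih
      by_cases ha : u a = 0
      · refine ⟨β, h0, h1, ?_⟩
        intro i hi hne
        rcases Finset.mem_insert.1 hi with rfl | hi
        · exact absurd ha hne
        · exact h2 i hi hne
      · refine ⟨min β (u a), lt_min h0 (lt_of_le_of_ne (hu a) (Ne.symm ha)),
          (min_le_left _ _).trans h1, ?_⟩
        intro i hi hne
        rcases Finset.mem_insert.1 hi with rfl | hi
        · exact min_le_right _ _
        · exact (min_le_left _ _).trans (h2 i hi hne)
  obtain ⟨β, h0, h1, h2⟩ := key Finset.univ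
  exact ⟨β, h0, h1, fun i hi => h2 i (Finset.mem_univ i) hi⟩

variable {Ω : Type} [Fintype Ω]

/-- squared discrepancy along the edges -/
noncomputable def dsc (W : Ω → Ω → ℝ) (a b : Ω → ℝ) : ℝ := ∑ x, ∑ y, W x y * (a x - b y) ^ 2

theorem dsc_nonneg {W : Ω → Ω → ℝ} (hW : ∀ x y, 0 ≤ W x y) (a b : Ω → ℝ) : 0 ≤ dsc W a b :=
  Finset.sum_nonneg fun x _ => Finset.sum_nonneg fun y _ => mul_nonneg (hW x y) (sq_nonneg _)

theorem dsc_edge {W : Ω → Ω → ℝ} {β : ℝ} (hβ : 0 < β) (hW : ∀ x y, 0 ≤ W x y)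
    (hmin : ∀ x y, W x y ≠ 0 → β ≤ W x y) (a b : Ω → ℝ) {x y : Ω} (h : W x y ≠ 0) :
    |a x - b y| ≤ √(dsc W a b / β) := by
  apply Real.abs_le_sqrt
  rw [le_div_iff₀ hβ]
  have h1 : W x y * (a x - b y) ^ 2 ≤ dsc W a b :=
    le_trans (Finset.single_le_sum (f := fun y => W x y * (a x - b y) ^ 2)
      (fun y _ => mul_nonneg (hW x y) (sq_nonneg _)) (Finset.mem_univ y))
      (Finset.single_le_sum (f := fun x => ∑ y, W x y * (a x - b y) ^ 2)
      (fun x _ => Finset.sum_nonneg fun y _ => mul_nonneg (hW x y) (sq_nonneg _))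
        (Finset.mem_univ x))
  have := mul_le_mul_of_nonneg_right (hmin x y h) (sq_nonneg (a x - b y))
  linarith

theorem dsc_eq {W : Ω → Ω → ℝ} {w : Ω → ℝ} (row : ∀ x, ∑ y, W x y = w x)
    (col : ∀ y, ∑ x, W x y = w y) (a b : Ω → ℝ) :
    dsc W a b = mn w (fun x => a x ^ 2) + mn w (fun x => b x ^ 2) - 2 * jt W a b := by
  have e1 : mn w (fun x => a x ^ 2) = ∑ x, ∑ y, W x y * a x ^ 2 := by
    simp only [mn, ← row, Finset.sum_mul]
  have e2 : mn w (fun x => b x ^ 2) = ∑ x, ∑ y, W x y * b y ^ 2 := by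
    rw [Finset.sum_comm]
    simp only [mn, ← col, Finset.sum_mul]
  rw [e1, e2, dsc, jt]
  simp only [Finset.mul_sum, ← Finset.sum_add_distrib, ← Finset.sum_sub_distrib]
  exact Finset.sum_congr rfl fun x _ => Finset.sum_congr rfl fun y _ => by ring

/-- gap from a uniform path bound -/
theorem gap_of_path {W : Ω → Ω → ℝ} {w : Ω → ℝ} {β K : ℝ} (hβ : 0 < β) (hβ1 : β ≤ 1) (hK : 0 ≤ K)
    (nn : ∀ x y, 0 ≤ W x y)
    (row : ∀ x, ∑ y, W x y = w x) (col : ∀ y, ∑ x, W x y = w y) (tot : ∑ x, w x = 1)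
    (emin : ∀ x y, W x y ≠ 0 → β ≤ W x y) (diag : ∀ x, w x ≠ 0 → W x x ≠ 0)
    (path : ∀ a b : Ω → ℝ, ∀ x y, w x ≠ 0 → w y ≠ 0 → |a x - a y| ≤ K * √(dsc W a b / β))
    (a b : Ω → ℝ) (ha : mn w a = 0) :
    2 * jt W a b ≤ (1 - 1 / (2 * (K + 1) ^ 2 / β)) *
      (mn w (fun x => a x ^ 2) + mn w (fun x => b x ^ 2)) := by
  have wnn : ∀ x, 0 ≤ w x := fun x => by rw [← row]; exact Finset.sum_nonneg fun y _ => nn x y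
  set d := √(dsc W a b / β) with hd
  have d0 : 0 ≤ d := Real.sqrt_nonneg _
  have dd : d ^ 2 = dsc W a b / β := Real.sq_sqrt (div_nonneg (dsc_nonneg nn a b) hβ.le)
  have ax : ∀ x, w x ≠ 0 → |a x| ≤ K * d := by
    intro x hx
    have e : a x = ∑ y, w y * (a x - a y) := by
      have : ∑ y, w y * (a x - a y) = (∑ y, w y) * a x - mn w a := by
        rw [mn, Finset.sum_mul, ← Finset.sum_sub_distrib]
        exact Finset.sum_congr rfl fun y _ => by ring
      rw [this, tot, ha]; ring
    rw [e]
    refine (Finset.abs_sum_le_sum_abs _ _).trans ?_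
    calc ∑ y, |w y * (a x - a y)| ≤ ∑ y, w y * (K * d) := by
          refine Finset.sum_le_sum fun y _ => ?_
          rw [abs_mul, abs_of_nonneg (wnn y)]
          by_cases hy : w y = 0
          · simp [hy]
          · exact mul_le_mul_of_nonneg_left (path a b x y hx hy) (wnn y)
      _ = K * d := by rw [← Finset.sum_mul, tot, one_mul]
  have bx : ∀ x, w x ≠ 0 → |b x| ≤ (K + 1) * d := by
    intro x hx
    have h1 := dsc_edge hβ nn emin a b (diag x hx)
    have h2 := ax x hx
    rw [← hd] at h1
    rw [abs_le] at h1 h2 ⊢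
    constructor <;> linarith [h1.1, h1.2, h2.1, h2.2]
  have bound : ∀ c : Ω → ℝ, (∀ x, w x ≠ 0 → |c x| ≤ (K + 1) * d) →
      mn w (fun x => c x ^ 2) ≤ ((K + 1) * d) ^ 2 := by
    intro c hc
    calc mn w (fun x => c x ^ 2) ≤ ∑ x, w x * ((K + 1) * d) ^ 2 := by
          refine Finset.sum_le_sum fun y _ => ?_
          by_cases hy : w y = 0
          · simp [hy]
          · refine mul_le_mul_of_nonneg_left ?_ (wnn y)
            exact sq_le_sq.2 ((hc y hy).trans (le_abs_self _))
      _ = _ := by rw [← Finset.sum_mul, tot, one_mul]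
  have b1 := bound a (fun x hx => (ax x hx).trans (by nlinarith))
  have b2 := bound b bx
  have e := dsc_eq row col a b
  set S := mn w (fun x => a x ^ 2) + mn w (fun x => b x ^ 2)
  have hS : S ≤ (2 * (K + 1) ^ 2 / β) * dsc W a b := by
    have : (2 * (K + 1) ^ 2 / β) * dsc W a b = 2 * ((K + 1) * d) ^ 2 := by
      rw [mul_pow, dd]; ring
    rw [this]; simp only [S]; linarith
  have hL : 0 < 2 * (K + 1) ^ 2 / β := by positivity
  have : 1 / (2 * (K + 1) ^ 2 / β) * S ≤ dsc W a b := by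
    rw [one_div, inv_mul_le_iff₀ hL]; exact hS
  have e2 : (1 - 1 / (2 * (K + 1) ^ 2 / β)) * S = S - 1 / (2 * (K + 1) ^ 2 / β) * S := by ring
  rw [e2]; linarith

/-- mixture decomposition, one marginal -/
theorem E1_mix {C : Type} [Fintype C] {n : ℕ} (p : C → ℝ) (u : C → Ω → ℝ) (w : Ω → ℝ)
    (hw : ∀ x, w x = ∑ c, p c * u c x) (f : (Fin n → Ω) → ℝ) :
    E1 (fun _ => w) f = ∑ z : Fin n → C, (∏ i, p (z i)) * E1 (fun i => u (z i)) f := by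
  classical
  unfold E1
  simp only [Finset.mul_sum]
  rw [Finset.sum_comm]
  refine Finset.sum_congr rfl fun v _ => ?_
  simp only [hw]
  rw [Finset.prod_univ_sum, Fintype.piFinset_univ, Finset.sum_mul]
  refine Finset.sum_congr rfl fun z _ => ?_
  rw [Finset.prod_mul_distrib]; ring

theorem E2_mix {C : Type} [Fintype C] {n : ℕ} (p : C → ℝ) (U : C → Ω → Ω → ℝ) (W : Ω → Ω → ℝ)
    (hW : ∀ x y, W x y = ∑ c, p c * U c x y) (f g : (Fin n → Ω) → ℝ) :
    E2 (fun _ => W) f g = ∑ z : Fin n → C, (∏ i, p (z i)) * E2 (fun i => U (z i)) f g := by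
  classical
  unfold E2
  simp only [Finset.mul_sum]
  rw [Finset.sum_comm]
  conv_rhs => rw [Finset.sum_comm]; enter [2, x]; rw [Finset.sum_comm]
  rw [Finset.sum_comm]
  refine Finset.sum_congr rfl fun x _ => Finset.sum_congr rfl fun y _ => ?_
  simp only [hW]
  rw [Finset.prod_univ_sum, Fintype.piFinset_univ, Finset.sum_mul]
  refine Finset.sum_congr rfl fun z _ => ?_
  rw [Finset.prod_mul_distrib]; ring

/-- decomposition into components -/
theorem decomp (W : Ω → Ω → ℝ) (π : Ω → ℝ) (nn : ∀ x y, 0 ≤ W x y)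
    (row : ∀ x, ∑ y, W x y = π x) (col : ∀ y, ∑ x, W x y = π y) (tot : ∑ x, π x = 1)
    (hπ : ∀ x, 0 < π x) (diag : ∀ x, 0 < W x x) :
    ∃ (C : Type) (_ : Fintype C) (p : C → ℝ) (U : C → Ω → Ω → ℝ) (u : C → Ω → ℝ) (β ρ : ℝ),
      0 < β ∧ β ≤ 1 ∧ 0 ≤ ρ ∧ ρ < 1 ∧ (∀ c, 0 ≤ p c) ∧ ∑ c, p c = 1 ∧
      (∀ c, Good β ρ (U c) (u c)) ∧ (∀ x, π x = ∑ c, p c * u c x) ∧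
      (∀ x y, W x y = ∑ c, p c * U c x y) := by
  classical
  let R : Ω → Ω → Prop := fun x y => W x y ≠ 0
  let cl : Ω → Quot R := Quot.mk R
  have clR : ∀ x y, W x y ≠ 0 → cl x = cl y := fun x y h => Quot.sound h
  letI : Fintype (Quot R) := Fintype.ofFinite _
  let p : Quot R → ℝ := fun c => ∑ x, if cl x = c then π x else 0
  let U : Quot R → Ω → Ω → ℝ := fun c x y => if cl x = c then W x y / p c else 0
  let u : Quot R → Ω → ℝ := fun c x => if cl x = c then π x / p c else 0
  have pp : ∀ c, 0 < p c := by
    intro c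
    obtain ⟨x, rfl⟩ := Quot.exists_rep c
    refine Finset.sum_pos' (fun y _ => ?_) ⟨x, Finset.mem_univ x, ?_⟩
    · split_ifs
      exacts [(hπ y).le, le_rfl]
    · have : cl x = Quot.mk R x := rfl
      simp [this, hπ x]
  have Unn : ∀ c x y, 0 ≤ U c x y := by
    intro c x y
    simp only [U]
    split_ifs
    exacts [div_nonneg (nn x y) (pp c).le, le_rfl]
  have unn : ∀ c x, 0 ≤ u c x := by
    intro c x
    simp only [u]
    split_ifs
    exacts [div_nonneg (hπ x).le (pp c).le, le_rfl]
  have ucl : ∀ c x, u c x ≠ 0 → cl x = c := by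
    intro c x h
    by_contra hc
    exact h (by simp [u, hc])
  have Ucl : ∀ c x y, U c x y ≠ 0 → cl x = c := by
    intro c x y h
    by_contra hc
    exact h (by simp [U, hc])
  have Une : ∀ c x y, cl x = c → W x y ≠ 0 → U c x y ≠ 0 := by
    intro c x y h1 h2
    simp only [U, h1, if_true]
    exact div_ne_zero h2 (pp c).ne'
  have Urow : ∀ c x, ∑ y, U c x y = u c x := by
    intro c x
    simp only [U, u]
    split_ifs
    · rw [← Finset.sum_div, row]
    · simp
  have Ucol : ∀ c y, ∑ x, U c x y = u c y := by
    intro c y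
    have : ∀ x, U c x y = if cl y = c then W x y / p c else 0 := by
      intro x
      by_cases h : W x y = 0
      · simp [U, h]
      · simp only [U, clR x y h]
    simp only [this, u]
    split_ifs
    · rw [← Finset.sum_div, col]
    · simp
  have utot : ∀ c, ∑ x, u c x = 1 := by
    intro c
    have : ∀ x, u c x = (if cl x = c then π x else 0) / p c := by
      intro x; simp only [u]; split_ifs <;> simp
    simp only [this]
    rw [← Finset.sum_div]
    exact div_self (pp c).ne'
  obtain ⟨β₁, b1, b1', hb1⟩ := exists_min (fun q : Quot R × Ω × Ω => U q.1 q.2.1 q.2.2)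
    (fun q => Unn _ _ _)
  obtain ⟨β₂, b2, b2', hb2⟩ := exists_min (fun q : Quot R × Ω => u q.1 q.2) (fun q => unn _ _)
  obtain ⟨β, hβ, hβ1, emin, wmin⟩ : ∃ β : ℝ, 0 < β ∧ β ≤ 1 ∧ (∀ c x y, U c x y ≠ 0 → β ≤ U c x y) ∧
      (∀ c x, u c x ≠ 0 → β ≤ u c x) :=
    ⟨min β₁ β₂, lt_min b1 b2, (min_le_left _ _).trans b1',
      fun c x y h => (min_le_left _ _).trans (hb1 (c, x, y) h),
      fun c x h => (min_le_right _ _).trans (hb2 (c, x) h)⟩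
  have Udiag : ∀ c x, cl x = c → U c x x ≠ 0 := fun c x h => Une c x x h (diag x).ne'
  have path1 : ∀ x y, Relation.EqvGen R x y → ∃ K : ℝ, 0 ≤ K ∧ ∀ c, cl x = c → ∀ a b : Ω → ℝ,
      |a x - a y| ≤ K * √(dsc (U c) a b / β) := by
    intro x y h
    induction h with
    | rel x y h =>
      refine ⟨2, by norm_num, ?_⟩
      intro c hc a b
      have h1 := dsc_edge hβ (Unn c) (emin c) a b (Une c x y hc h)
      have h2 := dsc_edge hβ (Unn c) (emin c) a b (Udiag c y ((clR x y h).symm.trans hc))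
      rw [abs_le] at h1 h2 ⊢
      constructor <;> linarith [h1.1, h1.2, h2.1, h2.2]
    | refl x => exact ⟨0, le_rfl, fun c hc a b => by simp⟩
    | symm x y h ih =>
      obtain ⟨K, hK, ih⟩ := ih
      refine ⟨K, hK, fun c hc a b => ?_⟩
      rw [abs_sub_comm]
      exact ih c ((Quot.eqvGen_sound h).trans hc) a b
    | trans x y z h1 h2 ih1 ih2 =>
      obtain ⟨K1, hK1, ih1⟩ := ih1
      obtain ⟨K2, hK2, ih2⟩ := ih2
      refine ⟨K1 + K2, by positivity, fun c hc a b => ?_⟩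
      have e1 := ih1 c hc a b
      have e2 := ih2 c ((Quot.eqvGen_sound h1).symm.trans hc) a b
      have := abs_sub_le (a x) (a y) (a z)
      linarith
  have path2 : ∀ q : Ω × Ω, ∃ K : ℝ, 0 ≤ K ∧ ∀ c, cl q.1 = c → cl q.2 = c → ∀ a b : Ω → ℝ,
      |a q.1 - a q.2| ≤ K * √(dsc (U c) a b / β) := by
    intro q
    by_cases h : cl q.1 = cl q.2
    · obtain ⟨K, hK, hh⟩ := path1 q.1 q.2 (Quot.eqvGen_exact h)
      exact ⟨K, hK, fun c hc _ => hh c hc⟩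
    · exact ⟨0, le_rfl, fun c h1 h2 => absurd (h1.trans h2.symm) h⟩
  choose Kf hK0 hKf using path2
  obtain ⟨K, hK, hKle⟩ : ∃ K : ℝ, 0 ≤ K ∧ ∀ q, Kf q ≤ K :=
    ⟨∑ q, Kf q, Finset.sum_nonneg fun q _ => hK0 q,
      fun q => Finset.single_le_sum (fun q _ => hK0 q) (Finset.mem_univ q)⟩
  have hL : 2 ≤ 2 * (K + 1) ^ 2 / β := by
    rw [le_div_iff₀ hβ]; nlinarith
  refine ⟨Quot R, inferInstance, p, U, u, β, 1 - 1 / (2 * (K + 1) ^ 2 / β), hβ, hβ1, ?_, ?_,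
    fun c => (pp c).le, ?_, ?_, ?_, ?_⟩
  · have : 1 / (2 * (K + 1) ^ 2 / β) ≤ 1 := by
      rw [div_le_one (by linarith)]; linarith
    linarith
  · have : 0 < 1 / (2 * (K + 1) ^ 2 / β) := by positivity
    linarith
  · simp only [p]
    rw [Finset.sum_comm]
    simpa using tot
  · intro c
    refine ⟨Unn c, Urow c, Ucol c, utot c, wmin c, emin c,
      fun x hx => Udiag c x (ucl c x hx), fun a b ha _ => ?_⟩
    refine gap_of_path hβ hβ1 hK (Unn c) (Urow c) (Ucol c) (utot c) (emin c)
      (fun x hx => Udiag c x (ucl c x hx)) ?_ a b ha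
    intro a b x y hx hy
    exact (hKf (x, y) c (ucl c x hx) (ucl c y hy) a b).trans
      (mul_le_mul_of_nonneg_right (hKle _) (Real.sqrt_nonneg _))
  · intro x
    simp only [u, mul_ite, mul_zero, Finset.sum_ite_eq, Finset.mem_univ, if_true]
    rw [mul_div_cancel₀ _ (pp _).ne']
  · intro x y
    simp only [U, mul_ite, mul_zero, Finset.sum_ite_eq, Finset.mem_univ, if_true]
    rw [mul_div_cancel₀ _ (pp _).ne']

theorem hitting (W : Ω → Ω → ℝ) (π : Ω → ℝ) (nn : ∀ x y, 0 ≤ W x y)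
    (row : ∀ x, ∑ y, W x y = π x) (col : ∀ y, ∑ x, W x y = π y) (tot : ∑ x, π x = 1)
    (hπ : ∀ x, 0 < π x) (diag : ∀ x, 0 < W x x) (μ : ℝ) (hμ : 0 < μ) :
    ∃ δ : ℝ, 0 < δ ∧ ∀ (n : ℕ) (f : (Fin n → Ω) → ℝ), (∀ v, f v ∈ Set.Icc (0:ℝ) 1) →
      μ ≤ E1 (fun _ => π) f → δ ≤ E2 (fun _ => W) f f := by
  obtain ⟨C, _, p, U, u, β, ρ, hβ, hβ1, hρ, hρ1, hp, hp1, hG, hu, hU⟩ :=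
    decomp W π nn row col tot hπ diag
  obtain ⟨δ, hδ, hA⟩ := lemA Ω β ρ hβ hβ1 hρ hρ1 (μ / 2) (by positivity)
  refine ⟨δ * (μ / 2), by positivity, ?_⟩
  intro n f hf h1
  rw [E1_mix p u π hu f] at h1
  rw [E2_mix p U W hU f f]
  have one : ∑ z : Fin n → C, ∏ i, p (z i) = 1 := by
    classical
    have := Finset.prod_univ_sum (fun _ : Fin n => (Finset.univ : Finset C)) (fun _ c => p c)
    rw [Fintype.piFinset_univ] at this
    rw [← this]; simp [hp1]
  have key : ∑ z : Fin n → C, (∏ i, p (z i)) * (δ * (E1 (fun i => u (z i)) f - μ / 2))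
      ≤ ∑ z : Fin n → C, (∏ i, p (z i)) * E2 (fun i => U (z i)) f f := by
    refine Finset.sum_le_sum fun z _ => mul_le_mul_of_nonneg_left ?_
      (Finset.prod_nonneg fun i _ => hp _)
    have g : ∀ i, Good β ρ (U (z i)) (u (z i)) := fun i => hG _
    have e1 : E1 (fun i => u (z i)) f ≤ 1 := E1_le_one g (fun v => (hf v).2)
    by_cases hz : μ / 2 ≤ E1 (fun i => u (z i)) f
    · have := hA g f hf hz
      nlinarith
    · have : 0 ≤ E2 (fun i => U (z i)) f f := E2_nonneg g (fun v => (hf v).1) (fun v => (hf v).1)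
      push Not at hz
      nlinarith
  refine le_trans ?_ key
  have e : ∑ z : Fin n → C, (∏ i, p (z i)) * (δ * (E1 (fun i => u (z i)) f - μ / 2))
      = δ * (∑ z : Fin n → C, (∏ i, p (z i)) * E1 (fun i => u (z i)) f)
        - δ * (μ / 2) * ∑ z : Fin n → C, ∏ i, p (z i) := by
    rw [Finset.mul_sum, Finset.mul_sum, ← Finset.sum_sub_distrib]
    exact Finset.sum_congr rfl fun z _ => by ring
  rw [e, one]
  nlinarith

theorem sum_two {A : Type} [Fintype A] (H : (Fin 2 → A) → ℝ) :
    ∑ x, H x = ∑ a, ∑ b, H ![a, b] := by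
  rw [← (finTwoArrowEquiv A).symm.sum_comp, Fintype.sum_prod_type]
  rfl
end reduction

/-- a two-step distribution with equal marginals is same-set hitting
iff `α(P) = min_x P(x,x) > 0`. -/
theorem two_step_same_set_hitting_classification
    {Ω : Type} [Fintype Ω]
    (P : (Fin 2 → Ω) → ℝ) (π : Ω → ℝ)
    (hP : IsDist P) (hm : HasMarginals P π) (hπ : ∀ a : Ω, 0 < π a) :
    (∀ μ : ℝ, μ ∈ Set.Ioc (0:ℝ) 1 →
      ∃ δ : ℝ, δ ∈ Set.Ioc (0:ℝ) 1 ∧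
        ∀ n : ℕ, 1 ≤ n →
        ∀ f : (Fin n → Ω) → ℝ, (∀ v, f v ∈ Set.Icc (0:ℝ) 1) →
          μ ≤ exps π f →
          δ ≤ prodExp P (fun _ => f))
    ↔ (∀ x : Ω, 0 < P (fun _ => x)) := by
  have toE2 : ∀ (n : ℕ) (f : (Fin n → Ω) → ℝ),
      prodExp P (fun _ => f) = E2 (fun _ x y => P ![x, y]) f f := by
    intro n f
    unfold prodExp E2
    rw [sum_two]
    refine Finset.sum_congr rfl fun x _ => Finset.sum_congr rfl fun y _ => ?_
    have e : ∀ i : Fin n, (fun j : Fin 2 => (![x, y] : Fin 2 → Fin n → Ω) j i) = ![x i, y i] := by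
      intro i; funext j; fin_cases j <;> rfl
    simp only [e, Fin.prod_univ_two]
    rfl
  have cst : ∀ x : Ω, (fun _ : Fin 2 => x) = ![x, x] := by
    intro x; funext j; fin_cases j <;> rfl
  have row : ∀ x, ∑ y, P ![x, y] = π x := by
    intro x
    rw [← hm 0 x, marginal, sum_two]
    symm
    rw [Finset.sum_eq_single x]
    · simp
    · intro b _ hb; simp [hb]
    · simp
  have col : ∀ y, ∑ x, P ![x, y] = π y := by
    intro y
    rw [← hm 1 y, marginal, sum_two]
    refine Finset.sum_congr rfl fun x _ => ?_
    symm
    rw [Finset.sum_eq_single y]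
    · simp
    · intro b _ hb; simp [hb]
    · simp
  have tot : ∑ x, π x = 1 := by
    rw [← hP.2, sum_two]
    exact Finset.sum_congr rfl fun x _ => (row x).symm
  constructor
  · intro H x
    classical
    by_contra hx
    have hx0 : P ![x, x] = 0 := by
      rw [← cst]; exact le_antisymm (not_lt.1 hx) (hP.1 _)
    have hle : π x ≤ 1 := by
      rw [← tot]; exact Finset.single_le_sum (fun y _ => (hπ y).le) (Finset.mem_univ x)
    obtain ⟨δ, hδ, h⟩ := H (π x) ⟨hπ x, hle⟩
    have h1 := h 1 le_rfl (fun v => if v 0 = x then 1 else 0)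
      (fun v => by split_ifs <;> simp) ?_
    · rw [toE2] at h1
      have : E2 (n := 1) (fun _ x y => P ![x, y]) (fun v => if v 0 = x then 1 else 0)
          (fun v => if v 0 = x then 1 else 0) = 0 := by
        unfold E2
        refine Finset.sum_eq_zero fun a _ => Finset.sum_eq_zero fun b _ => ?_
        by_cases ha : a 0 = x
        · by_cases hb : b 0 = x
          · simp [ha, hb, hx0]
          · simp [hb]
        · simp [ha]
      rw [this] at h1
      exact absurd hδ.1 (not_lt.2 h1)
    · unfold exps
      refine le_trans (le_of_eq ?_) (Finset.single_le_sum (fun v _ => mul_nonneg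
        (Finset.prod_nonneg fun i _ => (hπ _).le) (by split_ifs <;> simp))
        (Finset.mem_univ (fun _ : Fin 1 => x)))
      simp
  · intro hd μ hμ
    obtain ⟨δ, hδ, h⟩ := hitting (fun x y => P ![x, y]) π (fun x y => hP.1 _) row col tot hπ
      (fun x => by rw [← cst]; exact hd x) μ hμ.1
    refine ⟨min δ 1, ⟨lt_min hδ one_pos, min_le_right _ _⟩, ?_⟩
    intro n _ f hf hE
    rw [toE2]
    exact (min_le_left _ _).trans (h n f hf hE)


end SameSetHitting
end
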